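/- arXiv:2102.05777 — 2 statements merged into one kernel-verified Lean document; each statement's English description precedes it below -/
import Mathlib

section
/- There exist universal constants C and D such that for every finite set E ⊂ ℝ² there is a map ℰ : C²₊(E) × [0,∞) → C²₊(ℝ²) with the following two properties. (A) For every M ≥ 0 and every f ∈ C²₊(E) with ‖f‖_{C²₊(E)} ≤ M, the function ℰ(f,M) satisfies ℰ(f,M)(x) = f(x) for all x ∈ E, ℰ(f,M) ≥ 0 on ℝ², and ‖ℰ(f,M)‖_{C²(ℝ²)} ≤ C·M. (B) For each x ∈ ℝ² there exists a set S(x) ⊆ E with #S(x) ≤ D such that for all M ≥ 0 and all f, g ∈ C²₊(E) with ‖f‖_{C²₊(E)} ≤ M, ‖g‖_{C²₊(E)} ≤ M and f = g on S(x), one has ∂^α ℰ(f,M)(x) = ∂^α ℰ(g,M)(x) for every multi-index α with |α| ≤ 2. -/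
/-- The plane `ℝ²`. -/
abbrev E2 := EuclideanSpace ℝ (Fin 2)

/-- `F` is twice continuously differentiable with all derivatives of order `≤ 2`
bounded (in norm) by `M`; this encodes `‖F‖_{C²(ℝ²)} ≤ M`. -/
def C2BddBy (F : E2 → ℝ) (M : ℝ) : Prop :=
  ContDiff ℝ 2 F ∧ ∀ x : E2, ∀ i : ℕ, i ≤ 2 → ‖iteratedFDeriv ℝ i F x‖ ≤ M

/-- The trace norm `‖f‖_{C²₊(E)}`: the infimum of `‖F‖_{C²(ℝ²)}` over all
nonnegative `C²` extensions `F` of `f`. -/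
noncomputable def posTraceNorm (E : Set E2) (f : E2 → ℝ) : ℝ :=
  sInf {M : ℝ | 0 ≤ M ∧ ∃ F : E2 → ℝ,
    (∀ y, 0 ≤ F y) ∧ (∀ x ∈ E, F x = f x) ∧ C2BddBy F M}

/-- The conditions, with constant `K`, that the values `f` and gradients `t` on `E` of a
nonnegative `C²` function satisfy. -/
structure IsNonnegField (E : Set E2) (K : ℝ) (f : E2 → ℝ) (t : E2 → E2) : Prop where
  taylor : ∀ x ∈ E, ∀ y ∈ E, |f y - f x - inner ℝ (t x) (y - x)| ≤ K * ‖y - x‖ ^ 2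
  lip : ∀ x ∈ E, ∀ y ∈ E, ‖t y - t x‖ ≤ K * ‖y - x‖
  sq_le : ∀ x ∈ E, ‖t x‖ ^ 2 ≤ 4 * K * f x
  nonneg : ∀ x ∈ E, 0 ≤ f x
  le : ∀ x ∈ E, f x ≤ K
  norm_le : ∀ x ∈ E, ‖t x‖ ≤ K

theorem C2BddBy.lipschitz_fderiv {F : E2 → ℝ} {K : ℝ} (h : C2BddBy F K) (x y : E2) :
    ‖fderiv ℝ F y - fderiv ℝ F x‖ ≤ K * ‖y - x‖ := by
  have hd : ContDiff ℝ 1 (fderiv ℝ F) := h.1.fderiv_right (by norm_num)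
  refine convex_univ.norm_image_sub_le_of_norm_fderiv_le (𝕜 := ℝ)
    (fun z _ => hd.differentiable (by norm_num) z) (fun z _ => ?_) (Set.mem_univ x) (Set.mem_univ y)
  have := h.2 z 2 le_rfl
  rwa [← norm_iteratedFDeriv_fderiv, norm_iteratedFDeriv_one] at this

theorem C2BddBy.taylor {F : E2 → ℝ} {K : ℝ} (h : C2BddBy F K) (x y : E2) :
    |F y - F x - fderiv ℝ F x (y - x)| ≤ K * ‖y - x‖ ^ 2 := by
  have hd : Differentiable ℝ F := h.1.differentiable (by norm_num)
  have hK : 0 ≤ K := (norm_nonneg _).trans (h.2 x 0 (by norm_num))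
  have := (convex_closedBall x ‖y - x‖).norm_image_sub_le_of_norm_fderiv_le' (𝕜 := ℝ)
    (f := F) (φ := fderiv ℝ F x) (C := K * ‖y - x‖) (fun z _ => hd z) (fun z hz => ?_)
    (x := x) (y := y) (by simp) (by simp [dist_eq_norm])
  · rw [Real.norm_eq_abs] at this
    linarith [this, show K * ‖y - x‖ * ‖y - x‖ = K * ‖y - x‖ ^ 2 by ring]
  · refine (h.lipschitz_fderiv x z).trans ?_
    rw [mem_closedBall_iff_norm] at hz
    gcongr

theorem C2BddBy.isNonnegField {F : E2 → ℝ} {K : ℝ} (h : C2BddBy F K) (h0 : ∀ y, 0 ≤ F y)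
    (E : Set E2) : IsNonnegField E K F (gradient F) := by
  have hin : ∀ x v, inner ℝ (gradient F x) v = fderiv ℝ F x v := fun x v => by
    simp [gradient, InnerProductSpace.toDual_symm_apply]
  have hT : ∀ x y, |F y - F x - inner ℝ (gradient F x) (y - x)| ≤ K * ‖y - x‖ ^ 2 := fun x y => by
    rw [hin]; exact h.taylor x y
  refine ⟨fun x _ y _ => hT x y, fun x _ y _ => ?_, fun x _ => ?_, fun x _ => h0 x, fun x _ => ?_,
    fun x _ => ?_⟩
  · rw [gradient, gradient, ← map_sub, LinearIsometryEquiv.norm_map]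
    exact h.lipschitz_fderiv x y
  · set v := gradient F x
    have key : ∀ s : ℝ, 0 ≤ K * ‖v‖ ^ 2 * (s * s) + ‖v‖ ^ 2 * s + F x := fun s => by
      have h1 := (abs_le.1 (hT x (x + s • v))).2
      rw [add_sub_cancel_left, inner_smul_right, real_inner_self_eq_norm_sq, norm_smul, mul_pow,
        Real.norm_eq_abs, sq_abs] at h1
      nlinarith [h0 (x + s • v)]
    have := discrim_le_zero key
    rw [discrim] at this
    by_cases hv : ‖v‖ ^ 2 = 0
    · rw [hv]
      have hK : 0 ≤ K := (norm_nonneg _).trans (h.2 x 0 (by norm_num))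
      have := h0 x
      positivity
    · have : 0 < ‖v‖ ^ 2 := by positivity
      by_contra! hc
      nlinarith
  · have := h.2 x 0 (by norm_num)
    rw [norm_iteratedFDeriv_zero] at this
    exact (le_abs_self _).trans this
  · have := h.2 x 1 (by norm_num)
    rwa [norm_iteratedFDeriv_one, ← LinearIsometryEquiv.norm_map
      (InnerProductSpace.toDual ℝ E2).symm] at this

theorem E2.norm_sq_eq (v : E2) : ‖v‖ ^ 2 = v 0 ^ 2 + v 1 ^ 2 := by
  rw [EuclideanSpace.norm_sq_eq]; simp

theorem E2.inner_eq (v w : E2) : inner ℝ v w = v 0 * w 0 + v 1 * w 1 := by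
  simp [PiLp.inner_apply]; ring

theorem E2.abs_apply_le (v : E2) (k : Fin 2) : |v k| ≤ ‖v‖ := by
  simpa using PiLp.norm_apply_le v k

/-- A separated family of points in a disc of comparable radius has bounded cardinality. -/
theorem finite_and_ncard_le_of_separated {A : Set E2} {x : E2} {r : ℝ} (hr : 0 < r)
    (hx : ∀ i ∈ A, dist x i ≤ 42 * r) (hA : A.Pairwise fun i j => r ≤ dist i j) :
    A.Finite ∧ A.ncard ≤ 171 ^ 2 := by
  let c : E2 → ℤ × ℤ := fun i => (⌊(i - x) 0 / (r / 2)⌋, ⌊(i - x) 1 / (r / 2)⌋)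
  let B : Finset (ℤ × ℤ) := Finset.Icc (-85) 85 ×ˢ Finset.Icc (-85) 85
  have hr2 : 0 < r / 2 := by positivity
  have hmem : ∀ i ∈ A, ∀ k : Fin 2, ⌊(i - x) k / (r / 2)⌋ ∈ Finset.Icc (-85 : ℤ) 85 := by
    intro i hi k
    have h1 := (E2.abs_apply_le (i - x) k).trans
      ((dist_eq_norm i x).symm.trans_le ((dist_comm i x).trans_le (hx i hi)))
    rw [abs_le] at h1
    rw [Finset.mem_Icc]
    constructor
    · rw [Int.le_floor, le_div_iff₀ hr2]; push_cast; linarith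
    · rw [← Int.lt_add_one_iff, Int.floor_lt, div_lt_iff₀ hr2]; push_cast; linarith
  have hmaps : Set.MapsTo c A B := fun i hi => by
    simp only [B, Finset.coe_product, Set.mem_prod, Finset.mem_coe, c]
    exact ⟨hmem i hi 0, hmem i hi 1⟩
  have hinj : Set.InjOn c A := by
    intro i hi j hj hij
    by_contra hne
    have hsep : r ≤ dist i j := hA hi hj hne
    have hk : ∀ k : Fin 2, ⌊(i - x) k / (r / 2)⌋ = ⌊(j - x) k / (r / 2)⌋ →
        |(i - j) k| < r / 2 := fun k hk => by
      have := Int.abs_sub_lt_one_of_floor_eq_floor hk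
      rw [← sub_div, abs_div, abs_of_pos hr2, div_lt_one hr2] at this
      simpa using this
    obtain ⟨h0, h1⟩ := Prod.mk.inj hij
    have h0 := hk 0 h0
    have h1 := hk 1 h1
    rw [dist_eq_norm] at hsep
    have h2 := E2.norm_sq_eq (i - j)
    nlinarith [abs_nonneg ((i - j) 0), abs_nonneg ((i - j) 1), sq_abs ((i - j) 0),
      sq_abs ((i - j) 1)]
  refine ⟨B.finite_toSet.of_injOn hmaps hinj, ?_⟩
  calc A.ncard ≤ (B : Set (ℤ × ℤ)).ncard := Set.ncard_le_ncard_of_injOn c hmaps hinj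
    _ = 171 ^ 2 := by rw [Set.ncard_coe_finset]; simp [B]

/-- A net of points whose local spacing is comparable to a Lipschitz length scale. -/
theorem exists_net {ρ : E2 → ℝ} (hpos : ∀ x, 0 < ρ x) (hlip : ∀ x y, ρ x ≤ ρ y + dist x y) :
    ∃ I : Set E2, (I.Pairwise fun i j => ρ i / 8 ≤ dist i j) ∧
      ∀ x, ∃ i ∈ I, dist x i ≤ ρ i / 4 := by
  obtain ⟨I, hI⟩ := zorn_subset {S : Set E2 | S.Pairwise fun i j => ρ i / 8 ≤ dist i j}
    fun c hc hchain => ⟨⋃₀ c, (Set.pairwise_sUnion hchain.directedOn).2 fun s hs => hc hs,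
      fun s hs => Set.subset_sUnion_of_mem hs⟩
  refine ⟨I, hI.prop, fun x => ?_⟩
  by_contra! hfar
  have hxI : x ∉ I := fun hx => by
    have := hfar x hx
    rw [dist_self] at this
    linarith [hpos x]
  refine hxI (hI.le_of_ge (y := insert x I) ?_ (Set.subset_insert x I) (Set.mem_insert x I))
  refine hI.prop.insert_of_notMem hxI fun i hi => ?_
  have h1 := hfar i hi
  have h2 := hlip x i
  rw [dist_comm i x]
  constructor <;> linarith [hpos i]

theorem net_local_bound {ρ : E2 → ℝ} (hpos : ∀ x, 0 < ρ x) (hlip : ∀ x y, ρ x ≤ ρ y + dist x y)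
    {I : Set E2} (hI : I.Pairwise fun i j => ρ i / 8 ≤ dist i j) (x : E2) :
    {i ∈ I | dist x i ≤ 3 / 4 * ρ i}.Finite ∧
      {i ∈ I | dist x i ≤ 3 / 4 * ρ i}.ncard ≤ 171 ^ 2 := by
  refine finite_and_ncard_le_of_separated (x := x) (r := ρ x / 14) (by linarith [hpos x]) ?_ ?_
  · rintro i ⟨-, hi⟩
    have := hlip i x
    rw [dist_comm i x] at this
    linarith
  · rintro i ⟨hi, hxi⟩ j ⟨hj, -⟩ hij
    have := hI hi hj hij
    have := hlip x i
    linarith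

/-- A `C²` partition of unity subordinate to balls of radius comparable to the length scale `ρ`;
near `x` only the functions with index in `J x` are active. -/
structure IsLocalPartition (N : ℕ) (C : ℝ) (ρ : E2 → ℝ) (θ : E2 → E2 → ℝ)
    (J : E2 → Finset E2) : Prop where
  contDiff : ∀ i, ContDiff ℝ 2 (θ i)
  nonneg : ∀ i x, 0 ≤ θ i x
  sum_eq_one : ∀ x, ∑ i ∈ J x, θ i x = 1
  card_le : ∀ x, (J x).card ≤ N
  dist_le : ∀ x, ∀ i ∈ J x, dist x i ≤ 3 / 4 * ρ i
  mem_of_ne_zero : ∀ x y, dist y x < ρ x / 8 → ∀ i, θ i y ≠ 0 → i ∈ J x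
  norm_deriv_le : ∀ i x, ∀ k ≤ 2, ‖iteratedFDeriv ℝ k (θ i) x‖ ≤ C / ρ x ^ k

theorem exists_bump : ∃ b : E2 → ℝ, ∃ B : ℝ, 0 ≤ B ∧ ContDiff ℝ 2 b ∧ (∀ x, 0 ≤ b x) ∧
    (∀ x, ‖x‖ ≤ 1 / 4 → b x = 1) ∧ (∀ x, 1 / 2 ≤ ‖x‖ → b x = 0) ∧ (∀ x, b x ≤ 1) ∧
    ∀ x, ∀ k ≤ 2, ‖iteratedFDeriv ℝ k b x‖ ≤ B := by
  let φ : ContDiffBump (0 : E2) := ⟨1 / 4, 1 / 2, by norm_num, by norm_num⟩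
  have hφ : ContDiff ℝ 2 φ := φ.contDiff
  have hbd : ∀ k : ℕ, ∃ B, ∀ x, k ≤ 2 → ‖iteratedFDeriv ℝ k φ x‖ ≤ B := fun k => by
    by_cases hk : k ≤ 2
    · obtain ⟨B, hB⟩ := (hφ.continuous_iteratedFDeriv (m := k)
        (by exact_mod_cast hk)).bounded_above_of_compact_support
        (φ.hasCompactSupport.iteratedFDeriv k)
      exact ⟨B, fun x _ => hB x⟩
    · exact ⟨0, fun x h => absurd h hk⟩
  choose B hB using hbd
  refine ⟨φ, max (B 0) (max (B 1) (B 2)), ?_, hφ, fun x => φ.nonneg,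
    fun x hx => φ.one_of_mem_closedBall (by rw [mem_closedBall_zero_iff]; exact hx),
    fun x hx => φ.zero_of_le_dist (by rw [dist_zero_right]; exact hx), fun x => φ.le_one, fun x k hk => ?_⟩
  · exact le_max_of_le_left ((norm_nonneg _).trans (hB 0 0 (by norm_num)))
  · refine (hB k x hk).trans ?_
    interval_cases k <;> simp

theorem norm_iteratedFDeriv_comp_scale_le {b : E2 → ℝ} {B : ℝ} (hb : ContDiff ℝ 2 b)
    (hB : ∀ x, ∀ k ≤ 2, ‖iteratedFDeriv ℝ k b x‖ ≤ B) (hB0 : 0 ≤ B) {r : ℝ} (hr : 0 < r) (i x : E2)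
    {k : ℕ} (hk : k ≤ 2) :
    ‖iteratedFDeriv ℝ k (fun y => b (r⁻¹ • (y - i))) x‖ ≤ 2 * B / r ^ k := by
  have hg : ContDiff ℝ 2 fun y : E2 => r⁻¹ • (y - i) := by fun_prop
  have h := norm_iteratedFDeriv_comp_le (𝕜 := ℝ) hb hg (n := k) (by exact_mod_cast hk) x (C := B)
    (D := r⁻¹) (fun j hj => hB _ j (hj.trans hk)) ?_
  · refine h.trans ?_
    rw [inv_pow, ← div_eq_mul_inv]
    gcongr
    have : (k.factorial : ℝ) ≤ (2 : ℕ).factorial := by exact_mod_cast Nat.factorial_le hk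
    simpa using this
  · have hf : fderiv ℝ (fun y : E2 => r⁻¹ • (y - i)) =
        fun _ => r⁻¹ • ContinuousLinearMap.id ℝ E2 := by
      funext z
      rw [fderiv_fun_const_smul (by fun_prop), fderiv_sub_const, fderiv_fun_id]
    intro j hj1 hj2
    obtain rfl | rfl : j = 1 ∨ j = 2 := by omega
    · rw [norm_iteratedFDeriv_one, hf, norm_smul, pow_one, Real.norm_of_nonneg (by positivity)]
      exact mul_le_of_le_one_right (by positivity) ContinuousLinearMap.norm_id_le
    · rw [← norm_iteratedFDeriv_fderiv, norm_iteratedFDeriv_one, hf]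
      simp only [fderiv_fun_const, Pi.zero_apply, norm_zero]
      positivity

theorem exists_bound_iteratedFDerivWithin_inv (N : ℝ) : ∃ B : ℝ, 0 ≤ B ∧ ∀ t ∈ Set.Icc 1 N, ∀ k ≤ 2,
    ‖iteratedFDerivWithin ℝ k (fun s : ℝ => s⁻¹) (Set.Ioi 0) t‖ ≤ B := by
  have hc : ContDiffOn ℝ 2 (fun s : ℝ => s⁻¹) (Set.Ioi 0) :=
    contDiffOn_id.inv fun s hs => ne_of_gt hs
  have hbd : ∀ k : ℕ, ∃ B, ∀ t ∈ Set.Icc 1 N, k ≤ 2 →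
      ‖iteratedFDerivWithin ℝ k (fun s : ℝ => s⁻¹) (Set.Ioi 0) t‖ ≤ B := fun k => by
    by_cases hk : k ≤ 2
    · obtain ⟨B, hB⟩ := isCompact_Icc.exists_bound_of_continuousOn
        ((hc.continuousOn_iteratedFDerivWithin (m := k) (by exact_mod_cast hk)
          (uniqueDiffOn_Ioi 0)).mono
          (fun t ht => lt_of_lt_of_le one_pos ht.1 : Set.Icc 1 N ⊆ Set.Ioi 0))
      exact ⟨B, fun x hx _ => hB x hx⟩
    · exact ⟨0, fun _ _ h => absurd h hk⟩
  choose B hB using hbd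
  refine ⟨max 0 (max (B 0) (max (B 1) (B 2))), le_max_left _ _, fun t ht k hk => ?_⟩
  refine (hB k t ht hk).trans ?_
  interval_cases k <;> simp

/-- Derivative bounds for the reciprocal of a function with values in `[1, N]`. -/
theorem exists_norm_iteratedFDeriv_inv_le (N B : ℝ) (hB : 1 ≤ B) : ∃ C : ℝ, 0 ≤ C ∧
    ∀ (Φ : E2 → ℝ) (r : ℝ) (x : E2), 0 < r → ContDiff ℝ 2 Φ → (∀ y, 1 ≤ Φ y) → Φ x ≤ N →
      (∀ k ≤ 2, ‖iteratedFDeriv ℝ k Φ x‖ ≤ B / r ^ k) →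
      ∀ k ≤ 2, ‖iteratedFDeriv ℝ k (fun y => (Φ y)⁻¹) x‖ ≤ C / r ^ k := by
  obtain ⟨A, hA0, hA⟩ := exists_bound_iteratedFDerivWithin_inv N
  refine ⟨2 * A * B ^ 2, by positivity, fun Φ r x hr hΦ h1 hN hd k hk => ?_⟩
  have hc : ContDiffOn ℝ 2 (fun s : ℝ => s⁻¹) (Set.Ioi 0) :=
    contDiffOn_id.inv fun s hs => ne_of_gt hs
  have h := norm_iteratedFDerivWithin_comp_le (𝕜 := ℝ) hc hΦ.contDiffOn
    (n := k) (by exact_mod_cast hk) (uniqueDiffOn_Ioi 0) uniqueDiffOn_univ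
    (fun y _ => lt_of_lt_of_le one_pos (h1 y)) (Set.mem_univ x) (C := A) (D := B / r)
    (fun j hj => hA _ ⟨h1 x, hN⟩ j (hj.trans hk)) ?_
  · rw [iteratedFDerivWithin_univ] at h
    refine h.trans ?_
    rw [div_pow, mul_div_assoc]
    have h2 : (k.factorial : ℝ) ≤ (2 : ℕ).factorial := by exact_mod_cast Nat.factorial_le hk
    have h3 : B ^ k ≤ B ^ 2 := pow_le_pow_right₀ hB hk
    have h2 : (k.factorial : ℝ) ≤ 2 := by simpa using h2
    rw [← mul_div_assoc, ← mul_div_assoc]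
    gcongr
  · intro j hj1 hj2
    rw [iteratedFDerivWithin_univ, div_pow]
    refine (hd j (hj2.trans hk)).trans ?_
    gcongr
    exact le_self_pow₀ hB (by omega)

theorem norm_iteratedFDeriv_mul_le_of_scale {u v : E2 → ℝ} (hu : ContDiff ℝ 2 u)
    (hv : ContDiff ℝ 2 v) {x : E2} {r A B : ℝ} (hr : 0 < r) (hA : 0 ≤ A) (m : ℤ)
    (hB : ∀ k ≤ 2, ‖iteratedFDeriv ℝ k u x‖ ≤ A / r ^ k)
    (hC : ∀ k ≤ 2, ‖iteratedFDeriv ℝ k v x‖ ≤ B * r ^ (m - k)) {k : ℕ} (hk : k ≤ 2) :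
    ‖iteratedFDeriv ℝ k (fun y => u y * v y) x‖ ≤ 4 * A * B * r ^ (m - k) := by
  have hB0 : 0 ≤ B := by
    have := (norm_nonneg _).trans (hC 0 (by norm_num))
    exact nonneg_of_mul_nonneg_left this (by positivity)
  refine (norm_iteratedFDeriv_mul_le hu hv x (n := k) (by exact_mod_cast hk)).trans ?_
  calc ∑ j ∈ Finset.range (k + 1), (k.choose j : ℝ) * ‖iteratedFDeriv ℝ j u x‖ *
        ‖iteratedFDeriv ℝ (k - j) v x‖
      ≤ ∑ j ∈ Finset.range (k + 1), (k.choose j : ℝ) * (A * B * r ^ (m - k)) := by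
        refine Finset.sum_le_sum fun j hj => ?_
        have hjk : j ≤ k := Nat.lt_succ_iff.1 (Finset.mem_range.1 hj)
        have h1 := hB j (hjk.trans hk)
        have h2 := hC (k - j) (by omega)
        have h3 : A * B * r ^ (m - k) = A / r ^ j * (B * r ^ (m - ((k - j : ℕ) : ℤ))) := by
          rw [show m - ((k - j : ℕ) : ℤ) = (m - k) + (j : ℤ) by omega, zpow_add₀ hr.ne',
            zpow_natCast]
          field_simp
        rw [h3, mul_assoc]
        gcongr
    _ = 2 ^ k * (A * B * r ^ (m - k)) := by
        rw [← Finset.sum_mul]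
        congr 1
        exact_mod_cast Nat.sum_range_choose k
    _ ≤ 4 * (A * B * r ^ (m - k)) := by
        gcongr
        calc (2 : ℝ) ^ k ≤ 2 ^ 2 := pow_le_pow_right₀ (by norm_num) hk
          _ = 4 := by norm_num
    _ = _ := by ring

theorem exists_localPartition : ∃ (N : ℕ) (C : ℝ), 0 ≤ C ∧ ∀ ρ : E2 → ℝ, (∀ x, 0 < ρ x) →
    (∀ x y, ρ x ≤ ρ y + dist x y) → ∃ θ J, IsLocalPartition N C ρ θ J := by
  classical
  obtain ⟨b, B, hB0, hb, hbn, hb1, hb0, hble, hbB⟩ := exists_bump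
  let N : ℕ := 171 ^ 2
  obtain ⟨A, hA0, hA⟩ := exists_norm_iteratedFDeriv_inv_le N (1 + N * (32 * B))
    (by have : 0 ≤ (N : ℝ) * (32 * B) := by positivity
        linarith)
  refine ⟨N, 4 * (32 * B) * A, by positivity, fun ρ hpos hlip => ?_⟩
  obtain ⟨I, hI, hcov⟩ := exists_net hpos hlip
  have hfin := fun x => (net_local_bound hpos hlip hI x).1
  let J : E2 → Finset E2 := fun x => (hfin x).toFinset
  have hJ : ∀ x i, i ∈ J x ↔ i ∈ I ∧ dist x i ≤ 3 / 4 * ρ i := fun x i => by simp [J]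
  let φ : E2 → E2 → ℝ := fun i x => if i ∈ I then b ((ρ i)⁻¹ • (x - i)) else 0
  have hφc : ∀ i, ContDiff ℝ 2 (φ i) := fun i => by
    by_cases hi : i ∈ I
    · simp only [φ, hi, if_true]
      exact hb.comp (by fun_prop)
    · simp only [φ, hi, if_false]
      exact contDiff_const
  have hφn : ∀ i x, 0 ≤ φ i x := fun i x => by
    simp only [φ]; split_ifs
    exacts [hbn _, le_rfl]
  have hφle : ∀ i x, φ i x ≤ 1 := fun i x => by
    simp only [φ]; split_ifs
    exacts [hble _, zero_le_one]
  have hφJ : ∀ x y, dist y x < ρ x / 8 → ∀ i, φ i y ≠ 0 → i ∈ J x := by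
    intro x y hxy i hi
    simp only [φ] at hi
    split_ifs at hi with hiI
    · have h1 : ‖(ρ i)⁻¹ • (y - i)‖ < 1 / 2 := lt_of_not_ge fun h => hi (hb0 _ h)
      rw [norm_smul, Real.norm_of_nonneg (by have := hpos i; positivity), inv_mul_lt_iff₀ (hpos i),
        ← dist_eq_norm] at h1
      refine (hJ x i).2 ⟨hiI, ?_⟩
      have h2 := hlip x i
      have h3 := dist_triangle_left x i y
      linarith [hpos i]
    · exact absurd rfl hi
  have hφJ' : ∀ x i, φ i x ≠ 0 → i ∈ J x := fun x => hφJ x x (by simpa using hpos x)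
  have hρJ : ∀ x i, i ∈ J x → ρ x ≤ 4 * ρ i := fun x i hi => by
    have := ((hJ x i).1 hi).2
    have := hlip x i
    linarith [hpos i]
  have hφd : ∀ i x, ∀ k ≤ 2, ‖iteratedFDeriv ℝ k (φ i) x‖ ≤ 32 * B / ρ x ^ k := by
    intro i x k hk
    by_cases hi : i ∈ J x
    · have h1 := norm_iteratedFDeriv_comp_scale_le hb hbB hB0 (hpos i) i x hk
      simp only [φ, ((hJ x i).1 hi).1, if_true]
      refine h1.trans ?_
      rw [div_le_div_iff₀ (by have := hpos i; positivity) (by have := hpos x; positivity)]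
      have h2 : ρ x ^ k ≤ (4 * ρ i) ^ k := by
        have := hρJ x i hi
        have := (hpos x).le
        gcongr
      have h3 : (4 : ℝ) ^ k ≤ 4 ^ 2 := pow_le_pow_right₀ (by norm_num) hk
      calc 2 * B * ρ x ^ k ≤ 2 * B * (4 * ρ i) ^ k := by gcongr
        _ = 2 * B * 4 ^ k * ρ i ^ k := by rw [mul_pow]; ring
        _ ≤ 2 * B * 4 ^ 2 * ρ i ^ k := by have := (hpos i).le; gcongr
        _ = _ := by ring
    · have : φ i =ᶠ[nhds x] fun _ => 0 := by
        filter_upwards [Metric.ball_mem_nhds x (show 0 < ρ x / 8 by linarith [hpos x])] with y hy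
        by_contra h
        exact hi (hφJ x y hy i h)
      rw [(this.iteratedFDeriv ℝ k).eq_of_nhds]
      have h0 : iteratedFDeriv ℝ k (fun _ : E2 => (0 : ℝ)) x = 0 := by simp
      rw [h0, norm_zero]
      have := hpos x
      positivity
  let Φ : E2 → ℝ := fun x => ∑ i ∈ J x, φ i x
  have hΦloc : ∀ x y, dist y x < ρ x / 8 → Φ y = ∑ i ∈ J x, φ i y := by
    intro x y hxy
    exact Finset.sum_congr_of_eq_on_inter (fun i _ hi => by_contra fun h => hi (hφJ x y hxy i h))
      (fun i _ hi => by_contra fun h => hi (hφJ' y i h)) (fun _ _ _ => rfl)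
  have hΦev : ∀ x, Φ =ᶠ[nhds x] fun y => ∑ i ∈ J x, φ i y := fun x => by
    filter_upwards [Metric.ball_mem_nhds x (show 0 < ρ x / 8 by linarith [hpos x])] with y hy
    exact hΦloc x y hy
  have hΦc : ContDiff ℝ 2 Φ := contDiff_iff_contDiffAt.2 fun x =>
    (ContDiff.sum fun i _ => hφc i).contDiffAt.congr_of_eventuallyEq (hΦev x)
  have hcard : ∀ x, (J x).card ≤ N := fun x => by
    have := (net_local_bound hpos hlip hI x).2
    rwa [Set.ncard_eq_toFinset_card _ (hfin x)] at this
  have hΦ1 : ∀ x, 1 ≤ Φ x := fun x => by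
    obtain ⟨i, hiI, hi⟩ := hcov x
    have h1 : φ i x = 1 := by
      simp only [φ, hiI, if_true]
      apply hb1
      rw [norm_smul, Real.norm_of_nonneg (by have := hpos i; positivity), inv_mul_le_iff₀ (hpos i),
        ← dist_eq_norm]
      linarith
    rw [← h1]
    exact Finset.single_le_sum (f := fun i => φ i x) (fun i _ => hφn i x)
      (hφJ' x i (by rw [h1]; exact one_ne_zero))
  have hΦN : ∀ x, Φ x ≤ N := fun x => by
    calc Φ x ≤ ∑ i ∈ J x, (1 : ℝ) := Finset.sum_le_sum fun i _ => hφle i x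
      _ = (J x).card := by simp
      _ ≤ N := by exact_mod_cast hcard x
  have hΦd : ∀ x, ∀ k ≤ 2, ‖iteratedFDeriv ℝ k Φ x‖ ≤ (1 + N * (32 * B)) / ρ x ^ k := by
    intro x k hk
    have hp : 0 < ρ x ^ k := pow_pos (hpos x) k
    rw [((hΦev x).iteratedFDeriv ℝ k).eq_of_nhds, iteratedFDeriv_fun_sum_apply
      fun i _ => ((hφc i).of_le (by exact_mod_cast hk)).contDiffAt]
    calc ‖∑ i ∈ J x, iteratedFDeriv ℝ k (φ i) x‖
        ≤ ∑ i ∈ J x, 32 * B / ρ x ^ k := norm_sum_le_of_le _ fun i _ => hφd i x k hk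
      _ = (J x).card * (32 * B / ρ x ^ k) := by simp
      _ ≤ N * (32 * B / ρ x ^ k) := by
        gcongr
        exact hcard x
      _ ≤ _ := by
        rw [← mul_div_assoc]
        gcongr
        linarith
  have hinv : ContDiff ℝ 2 fun y => (Φ y)⁻¹ := hΦc.inv fun y => by linarith [hΦ1 y]
  refine ⟨fun i y => φ i y * (Φ y)⁻¹, J, fun i => (hφc i).mul hinv,
    fun i x => mul_nonneg (hφn i x) (inv_nonneg.2 (by linarith [hΦ1 x])), fun x => ?_, hcard,
    fun x i hi => ((hJ x i).1 hi).2, fun x y hxy i hi => hφJ x y hxy i (left_ne_zero_of_mul hi),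
    fun i x k hk => ?_⟩
  · rw [← Finset.sum_mul]
    exact mul_inv_cancel₀ (by linarith [hΦ1 x])
  · have h1 := norm_iteratedFDeriv_mul_le_of_scale (hφc i) hinv (hpos x)
      (show 0 ≤ 32 * B by positivity) (m := 0) (B := A) (hφd i x) (fun k hk => ?_) hk
    · rwa [zero_sub, zpow_neg, zpow_natCast, ← div_eq_mul_inv] at h1
    · have := hA Φ (ρ x) x (hpos x) hΦc hΦ1 (hΦN x) (hΦd x) k hk
      rwa [zero_sub, zpow_neg, zpow_natCast, ← div_eq_mul_inv]

/-- The function obtained by gluing the local functions `P i` with the weights `θ i`. -/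
noncomputable def patch (θ : E2 → E2 → ℝ) (J : E2 → Finset E2) (P : E2 → E2 → ℝ) : E2 → ℝ :=
  fun y => ∑ i ∈ J y, θ i y * P i y

namespace IsLocalPartition

variable {N : ℕ} {C : ℝ} {ρ : E2 → ℝ} {θ : E2 → E2 → ℝ} {J : E2 → Finset E2}

theorem mem_self (h : IsLocalPartition N C ρ θ J) (hpos : ∀ x, 0 < ρ x) {x i : E2}
    (hi : θ i x ≠ 0) : i ∈ J x :=
  h.mem_of_ne_zero x x (by simpa using hpos x) i hi

theorem sum_smul_eq {V : Type*} [AddCommGroup V] [Module ℝ V] (h : IsLocalPartition N C ρ θ J)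
    (hpos : ∀ x, 0 < ρ x) {x y : E2} (hxy : dist y x < ρ x / 8) (c : E2 → V) :
    ∑ i ∈ J y, θ i y • c i = ∑ i ∈ J x, θ i y • c i := by
  classical
  refine Finset.sum_congr_of_eq_on_inter (fun i _ hi => ?_) (fun i _ hi => ?_) (fun _ _ _ => rfl)
  · rw [show θ i y = 0 from by_contra fun hn => hi (h.mem_of_ne_zero x y hxy i hn), zero_smul]
  · rw [show θ i y = 0 from by_contra fun hn => hi (h.mem_self hpos hn), zero_smul]

theorem sum_eq_one_of_dist_lt (h : IsLocalPartition N C ρ θ J) (hpos : ∀ x, 0 < ρ x) {x y : E2}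
    (hxy : dist y x < ρ x / 8) : ∑ i ∈ J x, θ i y = 1 := by
  have := h.sum_smul_eq hpos hxy fun _ => (1 : ℝ)
  simp only [smul_eq_mul, mul_one] at this
  rw [← this, h.sum_eq_one]

theorem patch_eventuallyEq (h : IsLocalPartition N C ρ θ J) (hpos : ∀ x, 0 < ρ x)
    (P : E2 → E2 → ℝ) (x : E2) :
    patch θ J P =ᶠ[nhds x] fun y => ∑ i ∈ J x, θ i y * P i y := by
  filter_upwards [Metric.ball_mem_nhds x (show 0 < ρ x / 8 by linarith [hpos x])] with y hy
  exact h.sum_smul_eq hpos hy fun i => P i y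

theorem contDiff_patch (h : IsLocalPartition N C ρ θ J) (hpos : ∀ x, 0 < ρ x)
    {P : E2 → E2 → ℝ} (hP : ∀ i, ContDiff ℝ 2 (P i)) : ContDiff ℝ 2 (patch θ J P) :=
  contDiff_iff_contDiffAt.2 fun x =>
    (ContDiff.sum fun i _ => (h.contDiff i).mul (hP i)).contDiffAt.congr_of_eventuallyEq
      (h.patch_eventuallyEq hpos P x)

theorem norm_iteratedFDeriv_patch_le (h : IsLocalPartition N C ρ θ J) (hpos : ∀ x, 0 < ρ x)
    (hC : 0 ≤ C) {P : E2 → E2 → ℝ} (hP : ∀ i, ContDiff ℝ 2 (P i)) {R : E2 → ℝ}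
    (hR : ContDiff ℝ 2 R) {A : ℝ} {x : E2} (hx : ρ x ≤ 1)
    (hRA : ∀ k ≤ 2, ‖iteratedFDeriv ℝ k R x‖ ≤ A)
    (hPA : ∀ i ∈ J x, ∀ k : ℕ, k ≤ 2 →
      ‖iteratedFDeriv ℝ k (fun y => P i y - R y) x‖ ≤ A * ρ x ^ ((2 : ℤ) - k))
    {k : ℕ} (hk : k ≤ 2) :
    ‖iteratedFDeriv ℝ k (patch θ J P) x‖ ≤ (1 + 4 * N * C) * A := by
  have hA : 0 ≤ A := (norm_nonneg _).trans (hRA 0 (by norm_num))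
  have hloc : patch θ J P =ᶠ[nhds x] fun y => R y + ∑ i ∈ J x, θ i y * (P i y - R y) := by
    filter_upwards [h.patch_eventuallyEq hpos P x,
      Metric.ball_mem_nhds x (show 0 < ρ x / 8 by linarith [hpos x])] with y hy hyx
    have h1 := h.sum_eq_one_of_dist_lt hpos hyx
    rw [hy]
    simp only [mul_sub, Finset.sum_sub_distrib, ← Finset.sum_mul, h1]
    ring
  have hterm : ∀ i, ContDiff ℝ 2 fun y => θ i y * (P i y - R y) := fun i =>
    (h.contDiff i).mul ((hP i).sub hR)
  have hk2 : (k : WithTop ℕ∞) ≤ 2 := by exact_mod_cast hk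
  rw [(hloc.iteratedFDeriv ℝ k).eq_of_nhds,
    fun_iteratedFDeriv_add_apply (hR.of_le hk2).contDiffAt
      ((ContDiff.sum fun i _ => hterm i).of_le hk2).contDiffAt,
    iteratedFDeriv_fun_sum_apply fun i _ => ((hterm i).of_le hk2).contDiffAt]
  have h2 : ∀ i ∈ J x, ‖iteratedFDeriv ℝ k (fun y => θ i y * (P i y - R y)) x‖ ≤ 4 * C * A := by
    intro i hi
    refine (norm_iteratedFDeriv_mul_le_of_scale (h.contDiff i) ((hP i).sub hR) (hpos x) hC 2
      (h.norm_deriv_le i x) (hPA i hi) hk).trans ?_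
    refine mul_le_of_le_one_right (by positivity) ?_
    rw [show (2 : ℤ) - k = ((2 - k : ℕ) : ℤ) by omega, zpow_natCast]
    exact pow_le_one₀ (hpos x).le hx
  calc _ ≤ A + ∑ i ∈ J x, 4 * C * A :=
        (norm_add_le _ _).trans (add_le_add (hRA k hk) (norm_sum_le_of_le _ h2))
    _ = A + (J x).card * (4 * C * A) := by simp
    _ ≤ A + N * (4 * C * A) := by gcongr; exact h.card_le x
    _ = _ := by ring

end IsLocalPartition

/-- The quadratic polynomial `c + ⟪v, y - a⟫ + m ‖y - a‖²`. -/
noncomputable def quad (a : E2) (c : ℝ) (v : E2) (m : ℝ) : E2 → ℝ :=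
  fun y => c + inner ℝ v (y - a) + m * ‖y - a‖ ^ 2

theorem contDiff_quad (a : E2) (c : ℝ) (v : E2) (m : ℝ) : ContDiff ℝ 2 (quad a c v m) := by
  unfold quad
  exact (contDiff_const.add (contDiff_const.inner ℝ (contDiff_id.sub contDiff_const))).add
    (contDiff_const.mul ((contDiff_id.sub contDiff_const).norm_sq ℝ))

theorem quad_recenter (a x : E2) (c : ℝ) (v : E2) (m : ℝ) :
    quad a c v m = quad x (quad a c v m x) (v + (2 * m) • (x - a)) m := by
  funext y
  simp only [quad, E2.norm_sq_eq, E2.inner_eq, PiLp.add_apply, PiLp.sub_apply, PiLp.smul_apply,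
    smul_eq_mul]
  ring

theorem quad_sub (x : E2) (c c' : ℝ) (v v' : E2) (m m' : ℝ) :
    (fun y => quad x c v m y - quad x c' v' m' y) = quad x (c - c') (v - v') (m - m') := by
  funext y
  simp only [quad, inner_sub_left]
  ring

theorem quad_nonneg {a v : E2} {c m : ℝ} (hm : 0 < m) (h : ‖v‖ ^ 2 ≤ 4 * m * c) (y : E2) :
    0 ≤ quad a c v m y := by
  have h1 := (abs_le.1 (abs_real_inner_le_norm v (y - a))).1
  have h2 : 0 ≤ 4 * m * (c - ‖v‖ * ‖y - a‖ + m * ‖y - a‖ ^ 2) := by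
    nlinarith [sq_nonneg (‖v‖ - 2 * m * ‖y - a‖)]
  have h3 := nonneg_of_mul_nonneg_right h2 (by positivity)
  simp only [quad]
  linarith

theorem fderiv_quad (a : E2) (c : ℝ) (v : E2) (m : ℝ) :
    fderiv ℝ (quad a c v m) = fun y => innerSL ℝ v + (2 * m) • innerSL ℝ (y - a) := by
  funext y
  have h1 : HasFDerivAt (fun y => inner ℝ v (y - a)) (innerSL ℝ v) y :=
    (innerSL ℝ v).hasFDerivAt.comp y ((hasFDerivAt_id y).sub_const a)
  have h2 := ((hasFDerivAt_id (𝕜 := ℝ) y).sub_const a).norm_sq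
  have h3 := ((h1.const_add c).add (h2.const_mul m)).fderiv
  refine h3.trans ?_
  ext w
  simp
  ring

theorem norm_iteratedFDeriv_quad_le {a : E2} {c : ℝ} {v : E2} {m A r : ℝ} (hA : 0 ≤ A)
    (hc : |c| ≤ A * r ^ 2) (hv : ‖v‖ ≤ A * r) (hm : 2 * |m| ≤ A) {k : ℕ} (hk : k ≤ 2) :
    ‖iteratedFDeriv ℝ k (quad a c v m) a‖ ≤ A * r ^ ((2 : ℤ) - k) := by
  interval_cases k
  · simpa [norm_iteratedFDeriv_zero, quad] using hc
  · rw [norm_iteratedFDeriv_one, fderiv_quad]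
    simpa using hv
  · rw [← norm_iteratedFDeriv_fderiv, norm_iteratedFDeriv_one, fderiv_quad]
    have h1 : HasFDerivAt (fun y : E2 => innerSL ℝ v + (2 * m) • innerSL ℝ (y - a))
        ((2 * m) • (innerSL ℝ : E2 →L[ℝ] E2 →L[ℝ] ℝ)) a :=
      ((((innerSL ℝ : E2 →L[ℝ] E2 →L[ℝ] ℝ)).hasFDerivAt.comp a
        ((hasFDerivAt_id a).sub_const a)).const_smul (2 * m)).const_add _
    rw [h1.fderiv]
    simp only [Nat.cast_ofNat, sub_self, zpow_zero, mul_one]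
    refine ContinuousLinearMap.opNorm_le_bound _ hA fun w => ?_
    have h2 : ‖((2 * m) • (innerSL ℝ : E2 →L[ℝ] E2 →L[ℝ] ℝ)) w‖ = 2 * |m| * ‖w‖ := by
      rw [smul_apply, norm_smul, innerSL_apply_norm, Real.norm_eq_abs, abs_mul,
        abs_two]
    rw [h2]
    gcongr

theorem exists_whitneyScale {E : Set E2} (hE : E.Finite) :
    ∃ ρ : E2 → ℝ, (∀ x, 0 < ρ x) ∧ (∀ x y, ρ x ≤ ρ y + dist x y) ∧ (∀ x, ρ x ≤ 1) ∧
      (∀ x, Metric.infDist x E ≤ 2 → Metric.infDist x E ≤ 2 * ρ x) ∧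
      (∀ x, 2 < Metric.infDist x E → ρ x = 1) ∧
      ∀ i, ∀ x ∈ E, dist x i ≤ 3 / 4 * ρ i → ∀ a ∈ E, dist i a = Metric.infDist i E → a = x := by
  obtain ⟨ε, hε0, hε1, hε⟩ : ∃ ε : ℝ, 0 < ε ∧ ε ≤ 1 ∧ ∀ a ∈ E, ∀ b ∈ E, a ≠ b → 2 * ε ≤ dist a b := by
    by_cases hn : E.Nontrivial
    · have h := hE.infsep_pos_iff_nontrivial.2 hn
      refine ⟨min 1 (E.infsep / 2), lt_min one_pos (by positivity), min_le_left _ _,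
        fun a ha b hb hab => ?_⟩
      have h1 := E.infsep_le_dist_of_mem ha hb hab
      have h2 := min_le_right 1 (E.infsep / 2)
      linarith
    · exact ⟨1, one_pos, le_rfl, fun a ha b hb hab => absurd ⟨a, ha, b, hb, hab⟩ hn⟩
  refine ⟨fun x => min 1 (max ε (Metric.infDist x E / 2)),
    fun x => lt_min one_pos (lt_max_of_lt_left hε0), fun x y => ?_, fun x => min_le_left _ _,
    fun x hx => ?_, fun x hx => ?_, fun i x hx hxi a ha hia => ?_⟩
  · have h1 : Metric.infDist x E ≤ Metric.infDist y E + dist x y := Metric.infDist_le_infDist_add_dist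
    have h0 : 0 ≤ dist x y := dist_nonneg
    rw [← min_add_add_right, ← max_add_add_right]
    refine min_le_min (by linarith) (max_le_max (by linarith) (by linarith))
  · have : Metric.infDist x E / 2 ≤ min 1 (max ε (Metric.infDist x E / 2)) :=
      le_min (by linarith) (le_max_right _ _)
    linarith
  · exact min_eq_left (le_max_of_le_right (by linarith))
  · beta_reduce at hxi
    have h1 : Metric.infDist i E ≤ dist i x := Metric.infDist_le_dist_of_mem hx
    rw [dist_comm i x] at h1
    have h2 : min 1 (max ε (Metric.infDist i E / 2)) ≤ ε := by
      refine (min_le_right _ _).trans (max_le le_rfl ?_)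
      by_contra! hc
      have h3 := min_le_right 1 (max ε (Metric.infDist i E / 2))
      rw [max_eq_right hc.le] at h3
      have h4 : dist x i ≤ 3 / 4 * (Metric.infDist i E / 2) := by
        rw [max_eq_right hc.le] at hxi
        linarith
      linarith
    by_contra hax
    have h3 := hε a ha x hx hax
    have h4 := dist_triangle_left a x i
    rw [dist_comm i x] at h4
    linarith

/-- Linear extension of first-order Whitney data from a finite set, with nonnegativity and bounded
depth. -/
theorem exists_whitneyExtension : ∃ (D : ℕ) (C : ℝ), 0 < C ∧ ∀ E : Set E2, E.Finite → E.Nonempty →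
    ∃ W : ℝ → (E2 → ℝ) → (E2 → E2) → E2 → ℝ,
      (∀ L > 0, ∀ f g, IsNonnegField E L f g →
        (∀ x ∈ E, W L f g x = f x) ∧ (∀ y, 0 ≤ W L f g y) ∧ C2BddBy (W L f g) (C * L)) ∧
      ∀ x, ∃ A : Finset E2, ↑A ⊆ E ∧ A.card ≤ D ∧ ∀ L f f' g g', (∀ a ∈ A, f a = f' a) →
        (∀ a ∈ A, g a = g' a) → W L f g =ᶠ[nhds x] W L f' g' := by
  classical
  obtain ⟨N, C, hC, hpart⟩ := exists_localPartition
  refine ⟨N, (1 + 4 * N * C) * 2200, by positivity, fun E hE hne => ?_⟩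
  obtain ⟨ρ, hpos, hlip, hle, hnear, hfar, hsep⟩ := exists_whitneyScale hE
  obtain ⟨θ, J, hθ⟩ := hpart ρ hpos hlip
  have hproj : ∀ i, ∃ a ∈ E, dist i a = Metric.infDist i E := fun i => by
    obtain ⟨a, ha, h⟩ := hE.isCompact.exists_infDist_eq_dist hne i
    exact ⟨a, ha, h.symm⟩
  choose a haE ha using hproj
  let P : ℝ → (E2 → ℝ) → (E2 → E2) → E2 → E2 → ℝ := fun L f g i =>
    if Metric.infDist i E ≤ 2 then quad (a i) (f (a i)) (g (a i)) L else fun _ => 0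
  refine ⟨fun L f g => patch θ J (P L f g), fun L hL f g hfg => ?_, fun x => ?_⟩
  · have hPc : ∀ i, ContDiff ℝ 2 (P L f g i) := fun i => by
      simp only [P]; split_ifs
      exacts [contDiff_quad _ _ _ _, contDiff_const]
    refine ⟨fun x hx => ?_, fun y => ?_, hθ.contDiff_patch hpos hPc, fun x k hk => ?_⟩
    · have h1 : ∀ i ∈ J x, θ i x * P L f g i x = θ i x * f x := fun i hi => by
        have hxi := hθ.dist_le x i hi
        have hax := hsep i x hx hxi (a i) (haE i) (ha i)
        have h2 : Metric.infDist i E ≤ 2 := by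
          have h3 : Metric.infDist i E ≤ dist i x := Metric.infDist_le_dist_of_mem hx
          rw [dist_comm] at h3
          linarith [hle i]
        simp only [P, h2, if_true, hax]
        simp [quad]
      change ∑ i ∈ J x, θ i x * P L f g i x = f x
      rw [Finset.sum_congr rfl h1, ← Finset.sum_mul, hθ.sum_eq_one, one_mul]
    · refine Finset.sum_nonneg fun i _ => mul_nonneg (hθ.nonneg i y) ?_
      simp only [P]; split_ifs
      exacts [quad_nonneg hL (hfg.sq_le _ (haE i)) y, le_rfl]
    · set r := ρ x
      have hr0 : 0 < r := hpos x
      have hr1 : r ≤ 1 := hle x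
      have hrJ : ∀ i ∈ J x, ρ i ≤ 4 * r := fun i hi => by
        have h1 := hθ.dist_le x i hi
        have h2 := hlip i x
        rw [dist_comm i x] at h2
        linarith
      have hdist : ∀ i ∈ J x, Metric.infDist i E ≤ 2 → ‖x - a i‖ ≤ 11 * r := fun i hi h2 => by
        have h3 := dist_triangle x i (a i)
        rw [ha i] at h3
        rw [← dist_eq_norm]
        linarith [hθ.dist_le x i hi, hrJ i hi, hnear i h2]
      have hrec : ∀ i, quad (a i) (f (a i)) (g (a i)) L = quad x
          (quad (a i) (f (a i)) (g (a i)) L x) (g (a i) + (2 * L) • (x - a i)) L :=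
        fun i => quad_recenter _ _ _ _ _
      have hval : ∀ i, ‖x - a i‖ ≤ 11 * r →
          |quad (a i) (f (a i)) (g (a i)) L x| ≤ 133 * L ∧
          ‖g (a i) + (2 * L) • (x - a i)‖ ≤ 23 * L := fun i hi => by
        have h0 := norm_nonneg (x - a i)
        have h1 := hfg.norm_le _ (haE i)
        have h2 := hfg.nonneg _ (haE i)
        have h3 := hfg.le _ (haE i)
        have h4 : |inner ℝ (g (a i)) (x - a i)| ≤ L * 11 := (abs_real_inner_le_norm _ _).trans
          (mul_le_mul h1 (by linarith) h0 hL.le)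
        have h5 : ‖x - a i‖ ^ 2 ≤ 11 ^ 2 := by gcongr; linarith
        rw [abs_le] at h4
        constructor
        · rw [quad, abs_le]
          constructor <;> nlinarith [sq_nonneg ‖x - a i‖]
        · refine (norm_add_le _ _).trans ?_
          rw [norm_smul, Real.norm_of_nonneg (by positivity)]
          nlinarith
      have hdir : ∀ i, ‖x - a i‖ ≤ 11 * r → ∀ k ≤ 2,
          ‖iteratedFDeriv ℝ k (quad (a i) (f (a i)) (g (a i)) L) x‖ ≤ 133 * L := fun i hi k hk => by
        obtain ⟨h1, h2⟩ := hval i hi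
        rw [hrec i]
        have := norm_iteratedFDeriv_quad_le (a := x) (A := 133 * L) (r := 1) (by positivity)
          (by simpa using h1) (by linarith : ‖g (a i) + (2 * L) • (x - a i)‖ ≤ 133 * L * 1)
          (by rw [abs_of_pos hL]; linarith : 2 * |L| ≤ 133 * L) hk
        simpa using this
      have hC' : (1 + 4 * N * C) * 2200 * L = (1 + 4 * N * C) * (2200 * L) := by ring
      rw [hC']
      by_cases hall : ∀ i ∈ J x, Metric.infDist i E ≤ 2
      · obtain ⟨j, hj⟩ : (J x).Nonempty := by
          by_contra h
          have := hθ.sum_eq_one x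
          rw [Finset.not_nonempty_iff_eq_empty.1 h] at this
          simp at this
        have hjr := hdist j hj (hall j hj)
        refine hθ.norm_iteratedFDeriv_patch_le hpos hC hPc
          (contDiff_quad (a j) (f (a j)) (g (a j)) L) (A := 2200 * L) (x := x) hr1
          (fun k hk => (hdir j hjr k hk).trans (by linarith)) (fun i hi k hk => ?_) hk
        have hir := hdist i hi (hall i hi)
        simp only [P, hall i hi, if_true]
        rw [hrec i, hrec j, quad_sub, sub_self]
        have hij : ‖a i - a j‖ ≤ 22 * r := by
          rw [show a i - a j = (x - a j) - (x - a i) by abel]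
          exact (norm_sub_le _ _).trans (by linarith)
        have hg : ‖g (a i) - g (a j)‖ ≤ 22 * L * r := by
          have := hfg.lip _ (haE j) _ (haE i)
          nlinarith
        have hLr : 0 < L * r := by positivity
        refine norm_iteratedFDeriv_quad_le (by positivity) ?_ ?_ (by simp [hL.le]) hk
        · have e : quad (a i) (f (a i)) (g (a i)) L x - quad (a j) (f (a j)) (g (a j)) L x =
              (f (a i) - f (a j) - inner ℝ (g (a j)) (a i - a j)) +
              inner ℝ (g (a i) - g (a j)) (x - a i) + L * (‖x - a i‖ ^ 2 - ‖x - a j‖ ^ 2) := by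
            simp only [quad, inner_sub_left, inner_sub_right]
            ring
          have h1 : |f (a i) - f (a j) - inner ℝ (g (a j)) (a i - a j)| ≤ L * (22 * r) ^ 2 :=
            (hfg.taylor _ (haE j) _ (haE i)).trans (by gcongr)
          have h2 : |inner ℝ (g (a i) - g (a j)) (x - a i)| ≤ 22 * L * r * (11 * r) :=
            (abs_real_inner_le_norm _ _).trans (by gcongr)
          have h3 : ‖x - a i‖ ^ 2 ≤ (11 * r) ^ 2 := by gcongr
          have h4 : ‖x - a j‖ ^ 2 ≤ (11 * r) ^ 2 := by gcongr
          have h5 : |L * (‖x - a i‖ ^ 2 - ‖x - a j‖ ^ 2)| ≤ L * (11 * r) ^ 2 := by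
            rw [abs_mul, abs_of_pos hL]
            gcongr
            rw [abs_le]
            constructor <;> nlinarith [sq_nonneg ‖x - a i‖, sq_nonneg ‖x - a j‖]
          rw [e]
          refine (abs_add_three _ _ _).trans ((add_le_add_three h1 h2 h5).trans ?_)
          nlinarith [mul_pos hLr hr0]
        · have e : g (a i) + (2 * L) • (x - a i) - (g (a j) + (2 * L) • (x - a j)) =
              (g (a i) - g (a j)) - (2 * L) • (a i - a j) := by
            simp only [smul_sub]; abel
          rw [e]
          refine (norm_sub_le _ _).trans ?_
          rw [norm_smul, Real.norm_of_nonneg (by positivity)]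
          nlinarith
      · push Not at hall
        obtain ⟨j, hj, hj2⟩ := hall
        have hr4 : 1 / 4 ≤ r := by
          have := hrJ j hj
          rw [hfar j hj2] at this
          linarith
        refine hθ.norm_iteratedFDeriv_patch_le hpos hC hPc (R := fun _ => 0)
          contDiff_const (A := 2200 * L) (x := x) hr1
          (fun k hk => ?_) (fun i hi k hk => ?_) hk
        · simp only [iteratedFDeriv_fun_zero, Pi.zero_apply, norm_zero]
          positivity
        · simp only [sub_zero]
          have h0 : 0 < L * r ^ ((2 : ℤ) - k) := by positivity
          have h1 : 1 / 16 ≤ r ^ ((2 : ℤ) - k) := by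
            rw [show (2 : ℤ) - k = ((2 - k : ℕ) : ℤ) by omega, zpow_natCast]
            calc (1 / 16 : ℝ) = (1 / 4) ^ 2 := by norm_num
              _ ≤ (1 / 4) ^ (2 - k) := pow_le_pow_of_le_one (by norm_num) (by norm_num) (by omega)
              _ ≤ _ := by gcongr
          simp only [P]
          split_ifs with h2
          · refine (hdir i (hdist i hi h2) k hk).trans ?_
            nlinarith
          · simp only [iteratedFDeriv_fun_zero, Pi.zero_apply, norm_zero]
            positivity
  · refine ⟨(J x).image a, ?_, Finset.card_image_le.trans (hθ.card_le x), ?_⟩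
    · intro y hy
      obtain ⟨i, -, rfl⟩ := Finset.mem_image.1 (Finset.mem_coe.1 hy)
      exact haE i
    · intro L f f' g g' hf hg
      refine ((hθ.patch_eventuallyEq hpos _ x).trans ?_).trans
        (hθ.patch_eventuallyEq hpos _ x).symm
      refine Filter.EventuallyEq.of_eq (funext fun y => Finset.sum_congr rfl fun i hi => ?_)
      have hm := Finset.mem_image_of_mem a hi
      simp only [P, hf _ hm, hg _ hm]

/-- The oriented area spanned by two vectors of the plane. -/
def cross (v w : E2) : ℝ := v 0 * w 1 - v 1 * w 0

theorem cross_smul_left (c : ℝ) (v w : E2) : cross (c • v) w = c * cross v w := by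
  simp only [cross, PiLp.smul_apply, smul_eq_mul]; ring

theorem cross_smul_right (c : ℝ) (v w : E2) : cross v (c • w) = c * cross v w := by
  simp only [cross, PiLp.smul_apply, smul_eq_mul]; ring

theorem abs_cross_le (v w : E2) : |cross v w| ≤ ‖v‖ * ‖w‖ := by
  refine abs_le_of_sq_le_sq ?_ (by positivity)
  rw [mul_pow, E2.norm_sq_eq, E2.norm_sq_eq, cross]
  nlinarith [sq_nonneg (v 0 * w 0 + v 1 * w 1)]

theorem norm_mul_abs_cross_le {v a b : E2} {s : ℝ} (ha : |inner ℝ v a| ≤ s * ‖a‖)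
    (hb : |inner ℝ v b| ≤ s * ‖b‖) : ‖v‖ * |cross a b| ≤ 2 * s * (‖a‖ * ‖b‖) := by
  have h1 := abs_real_inner_le_norm a b
  have hs : 0 ≤ s * ‖a‖ * ‖b‖ := mul_nonneg ((abs_nonneg _).trans ha) (norm_nonneg b)
  refine le_of_sq_le_sq ?_ (by nlinarith)
  have e : (‖v‖ * |cross a b|) ^ 2 = inner ℝ v a ^ 2 * ‖b‖ ^ 2 + inner ℝ v b ^ 2 * ‖a‖ ^ 2
      - 2 * (inner ℝ v a * inner ℝ v b * inner ℝ a b) := by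
    rw [mul_pow, sq_abs, E2.norm_sq_eq, E2.norm_sq_eq, E2.norm_sq_eq, cross, E2.inner_eq,
      E2.inner_eq, E2.inner_eq]
    ring
  have h2 : inner ℝ v a ^ 2 * ‖b‖ ^ 2 ≤ (s * ‖a‖ * ‖b‖) ^ 2 := by
    rw [← sq_abs (inner ℝ v a), ← mul_pow]; gcongr
  have h3 : inner ℝ v b ^ 2 * ‖a‖ ^ 2 ≤ (s * ‖a‖ * ‖b‖) ^ 2 := by
    rw [← sq_abs (inner ℝ v b), ← mul_pow]
    calc (|inner ℝ v b| * ‖a‖) ^ 2 ≤ (s * ‖b‖ * ‖a‖) ^ 2 := by gcongr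
      _ = _ := by ring
  have h4 : |inner ℝ v a * inner ℝ v b * inner ℝ a b| ≤ (s * ‖a‖ * ‖b‖) ^ 2 := by
    rw [abs_mul, abs_mul]
    calc _ ≤ (s * ‖a‖) * (s * ‖b‖) * (‖a‖ * ‖b‖) := by
          have := (abs_nonneg _).trans ha
          have := (abs_nonneg _).trans hb
          gcongr
      _ = _ := by ring
  rw [e]
  nlinarith [neg_abs_le (inner ℝ v a * inner ℝ v b * inner ℝ a b)]

/-- The component of `v` orthogonal to the unit vector `u`. -/
noncomputable def perp (u v : E2) : E2 := v - inner ℝ v u • u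

theorem perp_sub (u v w : E2) : perp u (v - w) = perp u v - perp u w := by
  simp only [perp, inner_sub_left, sub_smul]; abel

theorem norm_perp_le {u : E2} (hu : ‖u‖ = 1) (v : E2) : ‖perp u v‖ ≤ ‖v‖ := by
  refine le_of_sq_le_sq ?_ (norm_nonneg v)
  rw [perp, norm_sub_sq_real, norm_smul, hu, inner_smul_right, mul_one, Real.norm_eq_abs, sq_abs]
  nlinarith [sq_nonneg (inner ℝ v u)]

theorem norm_perp_sub_perp_le {u u' : E2} (hu : ‖u‖ = 1) (hu' : ‖u'‖ = 1) (v : E2) :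
    ‖perp u v - perp u' v‖ ≤ |cross u u'| * ‖v‖ := by
  refine le_of_sq_le_sq ?_ (by positivity)
  have h1 : perp u v - perp u' v = inner ℝ v u' • u' - inner ℝ v u • u := by
    simp only [perp]; abel
  have h2 : u 0 ^ 2 + u 1 ^ 2 = 1 := by rw [← E2.norm_sq_eq, hu, one_pow]
  have h3 : u' 0 ^ 2 + u' 1 ^ 2 = 1 := by rw [← E2.norm_sq_eq, hu', one_pow]
  have h4 : ‖v‖ ^ 2 * (‖u‖ ^ 2 * ‖u'‖ ^ 2) - ‖v‖ ^ 2 * inner ℝ u u' ^ 2 =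
      inner ℝ v u ^ 2 * ‖u'‖ ^ 2 + inner ℝ v u' ^ 2 * ‖u‖ ^ 2
      - 2 * (inner ℝ v u * inner ℝ v u' * inner ℝ u u') := by
    simp only [E2.norm_sq_eq, E2.inner_eq]
    ring
  have h5 : cross u u' ^ 2 = ‖u‖ ^ 2 * ‖u'‖ ^ 2 - inner ℝ u u' ^ 2 := by
    simp only [E2.norm_sq_eq, E2.inner_eq, cross]
    ring
  rw [h1, mul_pow, sq_abs, norm_sub_sq_real, norm_smul, norm_smul, inner_smul_left,
    inner_smul_right, real_inner_comm u u', h5, mul_pow, mul_pow]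
  simp only [hu, hu', Real.norm_eq_abs, sq_abs, conj_trivial, one_pow, mul_one] at h4 ⊢
  linarith

theorem abs_inner_perp_le {u : E2} (hu : ‖u‖ = 1) (v w : E2) :
    |inner ℝ (perp u v) w| ≤ ‖v‖ * |cross u w| := by
  have h1 : inner ℝ v w * ‖u‖ ^ 2 - inner ℝ v u * inner ℝ u w = cross u v * cross u w := by
    simp only [E2.norm_sq_eq, E2.inner_eq, cross]
    ring
  have h2 : inner ℝ (perp u v) w = cross u v * cross u w := by
    rw [perp, inner_sub_left, real_inner_smul_left, ← h1, hu, one_pow, mul_one]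
  rw [h2, abs_mul]
  have := abs_cross_le u v
  rw [hu, one_mul] at this
  gcongr

/-- The infimum of finitely many cones, truncated at height one. -/
theorem exists_min_cone {ι : Type*} (s : Finset ι) (a : ι → ℝ) (p : ι → E2)
    (ha : ∀ i ∈ s, 0 < a i) : ∃ ρ : E2 → ℝ, (∀ x, 0 < ρ x) ∧ (∀ x y, ρ x ≤ ρ y + dist x y) ∧
      (∀ x, ρ x ≤ 1) ∧ (∀ i ∈ s, ∀ x, ρ x ≤ a i + dist x (p i)) ∧
      ∀ x, ρ x = 1 ∨ ∃ i ∈ s, ρ x = a i + dist x (p i) := by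
  classical
  induction s using Finset.induction_on with
  | empty => exact ⟨fun _ => 1, by simp⟩
  | insert j s _ ih =>
    obtain ⟨ρ, h0, hl, h1, hs, hr⟩ := ih fun i hi => ha i (Finset.mem_insert_of_mem hi)
    have hj := ha j (Finset.mem_insert_self j s)
    refine ⟨fun x => min (ρ x) (a j + dist x (p j)), fun x => lt_min (h0 x) (by positivity),
      fun x y => ?_, fun x => (min_le_left _ _).trans (h1 x), fun i hi x => ?_, fun x => ?_⟩
    · rw [← min_add_add_right]
      refine min_le_min (hl x y) ?_
      have := dist_triangle x y (p j)
      linarith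
    · obtain rfl | hi := Finset.mem_insert.1 hi
      · exact min_le_right _ _
      · exact (min_le_left _ _).trans (hs i hi x)
    · beta_reduce
      obtain h | h := min_choice (ρ x) (a j + dist x (p j))
      · rw [h]
        obtain h' | ⟨i, hi, h'⟩ := hr x
        exacts [Or.inl h', Or.inr ⟨i, Finset.mem_insert_of_mem hi, h'⟩]
      · exact Or.inr ⟨j, Finset.mem_insert_self j s, h⟩

/-- The length scale at which the values on `E` determine the gradient. -/
theorem exists_gradientScale {E : Set E2} (hE : E.Finite) :
    ∃ ρ : E2 → ℝ, (∀ x, 0 < ρ x) ∧ (∀ x y, ρ x ≤ ρ y + dist x y) ∧ (∀ x, ρ x ≤ 1) ∧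
      (∀ p ∈ E, ∀ q ∈ E, ∀ p' ∈ E, ∀ q' ∈ E, ρ p * |cross (q - p) (q' - p')| ≤
        (‖q - p‖ + ‖q' - p'‖ + ‖p' - p‖) * (‖q - p‖ * ‖q' - p'‖)) ∧
      ∀ x, ρ x = 1 ∨ ∃ p ∈ E, ∃ q ∈ E, ∃ p' ∈ E, ∃ q' ∈ E, dist x p ≤ ρ x ∧
        0 < |cross (q - p) (q' - p')| ∧
        (‖q - p‖ + ‖q' - p'‖ + ‖p' - p‖) * (‖q - p‖ * ‖q' - p'‖) ≤
          ρ x * |cross (q - p) (q' - p')| := by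
  classical
  let s : Finset (E2 × E2 × E2 × E2) := (hE.toFinset ×ˢ hE.toFinset ×ˢ hE.toFinset ×ˢ
    hE.toFinset).filter fun T => cross (T.2.1 - T.1) (T.2.2.2 - T.2.2.1) ≠ 0
  have hmem : ∀ p q p' q', (p, q, p', q') ∈ s ↔
      (p ∈ E ∧ q ∈ E ∧ p' ∈ E ∧ q' ∈ E) ∧ cross (q - p) (q' - p') ≠ 0 := fun p q p' q' => by
    simp [s]
  let a : E2 × E2 × E2 × E2 → ℝ := fun T =>
    (‖T.2.1 - T.1‖ + ‖T.2.2.2 - T.2.2.1‖ + ‖T.2.2.1 - T.1‖) *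
      (‖T.2.1 - T.1‖ * ‖T.2.2.2 - T.2.2.1‖) / |cross (T.2.1 - T.1) (T.2.2.2 - T.2.2.1)|
  have ha : ∀ T ∈ s, 0 < a T := by
    rintro ⟨p, q, p', q'⟩ hT
    have h1 := abs_pos.2 ((hmem _ _ _ _).1 hT).2
    have h2 := h1.trans_le (abs_cross_le _ _)
    have h3 := pos_of_mul_pos_left h2 (norm_nonneg _)
    simp only [a]
    positivity
  obtain ⟨ρ, h0, hl, hle, hs, hr⟩ := exists_min_cone s a (fun T => T.1) ha
  refine ⟨ρ, h0, hl, hle, fun p hp q hq p' hp' q' hq' => ?_, fun x => ?_⟩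
  · by_cases hc : cross (q - p) (q' - p') = 0
    · rw [hc, abs_zero, mul_zero]; positivity
    · have h1 := hs (p, q, p', q') ((hmem _ _ _ _).2 ⟨⟨hp, hq, hp', hq'⟩, hc⟩) p
      simp only [a, dist_self, add_zero] at h1
      rwa [le_div_iff₀ (abs_pos.2 hc)] at h1
  · refine (hr x).imp id ?_
    rintro ⟨⟨p, q, p', q'⟩, hT, hx⟩
    have hap := ha _ hT
    obtain ⟨⟨hp, hq, hp', hq'⟩, hc⟩ := (hmem _ _ _ _).1 hT
    refine ⟨p, hp, q, hq, p', hp', q', hq', by simp only at hx; linarith, abs_pos.2 hc, ?_⟩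
    rw [← div_le_iff₀ (abs_pos.2 hc)]
    simp only at hx
    rw [hx]
    exact le_add_of_nonneg_right dist_nonneg

theorem exists_localGradient {E : Set E2} {ρ : E2 → ℝ} (hpos : ∀ x, 0 < ρ x)
    (hlip : ∀ x y, ρ x ≤ ρ y + dist x y)
    (hrep : ∀ x, ρ x = 1 ∨ ∃ p ∈ E, ∃ q ∈ E, ∃ p' ∈ E, ∃ q' ∈ E, dist x p ≤ ρ x ∧
      0 < |cross (q - p) (q' - p')| ∧
      (‖q - p‖ + ‖q' - p'‖ + ‖p' - p‖) * (‖q - p‖ * ‖q' - p'‖) ≤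
        ρ x * |cross (q - p) (q' - p')|) (i : E2) :
    ∃ (S : Finset E2) (γ : ℝ → (E2 → ℝ) → E2), ↑S ⊆ E ∧ S.card ≤ 5 ∧
      (∀ K f f', (∀ a ∈ S, f a = f' a) → γ K f = γ K f') ∧
      ∀ K f t, 0 < K → IsNonnegField E K f t → ∀ x ∈ E, dist x i ≤ 3 / 4 * ρ i →
        ‖γ K f - t x‖ ≤ 9 * K * ρ i ∧ (f x < K * ρ x ^ 2 → γ K f = 0) := by
  classical
  by_cases hne : ∃ e ∈ E, dist e i ≤ 3 / 4 * ρ i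
  swap
  · exact ⟨∅, fun _ _ => 0, by simp, by simp, fun _ _ _ _ => rfl,
      fun K f t _ _ x hx hxi => absurd ⟨x, hx, hxi⟩ hne⟩
  obtain ⟨e, he, hei⟩ := hne
  obtain h1 | ⟨p, hp, q, hq, p', hp', q', hq', hip, hc, hs⟩ := hrep i
  · refine ⟨∅, fun _ _ => 0, by simp, by simp, fun _ _ _ _ => rfl,
      fun K f t hK h x hx _ => ⟨?_, fun _ => rfl⟩⟩
    rw [zero_sub, norm_neg, h1]
    linarith [h.norm_le x hx]
  set s := ‖q - p‖ + ‖q' - p'‖ + ‖p' - p‖ with hsdef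
  let γ : ℝ → (E2 → ℝ) → E2 := fun K f => if f e ≤ 11 * K * ρ i ^ 2 then 0 else
    Classical.epsilon fun v : E2 => |inner ℝ v (q - p) - (f q - f p)| ≤ K * s * ‖q - p‖ ∧
      |inner ℝ v (q' - p') - (f q' - f p')| ≤ K * s * ‖q' - p'‖
  refine ⟨{e, p, q, p', q'}, γ, ?_, Finset.card_le_five, fun K f f' hff => ?_,
    fun K f t hK h x hx hxi => ?_⟩
  · simp [Set.insert_subset_iff, *]
  · simp only [Finset.mem_insert, Finset.mem_singleton, forall_eq_or_imp, forall_eq] at hff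
    obtain ⟨h0, h1, h2, h3, h4⟩ := hff
    simp only [γ, h0, h1, h2, h3, h4]
  have hr := hpos i
  have hex : ‖e - x‖ ≤ 3 / 2 * ρ i := by
    rw [← dist_eq_norm]
    linarith [dist_triangle_right e x i]
  have hρx : ρ x ≤ 7 / 4 * ρ i := by linarith [hlip x i]
  by_cases hfe : f e ≤ 11 * K * ρ i ^ 2
  · have hγ : γ K f = 0 := if_pos hfe
    refine ⟨?_, fun _ => hγ⟩
    have h1 : ‖t e‖ ≤ 7 * K * ρ i := by
      refine le_of_sq_le_sq ((h.sq_le e he).trans ?_) (by positivity)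
      nlinarith [mul_le_mul_of_nonneg_left hfe hK.le, mul_pos (mul_pos hK hr) (mul_pos hK hr)]
    have h2 := h.lip x hx e he
    rw [hγ, zero_sub, norm_neg]
    have h3 := norm_sub_norm_le (t x) (t e)
    rw [norm_sub_rev] at h3
    nlinarith [mul_le_mul_of_nonneg_left hex hK.le, mul_pos hK hr]
  have hγ : γ K f = _ := if_neg hfe
  have hmem : |inner ℝ (t p) (q - p) - (f q - f p)| ≤ K * s * ‖q - p‖ ∧
      |inner ℝ (t p) (q' - p') - (f q' - f p')| ≤ K * s * ‖q' - p'‖ := by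
    constructor
    · rw [abs_sub_comm]
      refine (h.taylor p hp q hq).trans ?_
      rw [sq, mul_assoc]
      gcongr
      rw [hsdef]
      linarith [norm_nonneg (q' - p'), norm_nonneg (p' - p)]
    · have h1 := h.taylor p' hp' q' hq'
      have h2 := (abs_real_inner_le_norm (t p' - t p) (q' - p')).trans
        (mul_le_mul_of_nonneg_right (h.lip p hp p' hp') (norm_nonneg _))
      have h3 : inner ℝ (t p) (q' - p') - (f q' - f p') =
          -((f q' - f p' - inner ℝ (t p') (q' - p')) + inner ℝ (t p' - t p) (q' - p')) := by
        rw [inner_sub_left]; ring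
      rw [h3, abs_neg]
      refine (abs_add_le _ _).trans ((add_le_add h1 h2).trans ?_)
      rw [hsdef]
      nlinarith [mul_nonneg (mul_nonneg hK.le (norm_nonneg (q - p))) (norm_nonneg (q' - p'))]
  have hspec := Classical.epsilon_spec (p := fun v : E2 =>
    |inner ℝ v (q - p) - (f q - f p)| ≤ K * s * ‖q - p‖ ∧
      |inner ℝ v (q' - p') - (f q' - f p')| ≤ K * s * ‖q' - p'‖) ⟨t p, hmem⟩
  rw [← hγ] at hspec
  constructor
  · have h1 : ‖γ K f - t p‖ ≤ 4 * K * ρ i := by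
      have h2 := norm_mul_abs_cross_le (v := γ K f - t p) (a := q - p) (b := q' - p')
        (s := 2 * K * s) ?_ ?_
      · refine le_of_mul_le_mul_right (h2.trans ?_) hc
        nlinarith [mul_le_mul_of_nonneg_left hs (show 0 ≤ 4 * K by positivity)]
      · rw [inner_sub_left]
        have := abs_sub_le (inner ℝ (γ K f) (q - p)) (f q - f p) (inner ℝ (t p) (q - p))
        rw [abs_sub_comm (f q - f p)] at this
        linarith [hspec.1, hmem.1]
      · rw [inner_sub_left]
        have := abs_sub_le (inner ℝ (γ K f) (q' - p')) (f q' - f p') (inner ℝ (t p) (q' - p'))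
        rw [abs_sub_comm (f q' - f p')] at this
        linarith [hspec.2, hmem.2]
    have h2 := h.lip x hx p hp
    have h3 : ‖p - x‖ ≤ 7 / 4 * ρ i := by
      rw [← dist_eq_norm, dist_comm]
      linarith [dist_triangle x i p]
    have h4 := norm_sub_le_norm_sub_add_norm_sub (γ K f) (t p) (t x)
    nlinarith [mul_le_mul_of_nonneg_left h3 hK.le, mul_pos hK hr]
  · intro hfx
    refine absurd ?_ hfe
    have h1 : ‖t x‖ ≤ 7 / 2 * K * ρ i := by
      refine le_of_sq_le_sq ((h.sq_le x hx).trans ?_) (by positivity)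
      have : ρ x ^ 2 ≤ (7 / 4 * ρ i) ^ 2 := by have := (hpos x).le; gcongr
      nlinarith [mul_le_mul_of_nonneg_left hfx.le hK.le,
        mul_le_mul_of_nonneg_left this (mul_pos hK hK).le]
    have h2 : f x ≤ K * (7 / 4 * ρ i) ^ 2 := by
      refine hfx.le.trans ?_
      have := (hpos x).le
      gcongr
    have h3 := (abs_le.1 (h.taylor x hx e he)).2
    have h4 : inner ℝ (t x) (e - x) ≤ 7 / 2 * K * ρ i * (3 / 2 * ρ i) :=
      (real_inner_le_norm _ _).trans (by gcongr)
    have h5 : K * ‖e - x‖ ^ 2 ≤ K * (3 / 2 * ρ i) ^ 2 := by gcongr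
    nlinarith [mul_pos hK (pow_pos hr 2)]

theorem IsLocalPartition.abs_sub_le {N : ℕ} {C : ℝ} {ρ : E2 → ℝ} {θ : E2 → E2 → ℝ}
    {J : E2 → Finset E2} (h : IsLocalPartition N C ρ θ J) (hpos : ∀ x, 0 < ρ x)
    (hlip : ∀ x y, ρ x ≤ ρ y + dist x y) (hC : 0 ≤ C) (i : E2) {x y : E2}
    (hxy : ‖y - x‖ ≤ ρ x / 16) : |θ i y - θ i x| ≤ 2 * C / ρ x * ‖y - x‖ := by
  refine (convex_closedBall x (ρ x / 16)).norm_image_sub_le_of_norm_fderiv_le (𝕜 := ℝ)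
    (fun z _ => (h.contDiff i).differentiable (by norm_num) z) (fun z hz => ?_)
    (Metric.mem_closedBall_self (by linarith [hpos x])) (by rwa [mem_closedBall_iff_norm])
  have h1 := h.norm_deriv_le i z 1 (by norm_num)
  rw [norm_iteratedFDeriv_one, pow_one] at h1
  refine h1.trans ?_
  have h2 := hlip x z
  rw [Metric.mem_closedBall, dist_comm] at hz
  have := hpos x
  rw [div_le_div_iff₀ (hpos z) (hpos x)]
  nlinarith

/-- A gradient field determined by finitely many values, accurate up to the scale `ρ`. -/
theorem exists_coarseGradient : ∃ (D : ℕ) (C : ℝ), 0 ≤ C ∧ ∀ E : Set E2, E.Finite →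
    ∃ (ρ : E2 → ℝ) (G : ℝ → (E2 → ℝ) → E2 → E2), (∀ x, 0 < ρ x) ∧
      (∀ x y, ρ x ≤ ρ y + dist x y) ∧ (∀ x, ρ x ≤ 1) ∧
      (∀ p ∈ E, ∀ q ∈ E, ∀ p' ∈ E, ∀ q' ∈ E, ρ p * |cross (q - p) (q' - p')| ≤
        (‖q - p‖ + ‖q' - p'‖ + ‖p' - p‖) * (‖q - p‖ * ‖q' - p'‖)) ∧
      (∀ x, ∃ S : Finset E2, ↑S ⊆ E ∧ S.card ≤ D ∧
        ∀ K f f', (∀ a ∈ S, f a = f' a) → G K f x = G K f' x) ∧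
      ∀ K f t, 0 < K → IsNonnegField E K f t → ∀ x ∈ E,
        ‖G K f x - t x‖ ≤ 36 * K * ρ x ∧ ‖G K f x‖ ^ 2 ≤ 2600 * K * f x ∧
        ∀ x' ∈ E, ‖x' - x‖ ≤ ρ x / 16 → ‖G K f x' - G K f x‖ ≤ C * K * ‖x' - x‖ := by
  classical
  obtain ⟨N, C, hC, hpart⟩ := exists_localPartition
  refine ⟨N * 5, 72 * N * C, by positivity, fun E hE => ?_⟩
  obtain ⟨ρ, hpos, hlip, hle, hkey, hrep⟩ := exists_gradientScale hE
  obtain ⟨θ, J, h⟩ := hpart ρ hpos hlip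
  choose S γ hSE hScard hdep hγ using exists_localGradient hpos hlip hrep
  refine ⟨ρ, fun K f x => ∑ i ∈ J x, θ i x • γ i K f, hpos, hlip, hle, hkey, fun x => ?_,
    fun K f t hK ht x hx => ?_⟩
  · refine ⟨(J x).biUnion S, ?_, ?_, fun K f f' hf => ?_⟩
    · simpa using fun i _ => hSE i
    · exact Finset.card_biUnion_le_card_mul _ _ _ (fun i _ => hScard i) |>.trans
        (Nat.mul_le_mul_right _ (h.card_le x))
    · refine Finset.sum_congr rfl fun i hi => ?_
      rw [hdep i K f f' fun a ha => hf a (Finset.mem_biUnion.2 ⟨i, hi, ha⟩)]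
  beta_reduce
  have hr := hpos x
  have hJ : ∀ i ∈ J x, ‖γ i K f - t x‖ ≤ 36 * K * ρ x := fun i hi => by
    have h1 := (hγ i K f t hK ht x hx (h.dist_le x i hi)).1
    have h2 := hlip i x
    have h3 := h.dist_le x i hi
    rw [dist_comm] at h2
    nlinarith
  have hacc : ‖∑ i ∈ J x, θ i x • γ i K f - t x‖ ≤ 36 * K * ρ x := by
    have e : ∑ i ∈ J x, θ i x • γ i K f - t x = ∑ i ∈ J x, θ i x • (γ i K f - t x) := by
      simp only [smul_sub, Finset.sum_sub_distrib, ← Finset.sum_smul, h.sum_eq_one, one_smul]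
    rw [e]
    calc _ ≤ ∑ i ∈ J x, θ i x * (36 * K * ρ x) := norm_sum_le_of_le _ fun i hi => by
          rw [norm_smul, Real.norm_of_nonneg (h.nonneg i x)]
          exact mul_le_mul_of_nonneg_left (hJ i hi) (h.nonneg i x)
      _ = _ := by rw [← Finset.sum_mul, h.sum_eq_one, one_mul]
  refine ⟨hacc, ?_, fun x' _ hxx' => ?_⟩
  · by_cases hf : f x < K * ρ x ^ 2
    · rw [Finset.sum_eq_zero fun i hi => by
        rw [(hγ i K f t hK ht x hx (h.dist_le x i hi)).2 hf, smul_zero], norm_zero, zero_pow two_ne_zero]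
      have := ht.nonneg x hx
      positivity
    · push Not at hf
      have h1 := norm_le_norm_add_norm_sub' (∑ i ∈ J x, θ i x • γ i K f) (t x)
      have h2 := ht.sq_le x hx
      have h3 := pow_le_pow_left₀ (norm_nonneg _) (h1.trans (add_le_add_right hacc _)) 2
      nlinarith [sq_nonneg (‖t x‖ - 36 * K * ρ x), mul_le_mul_of_nonneg_left hf hK.le]
  · have hd : dist x' x < ρ x / 8 := by rw [dist_eq_norm]; linarith
    have e : ∑ i ∈ J x', θ i x' • γ i K f - ∑ i ∈ J x, θ i x • γ i K f =
        ∑ i ∈ J x, (θ i x' - θ i x) • (γ i K f - t x) := by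
      simp only [smul_sub, sub_smul, Finset.sum_sub_distrib, ← Finset.sum_smul, h.sum_eq_one,
        h.sum_eq_one_of_dist_lt hpos hd, h.sum_smul_eq hpos hd, one_smul]
      abel
    rw [e]
    calc _ ≤ ∑ i ∈ J x, 2 * C / ρ x * ‖x' - x‖ * (36 * K * ρ x) :=
          norm_sum_le_of_le _ fun i hi => by
            rw [norm_smul, Real.norm_eq_abs]
            exact mul_le_mul (h.abs_sub_le hpos hlip hC i hxx') (hJ i hi) (norm_nonneg _)
              (by positivity)
      _ = (J x).card * (72 * C * K * ‖x' - x‖) := by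
          rw [Finset.sum_const, nsmul_eq_mul]
          field_simp
          ring
      _ ≤ N * (72 * C * K * ‖x' - x‖) := by gcongr; exact h.card_le x
      _ = _ := by ring

/-- Correcting an approximate gradient `G` along the direction of the nearest point yields a
nonnegative field. -/
theorem IsNonnegField.of_correction {E : Set E2} {K C : ℝ} {f : E2 → ℝ} {t G g : E2 → E2}
    {ρ : E2 → ℝ} (h : IsNonnegField E K f t) (hK : 0 < K) (hC : 0 ≤ C) (hpos : ∀ x, 0 < ρ x)
    (hlip : ∀ x y, ρ x ≤ ρ y + dist x y) (hle : ∀ x, ρ x ≤ 1)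
    (hkey : ∀ p ∈ E, ∀ q ∈ E, ∀ p' ∈ E, ∀ q' ∈ E, ρ p * |cross (q - p) (q' - p')| ≤
      (‖q - p‖ + ‖q' - p'‖ + ‖p' - p‖) * (‖q - p‖ * ‖q' - p'‖))
    (hG : ∀ x ∈ E, ‖G x - t x‖ ≤ 36 * K * ρ x ∧ ‖G x‖ ^ 2 ≤ 2600 * K * f x ∧
      ∀ x' ∈ E, ‖x' - x‖ ≤ ρ x / 16 → ‖G x' - G x‖ ≤ C * K * ‖x' - x‖)
    (hg : ∀ x ∈ E, (g x = G x ∧ ∀ z ∈ E, z ≠ x → ρ x / 16 < ‖z - x‖) ∨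
      ∃ y ∈ E, ∃ (u : E2) (d τ : ℝ), ‖u‖ = 1 ∧ 0 < d ∧ y - x = d • u ∧ d ≤ ρ x / 16 ∧
        (∀ z ∈ E, z ≠ x → d ≤ ‖z - x‖) ∧ τ ^ 2 ≤ 4 * K * f x ∧
        |f y - f x - τ * d| ≤ K * d ^ 2 ∧ g x = perp u (G x) + τ • u) :
    IsNonnegField E ((1400 + C) * K) f g := by
  have hdecomp : ∀ x ∈ E, (g x = G x ∧ ∀ z ∈ E, z ≠ x → ρ x / 16 < ‖z - x‖) ∨
      ∃ y ∈ E, ∃ (u : E2) (d σ : ℝ), ‖u‖ = 1 ∧ 0 < d ∧ y - x = d • u ∧ d ≤ ρ x / 16 ∧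
        (∀ z ∈ E, z ≠ x → d ≤ ‖z - x‖) ∧ |σ| ≤ 2 * K * d ∧
        g x = t x + perp u (G x - t x) + σ • u := fun x hx => by
    refine (hg x hx).imp id ?_
    rintro ⟨y, hy, u, d, τ, hu, hd, hyx, hdρ, hmin, -, hτ, hgx⟩
    refine ⟨y, hy, u, d, τ - inner ℝ (t x) u, hu, hd, hyx, hdρ, hmin, ?_, ?_⟩
    · have h1 := h.taylor x hx y hy
      rw [hyx, norm_smul, hu, mul_one, inner_smul_right, Real.norm_of_nonneg hd.le] at h1
      rw [abs_le] at h1 hτ ⊢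
      constructor <;> nlinarith
    · rw [hgx, perp_sub, sub_smul, perp, perp]
      abel
  have hacc : ∀ x ∈ E, ‖g x - t x‖ ≤ 37 * K * ρ x := fun x hx => by
    have hKρ := mul_pos hK (hpos x)
    obtain ⟨hgx, -⟩ | ⟨y, hy, u, d, σ, hu, hd, hyx, hdρ, hmin, hσ, hgx⟩ := hdecomp x hx
    · rw [hgx]
      linarith [(hG x hx).1]
    · rw [hgx, show t x + perp u (G x - t x) + σ • u - t x = perp u (G x - t x) + σ • u by abel]
      refine (norm_add_le _ _).trans ?_
      rw [norm_smul, hu, mul_one, Real.norm_eq_abs]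
      have := norm_perp_le hu (G x - t x)
      nlinarith [(hG x hx).1]
  have hnear : ∀ x ∈ E, ∀ x' ∈ E, x' ≠ x → ‖x' - x‖ ≤ ρ x / 16 →
      ∃ y ∈ E, ∃ (u : E2) (d σ : ℝ), ‖u‖ = 1 ∧ 0 < d ∧ y - x = d • u ∧ d ≤ ‖x' - x‖ ∧
        |σ| ≤ 2 * K * d ∧ g x = t x + perp u (G x - t x) + σ • u := by
    intro x hx x' hx' hne hxx'
    obtain ⟨-, hfar⟩ | ⟨y, hy, u, d, σ, hu, hd, hyx, -, hmin, hσ, hgx⟩ := hdecomp x hx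
    · exact absurd hxx' (hfar x' hx' hne).not_ge
    · exact ⟨y, hy, u, d, σ, hu, hd, hyx, hmin x' hx' hne, hσ, hgx⟩
  refine ⟨fun x hx x' hx' => ?_, fun x hx x' hx' => ?_, fun x hx => ?_, h.nonneg,
    fun x hx => (h.le x hx).trans (by nlinarith [mul_nonneg hC hK.le]), fun x hx => ?_⟩
  · have h1 := h.taylor x hx x' hx'
    have h2 : |inner ℝ (g x - t x) (x' - x)| ≤ 1000 * K * ‖x' - x‖ ^ 2 := by
      by_cases hne : x' = x
      · simp [hne]
      by_cases hfar : ρ x / 16 < ‖x' - x‖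
      · refine (abs_real_inner_le_norm _ _).trans ?_
        have : ‖g x - t x‖ ≤ 1000 * K * ‖x' - x‖ := (hacc x hx).trans (by
          nlinarith [mul_lt_mul_of_pos_left hfar hK, mul_nonneg hK.le (norm_nonneg (x' - x))])
        nlinarith [norm_nonneg (x' - x)]
      obtain ⟨y, hy, u, d, σ, hu, hd, hyx, hdx, hσ, hgx⟩ :=
        hnear x hx x' hx' hne (not_lt.1 hfar)
      have h3 := hkey x hx y hy x hx x' hx'
      rw [hyx, cross_smul_left, abs_mul, abs_of_pos hd, norm_smul, hu, mul_one,
        Real.norm_of_nonneg hd.le, sub_self, norm_zero, add_zero] at h3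
      have h4 : ρ x * |cross u (x' - x)| ≤ 2 * ‖x' - x‖ ^ 2 := by
        refine le_of_mul_le_mul_left ?_ hd
        nlinarith [mul_nonneg hd.le (norm_nonneg (x' - x))]
      rw [hgx, show t x + perp u (G x - t x) + σ • u - t x = perp u (G x - t x) + σ • u by abel,
        inner_add_left, real_inner_smul_left]
      refine (abs_add_le _ _).trans ?_
      have h5 := abs_inner_perp_le hu (G x - t x) (x' - x)
      have h6 := mul_le_mul_of_nonneg_right (hG x hx).1 (abs_nonneg (cross u (x' - x)))
      have h7 := abs_real_inner_le_norm u (x' - x)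
      rw [hu, one_mul] at h7
      rw [abs_mul]
      have h8 : |σ| * |inner ℝ u (x' - x)| ≤ 2 * K * ‖x' - x‖ * ‖x' - x‖ :=
        mul_le_mul (hσ.trans (by gcongr)) h7 (abs_nonneg _) (by positivity)
      nlinarith [mul_le_mul_of_nonneg_left h4 hK.le, mul_nonneg hK.le (sq_nonneg ‖x' - x‖)]
    have e : f x' - f x - inner ℝ (g x) (x' - x) =
        (f x' - f x - inner ℝ (t x) (x' - x)) - inner ℝ (g x - t x) (x' - x) := by
      rw [inner_sub_left]; ring
    rw [e]
    refine (abs_sub _ _).trans ?_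
    nlinarith [mul_nonneg (mul_nonneg hC hK.le) (sq_nonneg ‖x' - x‖),
      mul_nonneg hK.le (sq_nonneg ‖x' - x‖)]
  · have hCK : 0 ≤ C * K * ‖x' - x‖ := by positivity
    have hKh : 0 ≤ K * ‖x' - x‖ := by positivity
    have h1 := h.lip x hx x' hx'
    by_cases hne : x' = x
    · simp [hne]
    have hl1 := hlip x x'
    have hl2 := hlip x' x
    rw [dist_comm, dist_eq_norm] at hl1
    rw [dist_eq_norm] at hl2
    by_cases hfar : ρ x / 16 < ‖x' - x‖ ∨ ρ x' / 16 < ‖x' - x‖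
    · have h2 : ρ x ≤ 17 * ‖x' - x‖ := by obtain h2 | h2 := hfar <;> linarith [norm_nonneg (x' - x)]
      have h3 : ρ x' ≤ 17 * ‖x' - x‖ := by
        obtain h2 | h2 := hfar <;> linarith [norm_nonneg (x' - x)]
      have e : g x' - g x = (g x' - t x') + (t x' - t x) - (g x - t x) := by abel
      rw [e]
      refine (norm_sub_le _ _).trans ((add_le_add_left (norm_add_le _ _) _).trans ?_)
      have := hacc x hx
      have := hacc x' hx'
      nlinarith [mul_le_mul_of_nonneg_left h2 hK.le, mul_le_mul_of_nonneg_left h3 hK.le]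
    push Not at hfar
    obtain ⟨y, hy, u, d, σ, hu, hd, hyx, hdx, hσ, hgx⟩ := hnear x hx x' hx' hne hfar.1
    obtain ⟨y', hy', u', d', σ', hu', hd', hyx', hdx', hσ', hgx'⟩ :=
      hnear x' hx' x hx (Ne.symm hne) (by rw [norm_sub_rev]; exact hfar.2)
    rw [norm_sub_rev] at hdx'
    have h3 := hkey x hx y hy x' hx' y' hy'
    rw [hyx, hyx', cross_smul_left, cross_smul_right, abs_mul, abs_mul, abs_of_pos hd,
      abs_of_pos hd', norm_smul, norm_smul, hu, hu', mul_one, mul_one,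
      Real.norm_of_nonneg hd.le, Real.norm_of_nonneg hd'.le] at h3
    have h4 : ρ x * |cross u u'| ≤ 3 * ‖x' - x‖ := by
      have hdd := mul_pos hd hd'
      refine le_of_mul_le_mul_left ?_ hdd
      nlinarith
    have e : g x' - g x = σ' • u' - σ • u + (t x' - t x) +
        perp u' ((G x' - G x) - (t x' - t x)) - (perp u (G x - t x) - perp u' (G x - t x)) := by
      rw [hgx, hgx']
      simp only [perp_sub]
      abel
    rw [e]
    have h5 : ‖σ' • u' - σ • u‖ ≤ 4 * K * ‖x' - x‖ := by
      refine (norm_sub_le _ _).trans ?_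
      rw [norm_smul, norm_smul, hu, hu', mul_one, mul_one, Real.norm_eq_abs, Real.norm_eq_abs]
      nlinarith
    have h6 := (norm_perp_le hu' ((G x' - G x) - (t x' - t x))).trans (norm_sub_le _ _)
    have h7 := norm_perp_sub_perp_le hu hu' (G x - t x)
    have h8 := mul_le_mul_of_nonneg_left (hG x hx).1 (abs_nonneg (cross u u'))
    have h9 := (hG x hx).2.2 x' hx' hfar.1
    refine (norm_sub_le _ _).trans ((add_le_add_left ((norm_add_le _ _).trans
      (add_le_add_left (norm_add_le _ _) _)) _).trans ?_)
    nlinarith [mul_le_mul_of_nonneg_left h4 hK.le]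
  · have hf := mul_nonneg hK.le (h.nonneg x hx)
    have hCf := mul_nonneg hC hf
    have h1 := (hG x hx).2.1
    obtain ⟨hgx, -⟩ | ⟨y, hy, u, d, τ, hu, -, -, -, -, hτ, -, hgx⟩ := hg x hx
    · rw [hgx]
      nlinarith
    · have h2 : ‖g x‖ ≤ ‖G x‖ + |τ| := by
        rw [hgx]
        refine (norm_add_le _ _).trans (add_le_add (norm_perp_le hu _) ?_)
        rw [norm_smul, hu, mul_one, Real.norm_eq_abs]
      have h3 := pow_le_pow_left₀ (norm_nonneg _) h2 2
      nlinarith [sq_nonneg (‖G x‖ - |τ|), sq_abs τ]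
  · have h1 := norm_le_norm_add_norm_sub' (g x) (t x)
    have h2 := hacc x hx
    have h3 := h.norm_le x hx
    nlinarith [mul_le_mul_of_nonneg_left (hle x) hK.le, mul_nonneg hC hK.le]

/-- The gradient of a nonnegative extension can be chosen at each point from boundedly many
values. -/
theorem exists_gradientSelection : ∃ (D : ℕ) (C : ℝ), 0 < C ∧ ∀ E : Set E2, E.Finite →
    ∃ g : ℝ → (E2 → ℝ) → E2 → E2,
      (∀ K f t, 0 < K → IsNonnegField E K f t → IsNonnegField E (C * K) f (g K f)) ∧
      ∀ x ∈ E, ∃ S : Finset E2, ↑S ⊆ E ∧ S.card ≤ D ∧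
        ∀ K f f', (∀ a ∈ S, f a = f' a) → g K f x = g K f' x := by
  classical
  obtain ⟨D, C, hC, hD⟩ := exists_coarseGradient
  refine ⟨2 + D, 1400 + C, by positivity, fun E hE => ?_⟩
  obtain ⟨ρ, G, hpos, hlip, hle, hkey, hdep, hG⟩ := hD E hE
  have hnearest : ∀ x, ∃ y, (y = x ∧ ∀ z ∈ E, z ≠ x → ρ x / 16 < ‖z - x‖) ∨
      (y ∈ E ∧ y ≠ x ∧ ‖y - x‖ ≤ ρ x / 16 ∧ ∀ z ∈ E, z ≠ x → ‖y - x‖ ≤ ‖z - x‖) := fun x => by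
    by_cases hfar : ∀ z ∈ E, z ≠ x → ρ x / 16 < ‖z - x‖
    · exact ⟨x, Or.inl ⟨rfl, hfar⟩⟩
    push Not at hfar
    obtain ⟨z, hz, hzx, hzρ⟩ := hfar
    obtain ⟨y, ⟨hy, hyx⟩, hmin⟩ := (hE.subset (Set.sdiff_subset (t := {x}))).exists_minimalFor
      (fun y => ‖y - x‖) _ ⟨z, hz, hzx⟩
    have hmin' : ∀ w ∈ E, w ≠ x → ‖y - x‖ ≤ ‖w - x‖ := fun w hw hwx =>
      (le_total ‖w - x‖ ‖y - x‖).elim (fun hle => hmin ⟨hw, hwx⟩ hle) id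
    exact ⟨y, Or.inr ⟨hy, hyx, (hmin' z hz hzx).trans hzρ, hmin'⟩⟩
  choose n hn using hnearest
  let u : E2 → E2 := fun x => ‖n x - x‖⁻¹ • (n x - x)
  let τ : ℝ → (E2 → ℝ) → E2 → ℝ := fun K f x => Classical.epsilon fun s : ℝ =>
    s ^ 2 ≤ 4 * K * f x ∧ |f (n x) - f x - s * ‖n x - x‖| ≤ K * ‖n x - x‖ ^ 2
  let g : ℝ → (E2 → ℝ) → E2 → E2 := fun K f x =>
    if n x = x then G K f x else perp (u x) (G K f x) + τ K f x • u x
  refine ⟨g, fun K f t hK ht => ?_, fun x hx => ?_⟩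
  · refine ht.of_correction hK hC hpos hlip hle hkey (hG K f t hK ht) fun x hx => ?_
    refine (hn x).imp (fun h => ⟨if_pos h.1, h.2⟩) ?_
    rintro ⟨hy, hyx, hyρ, hmin⟩
    have hd : 0 < ‖n x - x‖ := norm_pos_iff.2 (sub_ne_zero.2 hyx)
    have hu : ‖u x‖ = 1 := by
      simp only [u]
      rw [norm_smul, norm_inv, norm_norm, inv_mul_cancel₀ hd.ne']
    have hnu : n x - x = ‖n x - x‖ • u x := by
      simp only [u]
      rw [smul_inv_smul₀ hd.ne']
    have hτ := Classical.epsilon_spec (p := fun s : ℝ => s ^ 2 ≤ 4 * K * f x ∧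
      |f (n x) - f x - s * ‖n x - x‖| ≤ K * ‖n x - x‖ ^ 2) ⟨inner ℝ (t x) (u x), ?_, ?_⟩
    · exact ⟨n x, hy, u x, ‖n x - x‖, τ K f x, hu, hd, hnu, hyρ, hmin, hτ.1, hτ.2, if_neg hyx⟩
    · refine le_trans ?_ (ht.sq_le x hx)
      have := abs_real_inner_le_norm (t x) (u x)
      rw [hu, mul_one] at this
      rw [← sq_abs]
      gcongr
    · have := ht.taylor x hx (n x) hy
      rwa [hnu, inner_smul_right, mul_comm, ← hnu] at this
  · obtain ⟨S, hSE, hScard, hS⟩ := hdep x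
    refine ⟨{x, n x} ∪ S, ?_, ?_, fun K f f' hf => ?_⟩
    · have hnx : n x ∈ E := by
        obtain h | h := hn x
        exacts [by rw [h.1]; exact hx, h.1]
      simp [Set.insert_subset_iff, *]
    · exact (Finset.card_union_le _ _).trans (add_le_add Finset.card_le_two hScard)
    · have h1 := hf x (by simp)
      have h2 := hf (n x) (by simp)
      have h3 := hS K f f' fun a ha => hf a (Finset.mem_union_right _ ha)
      simp only [g, τ, h1, h2, h3]

theorem C2BddBy.mono {F : E2 → ℝ} {M M' : ℝ} (h : C2BddBy F M) (hM : M ≤ M') : C2BddBy F M' :=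
  ⟨h.1, fun x i hi => (h.2 x i hi).trans hM⟩

theorem C2BddBy.zero {M : ℝ} (hM : 0 ≤ M) : C2BddBy (fun _ => 0) M :=
  ⟨contDiff_const, fun x i _ => by rw [iteratedFDeriv_fun_zero]; simpa using hM⟩

theorem IsNonnegField.congr {E : Set E2} {K : ℝ} {f f' : E2 → ℝ} {t : E2 → E2}
    (h : IsNonnegField E K f t) (hf : ∀ x ∈ E, f x = f' x) : IsNonnegField E K f' t where
  taylor x hx y hy := by rw [← hf x hx, ← hf y hy]; exact h.taylor x hx y hy
  lip := h.lip
  sq_le x hx := by rw [← hf x hx]; exact h.sq_le x hx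
  nonneg x hx := by rw [← hf x hx]; exact h.nonneg x hx
  le x hx := by rw [← hf x hx]; exact h.le x hx
  norm_le := h.norm_le

theorem exists_isNonnegField_zero {E : Set E2} (hE : E.Finite) {f : E2 → ℝ}
    (hf : ∀ x ∈ E, 0 ≤ f x) : ∃ K > 0, IsNonnegField E K f fun _ => 0 := by
  obtain ⟨A, hA⟩ := (hE.image f).bddAbove
  obtain ⟨B, hB⟩ := ((hE.prod hE).image fun p : E2 × E2 =>
    |f p.2 - f p.1| / ‖p.2 - p.1‖ ^ 2).bddAbove
  refine ⟨max 1 (max A B), lt_max_of_lt_left one_pos, fun x hx y hy => ?_,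
    fun x _ y _ => by rw [sub_zero, norm_zero]; positivity,
    fun x hx => by have := hf x hx; rw [norm_zero, zero_pow two_ne_zero]; positivity, hf,
    fun x hx => (hA ⟨x, hx, rfl⟩).trans (le_max_of_le_right (le_max_left _ _)),
    fun x _ => by rw [norm_zero]; positivity⟩
  rw [inner_zero_left, sub_zero]
  obtain rfl | hne := eq_or_ne y x
  · simp
  · rw [← div_le_iff₀ (pow_pos (norm_pos_iff.2 (sub_ne_zero.2 hne)) 2)]
    exact (hB ⟨(x, y), ⟨hx, hy⟩, rfl⟩).trans (le_max_of_le_right (le_max_right _ _))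

theorem exists_extension_of_posTraceNorm_lt {E : Set E2} (hE : E.Finite) (hne : E.Nonempty)
    {f : E2 → ℝ} (hf : ∀ x ∈ E, 0 ≤ f x) {K : ℝ} (hK : posTraceNorm E f < K) :
    ∃ F : E2 → ℝ, (∀ y, 0 ≤ F y) ∧ (∀ x ∈ E, F x = f x) ∧ C2BddBy F K := by
  obtain ⟨D, C, hC, hW⟩ := exists_whitneyExtension
  obtain ⟨W, hW, -⟩ := hW E hE hne
  obtain ⟨K₀, hK₀, h₀⟩ := exists_isNonnegField_zero hE hf
  obtain ⟨h1, h2, h3⟩ := hW K₀ hK₀ f _ h₀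
  rw [posTraceNorm] at hK
  obtain ⟨K', ⟨-, F, hF0, hFf, hF⟩, hK'⟩ := exists_lt_of_csInf_lt
    (by exact ⟨C * K₀, by positivity, _, h2, h1, h3⟩) hK
  exact ⟨F, hF0, hFf, hF.mono hK'.le⟩

theorem isNonnegField_of_posTraceNorm_lt {E : Set E2} (hE : E.Finite) (hne : E.Nonempty)
    {f : E2 → ℝ} (hf : ∀ x ∈ E, 0 ≤ f x) {K : ℝ} (hK : posTraceNorm E f < K) :
    ∃ t, IsNonnegField E K f t := by
  obtain ⟨F, hF0, hFf, hF⟩ := exists_extension_of_posTraceNorm_lt hE hne hf hK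
  exact ⟨_, (hF.isNonnegField hF0 E).congr hFf⟩

theorem eq_zero_of_posTraceNorm_nonpos {E : Set E2} (hE : E.Finite) {f : E2 → ℝ}
    (hf : ∀ x ∈ E, 0 ≤ f x) (h : posTraceNorm E f ≤ 0) {x : E2} (hx : x ∈ E) : f x = 0 := by
  refine le_antisymm (le_of_forall_pos_le_add fun ε hε => ?_) (hf x hx)
  obtain ⟨t, ht⟩ := isNonnegField_of_posTraceNorm_lt hE ⟨x, hx⟩ hf (h.trans_lt hε)
  rw [zero_add]
  exact ht.le x hx

/-- Existence of a bounded-depth nonnegative `C²(ℝ²)` extension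
operator. -/
theorem statement0 :
    ∃ (C : ℝ) (D : ℕ), 0 < C ∧
      ∀ E : Set E2, E.Finite →
        ∃ ℰ : (E2 → ℝ) → ℝ → (E2 → ℝ),
          (∀ M : ℝ, 0 ≤ M → ∀ f : E2 → ℝ, (∀ x ∈ E, 0 ≤ f x) →
            posTraceNorm E f ≤ M →
              (∀ x ∈ E, ℰ f M x = f x) ∧ (∀ y, 0 ≤ ℰ f M y) ∧
                C2BddBy (ℰ f M) (C * M)) ∧
          (∀ x : E2, ∃ S : Set E2, S ⊆ E ∧ S.ncard ≤ D ∧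
            ∀ M : ℝ, 0 ≤ M → ∀ f g : E2 → ℝ,
              (∀ y ∈ E, 0 ≤ f y) → (∀ y ∈ E, 0 ≤ g y) →
              posTraceNorm E f ≤ M → posTraceNorm E g ≤ M →
              Set.EqOn f g S →
              ∀ i : ℕ, i ≤ 2 →
                iteratedFDeriv ℝ i (ℰ f M) x = iteratedFDeriv ℝ i (ℰ g M) x) := by
  classical
  obtain ⟨D₁, C₁, hC₁, hsel⟩ := exists_gradientSelection
  obtain ⟨D₂, C₂, hC₂, hext⟩ := exists_whitneyExtension
  refine ⟨C₂ * (C₁ * 2), D₂ + D₂ * D₁, by positivity, fun E hE => ?_⟩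
  obtain rfl | hne := E.eq_empty_or_nonempty
  · exact ⟨fun _ _ _ => 0, fun M hM f _ _ => ⟨by simp, fun _ => le_rfl, .zero (by positivity)⟩,
      fun x => ⟨∅, by simp, by simp, fun _ _ _ _ _ _ _ _ _ _ _ => rfl⟩⟩
  obtain ⟨g, hg, hgdep⟩ := hsel E hE
  obtain ⟨W, hW, hWdep⟩ := hext E hE hne
  refine ⟨fun f M => if M = 0 then fun _ => 0 else W (C₁ * (2 * M)) f (g (2 * M) f),
    fun M hM f hf hfM => ?_, fun x => ?_⟩
  · obtain rfl | hM0 := hM.eq_or_lt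
    · simp only [if_true]
      exact ⟨fun x hx => (eq_zero_of_posTraceNorm_nonpos hE hf hfM hx).symm, fun _ => le_rfl,
        .zero (by simp)⟩
    · simp only [hM0.ne', if_false]
      obtain ⟨t, ht⟩ := isNonnegField_of_posTraceNorm_lt hE hne hf
        (show posTraceNorm E f < 2 * M by linarith)
      obtain ⟨h1, h2, h3⟩ := hW _ (by positivity) f _ (hg _ f t (by positivity) ht)
      exact ⟨h1, h2, h3.mono (by linarith)⟩
  · obtain ⟨A, hAE, hAcard, hA⟩ := hWdep x
    choose! S hSE hScard hS using hgdep
    refine ⟨↑(A ∪ A.biUnion S), ?_, ?_, fun M _ f f' _ _ _ _ hff i _ => ?_⟩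
    · simpa [hAE] using fun a ha => hSE a (hAE ha)
    · rw [Set.ncard_coe_finset]
      exact (Finset.card_union_le _ _).trans (add_le_add hAcard
        ((Finset.card_biUnion_le_card_mul _ _ _ fun a ha => hScard a (hAE ha)).trans
          (Nat.mul_le_mul_right _ hAcard)))
    · by_cases hM : M = 0
      · simp only [hM, if_true]
      · simp only [hM, if_false]
        refine ((hA _ f f' _ _ (fun a ha => hff (by simp [ha])) fun a ha => ?_).iteratedFDeriv
          ℝ i).eq_of_nhds
        refine hS a (hAE ha) _ f f' fun b hb => hff ?_
        exact Finset.mem_coe.2 (Finset.mem_union_right _ (Finset.mem_biUnion.2 ⟨a, ha, hb⟩))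
end

section
/- There exist universal constants C and D such that for every finite set E ⊂ ℝ² there is a family of maps {Ξ_x : x ∈ ℝ²}, where each Ξ_x maps C²₊(E) × [0,∞) into the space 𝒫⁺ of real polynomials on ℝ² of degree at most 2, with the following properties. (A) For each x ∈ ℝ² there is a set S(x) ⊆ E with #S(x) ≤ D such that Ξ_x(f,M) depends only on the restriction f|_{S(x)} and on M. (B) For every (f,M) ∈ C²₊(E) × [0,∞) with ‖f‖_{C²₊(E)} ≤ M there exists a single function F ∈ C²₊(ℝ²) such that J⁺_x F = Ξ_x(f,M) for all x ∈ ℝ², ‖F‖_{C²(ℝ²)} ≤ C·M, and F(x) = f(x) for all x ∈ E. -/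
/-- A two-jet at a point: the value, the first derivative and the second
derivative.  This encodes a polynomial of degree at most `2` on `ℝ²`
(the degree-2 Taylor polynomial). -/
abbrev Jet2 := ℝ × (E2 →L[ℝ] ℝ) × (E2 →L[ℝ] E2 →L[ℝ] ℝ)

/-- `J⁺_x F = j`: the two-jet of `F` at `x` is `j`. -/
def JetPlusEq (F : E2 → ℝ) (x : E2) (j : Jet2) : Prop :=
  F x = j.1 ∧ fderiv ℝ F x = j.2.1 ∧ fderiv ℝ (fderiv ℝ F) x = j.2.2

namespace PosInterp

open Set Filter Topology

section JetBounds

variable {W : Type*} [NormedAddCommGroup W] [NormedSpace ℝ W]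

/-- The derivatives of `g` at `p` of order `i ≤ 2` are bounded by `A * δ⁻¹ ^ i`. -/
def JetBdd (g : E2 → W) (p : E2) (δ A : ℝ) : Prop :=
  ∀ i : ℕ, i ≤ 2 → ‖iteratedFDeriv ℝ i g p‖ ≤ A * δ⁻¹ ^ i

lemma JetBdd.congr {f g : E2 → W} {p : E2} {δ A : ℝ} (h : JetBdd f p δ A)
    (hfg : g =ᶠ[𝓝 p] f) : JetBdd g p δ A := by
  intro i hi
  have h1 : iteratedFDeriv ℝ i g p = iteratedFDeriv ℝ i f p := by
    rw [← iteratedFDerivWithin_univ, ← iteratedFDerivWithin_univ]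
    exact Filter.EventuallyEq.iteratedFDerivWithin_eq (by simpa using hfg) hfg.eq_of_nhds i
  rw [h1]
  exact h i hi

lemma JetBdd.mono {f : E2 → W} {p : E2} {δ A B : ℝ} (h : JetBdd f p δ A) (hδ : 0 ≤ δ)
    (hAB : A ≤ B) : JetBdd f p δ B := fun i hi =>
  (h i hi).trans (by gcongr)

lemma JetBdd.nonneg {f : E2 → W} {p : E2} {δ A : ℝ} (h : JetBdd f p δ A) : 0 ≤ A := by
  simpa using (norm_nonneg _).trans (h 0 (by norm_num))

/-- Changing the scale of a jet bound. -/
lemma JetBdd.rescale {f : E2 → W} {p : E2} {δ ε A k : ℝ} (h : JetBdd f p δ A) (hδ : 0 < δ)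
    (hε : 0 < ε) (hk : 1 ≤ k) (hεδ : ε ≤ k * δ) : JetBdd f p ε (k ^ 2 * A) := by
  intro i hi
  have h1 : δ⁻¹ ≤ k * ε⁻¹ := by
    rw [inv_eq_one_div, ← div_eq_mul_inv, div_le_div_iff₀ hδ hε]
    linarith
  have hA := h.nonneg
  calc _ ≤ A * δ⁻¹ ^ i := h i hi
    _ ≤ A * (k * ε⁻¹) ^ i := by gcongr
    _ = A * ε⁻¹ ^ i * k ^ i := by ring
    _ ≤ A * ε⁻¹ ^ i * k ^ 2 := by gcongr
    _ = _ := by ring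

lemma JetBdd.smul {f : E2 → ℝ} {g : E2 → W} {p : E2} {δ A B : ℝ} (hf : ContDiff ℝ 2 f)
    (hg : ContDiff ℝ 2 g) (hδ : 0 < δ) (hA : JetBdd f p δ A) (hB : JetBdd g p δ B) :
    JetBdd (fun q => f q • g q) p δ (4 * A * B) := by
  intro i hi
  have hA0 := hA.nonneg
  have hB0 := hB.nonneg
  refine (norm_iteratedFDeriv_smul_le hf hg p (n := i) (by exact_mod_cast hi)).trans ?_
  calc _ ≤ ∑ j ∈ Finset.range (i + 1), (i.choose j : ℝ) * (A * δ⁻¹ ^ j) * (B * δ⁻¹ ^ (i - j)) := by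
        refine Finset.sum_le_sum fun j hj => ?_
        have hj' : j ≤ i := by simpa [Nat.lt_succ_iff] using hj
        have h1 := hA j (hj'.trans hi)
        have h2 := hB (i - j) (by omega)
        gcongr
    _ = ∑ j ∈ Finset.range (i + 1), (i.choose j : ℝ) * (A * B * δ⁻¹ ^ i) := by
        refine Finset.sum_congr rfl fun j hj => ?_
        have hj' : j ≤ i := by simpa [Nat.lt_succ_iff] using hj
        have : δ⁻¹ ^ i = δ⁻¹ ^ j * δ⁻¹ ^ (i - j) := by rw [← pow_add]; congr 1; omega
        rw [this]; ring
    _ = 2 ^ i * (A * B * δ⁻¹ ^ i) := by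
        rw [← Finset.sum_mul]; congr 1; exact_mod_cast Nat.sum_range_choose i
    _ ≤ 2 ^ 2 * (A * B * δ⁻¹ ^ i) := by
        gcongr
        norm_num
    _ = _ := by ring

lemma JetBdd.sum {ι : Type*} {s : Finset ι} {f : ι → E2 → W} {p : E2} {δ A : ℝ}
    (hf : ∀ z ∈ s, ContDiff ℝ 2 (f z)) (h : ∀ z ∈ s, JetBdd (f z) p δ A) :
    JetBdd (fun q => ∑ z ∈ s, f z q) p δ (s.card * A) := by
  intro i hi
  have h1 : iteratedFDeriv ℝ i (fun q => ∑ z ∈ s, f z q) p = ∑ z ∈ s, iteratedFDeriv ℝ i (f z) p :=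
    iteratedFDeriv_fun_sum_apply fun j hj => ((hf j hj).of_le (by exact_mod_cast hi)).contDiffAt
  rw [h1]
  calc _ ≤ ∑ z ∈ s, A * δ⁻¹ ^ i := norm_sum_le_of_le _ fun z hz => h z hz i hi
    _ = _ := by rw [Finset.sum_const, nsmul_eq_mul]; ring

lemma JetBdd.add {f g : E2 → W} {p : E2} {δ A B : ℝ} (hf : ContDiff ℝ 2 f)
    (hg : ContDiff ℝ 2 g) (hA : JetBdd f p δ A) (hB : JetBdd g p δ B) :
    JetBdd (fun q => f q + g q) p δ (A + B) := by
  intro i hi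
  rw [fun_iteratedFDeriv_add_apply (hf.of_le (by exact_mod_cast hi)).contDiffAt
    (hg.of_le (by exact_mod_cast hi)).contDiffAt, add_mul]
  exact norm_add_le_of_le (hA i hi) (hB i hi)

lemma JetBdd.sub {f g : E2 → W} {p : E2} {δ A B : ℝ} (hf : ContDiff ℝ 2 f)
    (hg : ContDiff ℝ 2 g) (hA : JetBdd f p δ A) (hB : JetBdd g p δ B) :
    JetBdd (fun q => f q - g q) p δ (A + B) := by
  intro i hi
  rw [fun_iteratedFDeriv_sub_apply (hf.of_le (by exact_mod_cast hi)).contDiffAt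
    (hg.of_le (by exact_mod_cast hi)).contDiffAt, add_mul]
  exact norm_sub_le_of_le (hA i hi) (hB i hi)

lemma jetBdd_iff {f : E2 → W} {p : E2} {δ A : ℝ} :
    JetBdd f p δ A ↔ ‖f p‖ ≤ A ∧ ‖fderiv ℝ f p‖ ≤ A * δ⁻¹ ∧
      ‖fderiv ℝ (fderiv ℝ f) p‖ ≤ A * δ⁻¹ ^ 2 := by
  have e2 : ‖iteratedFDeriv ℝ 2 f p‖ = ‖fderiv ℝ (fderiv ℝ f) p‖ := by
    rw [← norm_iteratedFDeriv_fderiv, norm_iteratedFDeriv_one]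
  constructor
  · intro h
    refine ⟨by simpa using h 0 (by norm_num), ?_, ?_⟩
    · have := h 1 (by norm_num); rwa [norm_iteratedFDeriv_one, pow_one] at this
    · have := h 2 le_rfl; rwa [e2] at this
  · rintro ⟨h0, h1, h2⟩ i hi
    interval_cases i
    · simpa using h0
    · rwa [norm_iteratedFDeriv_one, pow_one]
    · rwa [e2]

lemma jetBdd_const (c : W) (p : E2) {δ : ℝ} (hδ : 0 ≤ δ) : JetBdd (fun _ => c) p δ ‖c‖ := by
  have h : fderiv ℝ (fun _ : E2 => c) = fun _ => 0 := by ext1 q; simp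
  refine jetBdd_iff.2 ⟨le_rfl, ?_, ?_⟩
  · rw [h, norm_zero]; positivity
  · rw [h, fderiv_fun_const]; simp only [Pi.zero_apply]; exact (norm_zero (E := E2 →L[ℝ] E2 →L[ℝ] W)).trans_le (by positivity)

/-- The reciprocal of a function bounded below by one. -/
lemma JetBdd.inv {f : E2 → ℝ} {p : E2} {δ A : ℝ} (hf : ContDiff ℝ 2 f) (h1 : ∀ q, 1 ≤ f q)
    (hδ : 0 < δ) (hA : JetBdd f p δ A) (hA1 : 1 ≤ A) :
    JetBdd (fun q => (f q)⁻¹) p δ (3 * A ^ 2) := by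
  have hd : Differentiable ℝ f := hf.differentiable (by norm_num)
  have hne : ∀ q, f q ≠ 0 := fun q => (zero_lt_one.trans_le (h1 q)).ne'
  have hinv : ContDiff ℝ 2 (fun q => (f q)⁻¹) := hf.inv hne
  have hle : ∀ q, ‖(f q)⁻¹‖ ≤ 1 := fun q => by
    rw [norm_inv, Real.norm_of_nonneg (zero_le_one.trans (h1 q))]
    exact inv_le_one_of_one_le₀ (h1 q)
  have hder : ∀ q, fderiv ℝ (fun q => (f q)⁻¹) q = (-((f q)⁻¹ * (f q)⁻¹)) • fderiv ℝ f q := by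
    intro q
    have := ((hasDerivAt_inv (hne q)).comp_hasFDerivAt q (hd q).hasFDerivAt).fderiv
    simp only [Function.comp_def] at this
    rw [this]
    congr 1
    field_simp
  obtain ⟨_, a1, a2⟩ := jetBdd_iff.1 hA
  have b1 : ‖fderiv ℝ (fun q => (f q)⁻¹) p‖ ≤ A * δ⁻¹ := by
    rw [hder, norm_smul, norm_neg, norm_mul]
    calc _ ≤ 1 * 1 * (A * δ⁻¹) := by
          gcongr <;> exact hle p
      _ = _ := by ring
  have hδ' : 0 < δ⁻¹ := inv_pos.2 hδ
  refine jetBdd_iff.2 ⟨(hle p).trans (by nlinarith), b1.trans ?_, ?_⟩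
  · gcongr; nlinarith
  · have hfd : Differentiable ℝ (fderiv ℝ f) :=
      (hf.fderiv_right (m := 1) (by norm_num)).differentiable (by norm_num)
    have hid : Differentiable ℝ (fun q => (f q)⁻¹) := hinv.differentiable (by norm_num)
    have : fderiv ℝ (fun q => (f q)⁻¹) = fun q => (-((f q)⁻¹ * (f q)⁻¹)) • fderiv ℝ f q :=
      funext hder
    have hs : DifferentiableAt ℝ (fun q => -((f q)⁻¹ * (f q)⁻¹)) p := ((hid p).fun_mul (hid p)).fun_neg
    rw [this, fderiv_fun_smul hs (hfd p), fderiv_fun_neg, fderiv_fun_mul (hid p) (hid p)]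
    set g := fderiv ℝ (fun q => (f q)⁻¹) p
    refine (ContinuousLinearMap.opNorm_add_le _ _).trans ?_
    rw [norm_smul, norm_neg, norm_mul]
    have c1 : ‖(f p)⁻¹‖ * ‖(f p)⁻¹‖ * ‖fderiv ℝ (fderiv ℝ f) p‖ ≤ 1 * 1 * (A * δ⁻¹ ^ 2) := by
      gcongr <;> exact hle p
    have c2 : ‖(-((f p)⁻¹ • g + (f p)⁻¹ • g)).smulRight (fderiv ℝ f p)‖
        ≤ (1 * (A * δ⁻¹) + 1 * (A * δ⁻¹)) * (A * δ⁻¹) := by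
      rw [ContinuousLinearMap.norm_smulRight_apply, norm_neg]
      gcongr
      refine (norm_add_le _ _).trans ?_
      rw [norm_smul]
      gcongr <;> exact hle p
    have : A * δ⁻¹ ^ 2 ≤ A ^ 2 * δ⁻¹ ^ 2 := by gcongr; nlinarith
    nlinarith

end JetBounds

section Partition

/-- A smooth partition of unity adapted to the scale function `ρ`, with overlap at most `N` and
derivatives controlled by `C`. -/
structure ScalePartition (ρ : E2 → ℝ) (N : ℕ) (C : ℝ) where
  θ : E2 → E2 → ℝ
  I : E2 → Finset E2
  card_le : ∀ p, (I p).card ≤ N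
  dist_le : ∀ p, ∀ z ∈ I p, dist p z ≤ ρ z / 8
  smooth : ∀ z, ContDiff ℝ 2 (θ z)
  nonneg : ∀ z p, 0 ≤ θ z p
  eventually_zero : ∀ p, ∀ᶠ q in 𝓝 p, ∀ z ∉ I p, θ z q = 0
  sum_eq_one : ∀ p, ∑ z ∈ I p, θ z p = 1
  bound : ∀ z p, JetBdd (θ z) p (ρ p) C

lemma exists_packing_bound (η : ℝ) (hη : 0 < η) : ∃ N : ℕ, ∀ (p : E2) (R : ℝ) (s : Finset E2),
    0 < R → (∀ z ∈ s, dist z p ≤ R) →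
    (∀ z ∈ s, ∀ w ∈ s, z ≠ w → η * R ≤ dist z w) → s.card ≤ N := by
  obtain ⟨t, -, htf, ht⟩ := (isCompact_closedBall (0 : E2) 1).finite_cover_balls (half_pos hη)
  refine ⟨htf.toFinset.card, fun p R s hR hs hsep => ?_⟩
  have key : ∀ z ∈ s, ∃ c ∈ t, dist (R⁻¹ • (z - p)) c < η / 2 := by
    intro z hz
    have : R⁻¹ • (z - p) ∈ Metric.closedBall (0 : E2) 1 := by
      rw [mem_closedBall_zero_iff, norm_smul, norm_inv, Real.norm_of_nonneg hR.le,
        ← dist_eq_norm, inv_mul_le_iff₀ hR, mul_one]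
      exact hs z hz
    simpa using ht this
  choose! c hct hc using key
  refine Finset.card_le_card_of_injOn c (fun z hz => by simpa using hct z hz) ?_
  intro z hz w hw hzw
  by_contra hne
  have h1 := hsep z hz w hw hne
  have h2 : dist (R⁻¹ • (z - p)) (R⁻¹ • (w - p)) < η := by
    have := dist_triangle_right (R⁻¹ • (z - p)) (R⁻¹ • (w - p)) (c z)
    have a1 := hc z hz
    have a2 := hc w hw
    rw [← hzw] at a2
    linarith
  rw [dist_smul₀, dist_sub_right, norm_inv, Real.norm_of_nonneg hR.le, inv_mul_lt_iff₀ hR] at h2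
  linarith

/-- A maximal family of points separated at the scale `ε * ρ`. -/
lemma exists_scale_net (ρ : E2 → ℝ) (ε : ℝ) (hε : 0 < ε) (hρ : ∀ x, 0 < ρ x) :
    ∃ Z : Set E2, (∀ z ∈ Z, ∀ w ∈ Z, z ≠ w → ε * ρ z ≤ dist z w) ∧
      ∀ p, ∃ z ∈ Z, dist p z ≤ ε * max (ρ p) (ρ z) := by
  obtain ⟨Z, hZ⟩ := zorn_subset {Z : Set E2 | Z.Pairwise fun z w => ε * ρ z ≤ dist z w}
    (fun c hc hch => ⟨⋃₀ c, (Set.pairwise_sUnion hch.directedOn).2 fun s hs => hc hs,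
      fun s hs => Set.subset_sUnion_of_mem hs⟩)
  refine ⟨Z, fun z hz w hw h => hZ.prop hz hw h, fun p => ?_⟩
  by_contra! hcon
  have hpZ : p ∉ Z := fun hp => by
    have := hcon p hp
    have h2 := hρ p
    simp only [dist_self, max_self] at this
    nlinarith
  have hins : (insert p Z).Pairwise fun z w => ε * ρ z ≤ dist z w := by
    refine (Set.pairwise_insert_of_notMem hpZ).2 ⟨hZ.prop, fun z hz => ?_⟩
    have := (hcon z hz).le
    rw [mul_max_of_nonneg _ _ hε.le, max_le_iff] at this
    exact ⟨this.1, by rw [dist_comm]; exact this.2⟩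
  exact hpZ (hZ.2 (y := insert p Z) hins (Set.subset_insert p Z) (Set.mem_insert p Z))

lemma exists_bump : ∃ (b : E2 → ℝ) (C : ℝ), ContDiff ℝ 2 b ∧ (∀ x, 0 ≤ b x) ∧
    (∀ x, ‖x‖ ≤ 1 → b x = 1) ∧ (∀ x, 2 ≤ ‖x‖ → b x = 0) ∧ 
    ∀ x, ∀ i ≤ 2, ‖iteratedFDeriv ℝ i b x‖ ≤ C := by
  let b : ContDiffBump (0 : E2) := ⟨1, 2, by norm_num, by norm_num⟩
  have hb : ContDiff ℝ 2 b := b.contDiff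
  have : ∀ i : ℕ, i ≤ 2 → ∃ C, ∀ x, ‖iteratedFDeriv ℝ i b x‖ ≤ C := fun i hi =>
    (hb.continuous_iteratedFDeriv (by exact_mod_cast hi)).bounded_above_of_compact_support
      (b.hasCompactSupport.iteratedFDeriv i)
  choose! C hC using this
  refine ⟨b, max (C 0) (max (C 1) (C 2)), hb, fun x => b.nonneg, fun x hx => ?_, fun x hx => ?_,
    fun x i hi => ?_⟩
  · exact b.one_of_mem_closedBall (by simpa [b] using hx)
  · exact b.zero_of_le_dist (by simpa [b] using hx)
  · refine (hC i hi x).trans ?_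
    interval_cases i <;> simp

lemma jetBdd_dilate {b : E2 → ℝ} {C : ℝ} (hb : ContDiff ℝ 2 b)
    (hC : ∀ x, ∀ i ≤ 2, ‖iteratedFDeriv ℝ i b x‖ ≤ C) (z p : E2) {δ : ℝ} (hδ : 0 < δ) :
    JetBdd (fun q => b (δ⁻¹ • (q - z))) p δ (2 * C) := by
  intro i hi
  have hf : ContDiff ℝ 2 (fun q : E2 => δ⁻¹ • (q - z)) := by fun_prop
  have hC0 : 0 ≤ C := (norm_nonneg _).trans (hC p 0 (by norm_num))
  have hder : fderiv ℝ (fun q : E2 => δ⁻¹ • (q - z)) = fun _ => δ⁻¹ • ContinuousLinearMap.id ℝ E2 := by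
    ext1 q
    exact (((hasFDerivAt_id q).sub_const z).const_smul δ⁻¹).fderiv
  have := norm_iteratedFDeriv_comp_le (N := 2) hb hf (n := i) (by exact_mod_cast hi) p (C := C)
    (D := δ⁻¹) (fun j hj => hC _ j (hj.trans hi)) (by
      intro j hj1 hj2
      obtain rfl | rfl : j = 1 ∨ j = 2 := by omega
      · rw [norm_iteratedFDeriv_one, hder, pow_one, norm_smul, norm_inv, Real.norm_of_nonneg hδ.le]
        exact mul_le_of_le_one_right (by positivity) ContinuousLinearMap.norm_id_le
      · rw [← norm_iteratedFDeriv_fderiv, hder, norm_iteratedFDeriv_one, fderiv_fun_const]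
        exact norm_zero.trans_le (by positivity))
  refine this.trans ?_
  have h2 : (i.factorial : ℝ) ≤ 2 := by interval_cases i <;> norm_num [Nat.factorial]
  gcongr

end Partition

section Existence

theorem exists_scalePartition : ∃ (N : ℕ) (C : ℝ), ∀ ρ : E2 → ℝ, (∀ x, 0 < ρ x) →
    (∀ x y, ρ x ≤ ρ y + dist x y) → Nonempty (ScalePartition ρ N C) := by
  obtain ⟨b, B, hbs, hb0, hb1, hb2, hbB⟩ := exists_bump
  obtain ⟨N, hN⟩ := exists_packing_bound (1 / 100) (by norm_num)
  have hB0 : 0 ≤ B := (norm_nonneg _).trans (hbB 0 0 (by norm_num))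
  set A : ℝ := 1 + N * (3 ^ 2 * (20 ^ 2 * (2 * B))) with hA
  set A' : ℝ := 3 ^ 2 * (20 ^ 2 * (2 * B)) with hA'
  have hA'0 : 0 ≤ A' := by positivity
  have hA1 : 1 ≤ A := by
    have : 0 ≤ (N : ℝ) * A' := by positivity
    rw [hA]
    linarith
  refine ⟨N, 4 * A' * (3 * A ^ 2), fun ρ hρ hlip => ?_⟩
  obtain ⟨Z, hsep, hcov⟩ := exists_scale_net ρ (1 / 40) (by norm_num) hρ
  classical
  let φ : E2 → E2 → ℝ := fun z q => if z ∈ Z then b ((ρ z / 20)⁻¹ • (q - z)) else 0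
  have hnorm : ∀ z q, ‖(ρ z / 20)⁻¹ • (q - z)‖ = dist q z / (ρ z / 20) := fun z q => by
    rw [norm_smul, norm_inv, Real.norm_of_nonneg (by have := hρ z; positivity), dist_eq_norm,
      inv_mul_eq_div]
  have hφs : ∀ z, ContDiff ℝ 2 (φ z) := fun z => by
    by_cases hz : z ∈ Z
    · simp only [φ, hz, if_true]
      exact hbs.comp (by fun_prop)
    · simp only [φ, hz, if_false]
      exact contDiff_const
  have hφ0 : ∀ z q, 0 ≤ φ z q := fun z q => by
    by_cases hz : z ∈ Z <;> simp [φ, hz, hb0]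
  have hφ1 : ∀ z ∈ Z, ∀ q, dist q z ≤ ρ z / 20 → φ z q = 1 := fun z hz q h => by
    simp only [φ, hz, if_true]
    refine hb1 _ ?_
    rw [hnorm, div_le_one (by linarith [hρ z])]
    exact h
  have hφ2 : ∀ z q, ρ z / 10 ≤ dist q z → φ z q = 0 := fun z q h => by
    by_cases hz : z ∈ Z
    · simp only [φ, hz, if_true]
      refine hb2 _ ?_
      rw [hnorm, le_div_iff₀ (by linarith [hρ z])]
      linarith
    · simp [φ, hz]
  have hfin : ∀ p, {z | z ∈ Z ∧ dist p z ≤ ρ z / 8}.Finite ∧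
      {z | z ∈ Z ∧ dist p z ≤ ρ z / 8}.ncard ≤ N := by
    intro p
    have hs : ∀ s : Finset E2, (↑s : Set E2) ⊆ {z | z ∈ Z ∧ dist p z ≤ ρ z / 8} → s.card ≤ N := by
      intro s hs
      have hz : ∀ z ∈ s, dist z p ≤ ρ p / 7 ∧ ρ p * (8 / 9) ≤ ρ z := by
        intro z hz
        have h1 := (hs hz).2
        have h2 := hlip z p
        have h3 := hlip p z
        rw [dist_comm] at h2
        constructor
        · rw [dist_comm]; linarith
        · linarith
      refine hN p (ρ p / 7) s (by linarith [hρ p]) (fun z h => (hz z h).1) fun z h w h' hne => ?_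
      have := hsep z (hs h).1 w (hs h').1 hne
      have := (hz z h).2
      have := hρ p
      linarith
    have hf : {z | z ∈ Z ∧ dist p z ≤ ρ z / 8}.Finite := by
      by_contra hinf
      obtain ⟨t, ht, htc⟩ := Set.Infinite.exists_subset_card_eq hinf (N + 1)
      have := hs t ht
      omega
    refine ⟨hf, ?_⟩
    rw [Set.ncard_eq_toFinset_card _ hf]
    exact hs _ (by simp)
  let I : E2 → Finset E2 := fun p => (hfin p).1.toFinset
  have hI : ∀ p z, z ∈ I p ↔ z ∈ Z ∧ dist p z ≤ ρ z / 8 := fun p z => by simp [I]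
  have hIc : ∀ p, (I p).card ≤ N := fun p => by
    rw [← Set.ncard_eq_toFinset_card _ (hfin p).1]
    exact (hfin p).2
  have hev : ∀ p, ∀ᶠ q in 𝓝 p, ∀ z ∉ I p, φ z q = 0 := by
    intro p
    filter_upwards [Metric.ball_mem_nhds p (show 0 < ρ p / 100 by linarith [hρ p])] with q hq z hz
    by_cases hzZ : z ∈ Z
    · have h1 : ρ z / 8 < dist p z := by
        by_contra hcon
        exact hz ((hI p z).2 ⟨hzZ, not_lt.1 hcon⟩)
      refine hφ2 z q ?_
      have h2 := dist_triangle p q z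
      rw [Metric.mem_ball, dist_comm] at hq
      have := hlip p z
      have := hρ z
      have := hρ p
      linarith
    · simp [φ, hzZ]
  have hself : ∀ p, ∀ z ∉ I p, φ z p = 0 := fun p => (hev p).self_of_nhds
  have hcomm : ∀ p q, (∀ z ∉ I p, φ z q = 0) → ∑ z ∈ I q, φ z q = ∑ z ∈ I p, φ z q := by
    intro p q h
    rw [Finset.sum_subset (Finset.subset_union_left (s₂ := I p)) fun z _ hz => hself q z hz,
      Finset.sum_subset (Finset.subset_union_right (s₁ := I q)) fun z _ hz => h z hz]
  let S : E2 → ℝ := fun p => ∑ z ∈ I p, φ z p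
  have hSev : ∀ p, S =ᶠ[𝓝 p] fun q => ∑ z ∈ I p, φ z q := fun p => by
    filter_upwards [hev p] with q hq using hcomm p q hq
  have hSs : ContDiff ℝ 2 S := contDiff_iff_contDiffAt.2 fun p =>
    (ContDiff.contDiffAt (ContDiff.sum fun z _ => hφs z)).congr_of_eventuallyEq (hSev p)
  have hS1 : ∀ p, 1 ≤ S p := by
    intro p
    obtain ⟨z, hz, hd⟩ := hcov p
    have hd' : dist p z ≤ ρ z / 20 := by
      have h1 := hlip p z
      have h2 := hρ z
      have h3 : max (ρ p) (ρ z) ≤ ρ z + dist p z := max_le h1 (by linarith [dist_nonneg (x := p) (y := z)])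
      linarith
    have hzI : z ∈ I p := (hI p z).2 ⟨hz, by linarith [hρ z]⟩
    calc (1 : ℝ) = φ z p := (hφ1 z hz p hd').symm
      _ ≤ S p := Finset.single_le_sum (f := fun z => φ z p) (fun w _ => hφ0 w p) hzI
  have hφB : ∀ z p, JetBdd (φ z) p (ρ p) A' := by
    intro z p
    by_cases hz : z ∈ I p
    · obtain ⟨hzZ, hd⟩ := (hI p z).1 hz
      have h1 : JetBdd (φ z) p (ρ z / 20) (2 * B) := by
        have : φ z = fun q => b ((ρ z / 20)⁻¹ • (q - z)) := by
          ext q; simp [φ, hzZ]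
        rw [this]
        exact jetBdd_dilate hbs hbB z p (by linarith [hρ z])
      have h2 := h1.rescale (k := 20) (by linarith [hρ z]) (hρ z) (by norm_num) (by linarith)
      exact h2.rescale (k := 3) (hρ z) (hρ p) (by norm_num) (by linarith [hlip p z, hρ z])
    · have h0 : JetBdd (fun _ : E2 => (0 : ℝ)) p (ρ p) A' :=
        (jetBdd_const 0 p (hρ p).le).mono (hρ p).le (by simpa using hA'0)
      refine h0.congr ?_
      filter_upwards [hev p] with q hq using hq z hz
  have hSB : ∀ p, JetBdd S p (ρ p) A := by
    intro p
    refine JetBdd.congr ?_ (hSev p)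
    refine (JetBdd.sum (fun z _ => hφs z) fun z _ => hφB z p).mono (hρ p).le ?_
    have : ((I p).card : ℝ) ≤ N := by exact_mod_cast hIc p
    rw [hA]
    nlinarith
  have hSne : ∀ q, S q ≠ 0 := fun q => (zero_lt_one.trans_le (hS1 q)).ne'
  refine ⟨⟨fun z q => φ z q • (S q)⁻¹, I, hIc, fun p z hz => ((hI p z).1 hz).2,
    fun z => (hφs z).smul (hSs.inv hSne), fun z p => ?_, fun p => ?_, fun p => ?_, fun z p => ?_⟩⟩
  · exact mul_nonneg (hφ0 z p) (inv_nonneg.2 (zero_le_one.trans (hS1 p)))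
  · filter_upwards [hev p] with q hq z hz
    simp [hq z hz]
  · simp only [smul_eq_mul]
    rw [← Finset.sum_mul]
    exact mul_inv_cancel₀ (hSne p)
  · exact JetBdd.smul (hφs z) (hSs.inv hSne) (hρ p) (hφB z p)
      (JetBdd.inv hSs hS1 (hρ p) (hSB p) hA1)

variable {W : Type*} [NormedAddCommGroup W] [NormedSpace ℝ W]
  {ρ : E2 → ℝ} {N : ℕ} {C : ℝ}

namespace ScalePartition

/-- The function obtained by gluing the local functions `P z`. -/
noncomputable def glue (T : ScalePartition ρ N C) (P : E2 → E2 → W) (p : E2) : W :=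
  ∑ z ∈ T.I p, T.θ z p • P z p

variable (T : ScalePartition ρ N C) (P : E2 → E2 → W)

lemma eq_zero {p z : E2} (hz : z ∉ T.I p) : T.θ z p = 0 :=
  (T.eventually_zero p).self_of_nhds z hz

lemma I_nonempty (p : E2) : (T.I p).Nonempty := by
  by_contra h
  have := T.sum_eq_one p
  rw [Finset.not_nonempty_iff_eq_empty.1 h] at this
  simp at this

lemma eventually_sum (p : E2) (P : E2 → E2 → W) :
    ∀ᶠ q in 𝓝 p, ∑ z ∈ T.I q, T.θ z q • P z q = ∑ z ∈ T.I p, T.θ z q • P z q := by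
  classical
  filter_upwards [T.eventually_zero p] with q hq
  have h1 : ∑ z ∈ T.I q, T.θ z q • P z q = ∑ z ∈ T.I q ∪ T.I p, T.θ z q • P z q :=
    Finset.sum_subset Finset.subset_union_left fun z _ hz => by rw [T.eq_zero hz, zero_smul]
  have h2 : ∑ z ∈ T.I p, T.θ z q • P z q = ∑ z ∈ T.I q ∪ T.I p, T.θ z q • P z q :=
    Finset.sum_subset Finset.subset_union_right fun z _ hz => by rw [hq z hz, zero_smul]
  rw [h1, h2]

lemma glue_eventuallyEq (p : E2) :
    T.glue P =ᶠ[𝓝 p] fun q => ∑ z ∈ T.I p, T.θ z q • P z q :=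
  T.eventually_sum p P

lemma glue_congr {P Q : E2 → E2 → W} {p : E2} (h : ∀ z ∈ T.I p, P z = Q z) :
    T.glue P =ᶠ[𝓝 p] T.glue Q := by
  filter_upwards [T.glue_eventuallyEq P p, T.glue_eventuallyEq Q p] with q h1 h2
  rw [h1, h2]
  exact Finset.sum_congr rfl fun z hz => by rw [h z hz]

lemma glue_contDiff (hP : ∀ z, ContDiff ℝ 2 (P z)) : ContDiff ℝ 2 (T.glue P) :=
  contDiff_iff_contDiffAt.2 fun p =>
    (ContDiff.contDiffAt (ContDiff.sum fun z _ => (T.smooth z).smul (hP z))).congr_of_eventuallyEq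
      (T.glue_eventuallyEq P p)

lemma glue_sub_eventuallyEq (p z₀ : E2) :
    (fun q => T.glue P q - P z₀ q) =ᶠ[𝓝 p] fun q => ∑ z ∈ T.I p, T.θ z q • (P z q - P z₀ q) := by
  filter_upwards [T.glue_eventuallyEq P p, T.eventually_sum p fun _ _ => (1 : ℝ)] with q h1 h2
  have h3 : ∑ z ∈ T.I p, T.θ z q = 1 := by
    simpa [T.sum_eq_one q] using h2.symm
  simp only [smul_sub, Finset.sum_sub_distrib]
  rw [h1, ← Finset.sum_smul, h3, one_smul]

lemma glue_sub_jetBdd (hρ : ∀ x, 0 < ρ x) (hP : ∀ z, ContDiff ℝ 2 (P z)) {p z₀ : E2} {A : ℝ}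
    (h : ∀ z ∈ T.I p, JetBdd (fun q => P z q - P z₀ q) p (ρ p) A) :
    JetBdd (fun q => T.glue P q - P z₀ q) p (ρ p) (N * (4 * C * A)) := by
  refine JetBdd.congr ?_ (T.glue_sub_eventuallyEq P p z₀)
  have h1 : ∀ z ∈ T.I p, JetBdd (fun q => T.θ z q • (P z q - P z₀ q)) p (ρ p) (4 * C * A) :=
    fun z hz => JetBdd.smul (T.smooth z) ((hP z).sub (hP z₀)) (hρ p) (T.bound z p) (h z hz)
  refine (JetBdd.sum (fun z _ => (T.smooth z).smul ((hP z).sub (hP z₀))) h1).mono (hρ p).le ?_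
  obtain ⟨z, hz⟩ := T.I_nonempty p
  have := (h1 z hz).nonneg
  gcongr
  exact T.card_le p

end ScalePartition

end Existence

section Whitney

/-- A minimum of `1` and finitely many cones is a scale function. -/
lemma exists_cone_scale (T : Finset (E2 × ℝ)) (hT : ∀ t ∈ T, 0 < t.2) :
    ∃ ρ : E2 → ℝ, (∀ x, 0 < ρ x) ∧ (∀ x y, ρ x ≤ ρ y + dist x y) ∧ (∀ x, ρ x ≤ 1) ∧
      (∀ t ∈ T, ∀ x, ρ x ≤ t.2 + dist x t.1) ∧
      ∀ x, ρ x = 1 ∨ ∃ t ∈ T, ρ x = t.2 + dist x t.1 := by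
  classical
  induction T using Finset.induction_on with
  | empty => exact ⟨fun _ => 1, by simp, by simp, by simp, by simp, by simp⟩
  | insert t T _ ih =>
    obtain ⟨ρ, h1, h2, h3, h4, h5⟩ := ih fun s hs => hT s (Finset.mem_insert_of_mem hs)
    have ht := hT t (Finset.mem_insert_self t T)
    refine ⟨fun x => min (ρ x) (t.2 + dist x t.1), fun x => lt_min (h1 x) (by positivity),
      fun x y => ?_, fun x => (min_le_left _ _).trans (h3 x), fun s hs x => ?_, fun x => ?_⟩
    · rw [← min_add_add_right]
      refine min_le_min (h2 x y) ?_
      linarith [dist_triangle x y t.1]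
    · rcases Finset.mem_insert.1 hs with rfl | hs
      · exact min_le_right _ _
      · exact (min_le_left _ _).trans (h4 s hs x)
    · beta_reduce
      rcases min_choice (ρ x) (t.2 + dist x t.1) with h | h
      · rw [h]
        rcases h5 x with h' | ⟨s, hs, h'⟩
        · exact .inl h'
        · exact .inr ⟨s, Finset.mem_insert_of_mem hs, h'⟩
      · rw [h]
        exact .inr ⟨t, Finset.mem_insert_self t T, rfl⟩

/-- Values `f` and gradients `ξ` on `E` satisfying Whitney's conditions for a nonnegative
function, with constant `K`. -/
structure WhitneyData (E : Set E2) (f : E2 → ℝ) (ξ : E2 → E2 →L[ℝ] ℝ) (K : ℝ) : Prop where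
  nonneg : ∀ x ∈ E, 0 ≤ f x
  le : ∀ x ∈ E, f x ≤ K
  sq_le : ∀ x ∈ E, ‖ξ x‖ ^ 2 ≤ K * f x
  lip : ∀ x ∈ E, ∀ y ∈ E, ‖ξ x - ξ y‖ ≤ K * dist x y
  taylor : ∀ x ∈ E, ∀ y ∈ E, |f y - f x - ξ x (y - x)| ≤ K * dist x y ^ 2

/-- The paraboloid with value `c`, gradient `ξ` at `y` and curvature `K`. -/
noncomputable def paraboloid (K c : ℝ) (ξ : E2 →L[ℝ] ℝ) (y q : E2) : ℝ :=
  c + ξ (q - y) + K * ‖q - y‖ ^ 2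

variable {K : ℝ}

lemma paraboloid_self (c : ℝ) (ξ : E2 →L[ℝ] ℝ) (y : E2) : paraboloid K c ξ y y = c := by
  simp [paraboloid]

lemma contDiff_paraboloid (c : ℝ) (ξ : E2 →L[ℝ] ℝ) (y : E2) :
    ContDiff ℝ 2 (paraboloid K c ξ y) := by
  have : ContDiff ℝ 2 fun q : E2 => ‖q - y‖ ^ 2 := (contDiff_id.sub contDiff_const).norm_sq ℝ
  unfold paraboloid
  fun_prop

lemma hasFDerivAt_paraboloid (c : ℝ) (ξ : E2 →L[ℝ] ℝ) (y q : E2) :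
    HasFDerivAt (paraboloid K c ξ y) (ξ + (2 * K) • innerSL ℝ (q - y)) q := by
  have h1 : HasFDerivAt (fun q : E2 => q - y) (ContinuousLinearMap.id ℝ E2) q :=
    (hasFDerivAt_id q).sub_const y
  have h2 := ((ξ.hasFDerivAt (x := q - y)).comp q h1).const_add c
  have h3 := h1.norm_sq.const_mul K
  have e : ξ + (2 * K) • innerSL ℝ (q - y) = ξ ∘SL ContinuousLinearMap.id ℝ E2 +
      K • 2 • innerSL ℝ (q - y) ∘SL ContinuousLinearMap.id ℝ E2 := by
    ext v
    simp
    ring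
  rw [e]
  exact h2.add h3

lemma paraboloid_nonneg {c : ℝ} {ξ : E2 →L[ℝ] ℝ} (hK : 0 < K) (h : ‖ξ‖ ^ 2 ≤ K * c) (y q : E2) :
    0 ≤ paraboloid K c ξ y q := by
  have h1 : -(‖ξ‖ * ‖q - y‖) ≤ ξ (q - y) := (abs_le.1 (ξ.le_opNorm (q - y))).1
  have h2 : 0 ≤ K * (c - ‖ξ‖ * ‖q - y‖ + K * ‖q - y‖ ^ 2) := by
    nlinarith [sq_nonneg (‖ξ‖ - K * ‖q - y‖), sq_nonneg ‖ξ‖, sq_nonneg (K * ‖q - y‖)]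
  have h3 := nonneg_of_mul_nonneg_right h2 hK
  unfold paraboloid
  linarith

lemma jetBdd_paraboloid {c : ℝ} {ξ : E2 →L[ℝ] ℝ} {y p : E2} (hK : 0 ≤ K) (hc : |c| ≤ K)
    (hξ : ‖ξ‖ ≤ K) (hp : dist p y ≤ 2) : JetBdd (paraboloid K c ξ y) p 1 (7 * K) := by
  have hn : ‖p - y‖ ≤ 2 := by rwa [← dist_eq_norm]
  have hd : fderiv ℝ (paraboloid K c ξ y) = fun q => ξ + (2 * K) • innerSL ℝ (q - y) :=
    funext fun q => (hasFDerivAt_paraboloid c ξ y q).fderiv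
  refine jetBdd_iff.2 ⟨?_, ?_, ?_⟩
  · have h1 := ξ.le_opNorm (p - y)
    unfold paraboloid
    refine (norm_add₃_le).trans ?_
    rw [norm_mul, norm_pow, norm_norm, Real.norm_of_nonneg hK, Real.norm_eq_abs c]
    have h2 : ‖ξ‖ * ‖p - y‖ ≤ K * 2 := by gcongr
    have h3 : K * ‖p - y‖ ^ 2 ≤ K * 2 ^ 2 := by gcongr
    linarith
  · rw [hd]
    refine (norm_add_le _ _).trans ?_
    rw [norm_smul, innerSL_apply_norm, Real.norm_of_nonneg (by positivity)]
    have : 2 * K * ‖p - y‖ ≤ 2 * K * 2 := by gcongr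
    simp only [inv_one]
    linarith
  · have h2 : HasFDerivAt (fderiv ℝ (paraboloid K c ξ y)) ((2 * K) • innerSL ℝ (E := E2)) p := by
      rw [hd]
      have h1 : HasFDerivAt (fun q : E2 => q - y) (ContinuousLinearMap.id ℝ E2) p :=
        (hasFDerivAt_id p).sub_const y
      exact ((((innerSL ℝ (E := E2)).hasFDerivAt (x := p - y)).comp p h1).const_smul
        (2 * K)).const_add ξ
    rw [h2.fderiv]
    refine (ContinuousLinearMap.opNorm_smul_le _ _).trans ?_
    rw [Real.norm_of_nonneg (by positivity)]
    have : ‖innerSL ℝ (E := E2)‖ ≤ 1 := norm_innerSL_le ℝ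
    have : 2 * K * ‖innerSL ℝ (E := E2)‖ ≤ 2 * K * 1 := by gcongr
    simp only [inv_one]
    linarith

lemma WhitneyData.jetBdd_sub {E : Set E2} {f : E2 → ℝ} {ξ : E2 → E2 →L[ℝ] ℝ}
    (h : WhitneyData E f ξ K) (hK : 0 ≤ K) {x y p : E2} (hx : x ∈ E) (hy : y ∈ E) {δ : ℝ}
    (hδ : 0 < δ) (hpx : dist p x ≤ 2 * δ) (hpy : dist p y ≤ 2 * δ) :
    JetBdd (fun q => paraboloid K (f x) (ξ x) x q - paraboloid K (f y) (ξ y) y q) p δ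
      (32 * K * δ ^ 2) := by
  have hxy : dist x y ≤ 4 * δ := by linarith [dist_triangle_left x y p]
  have hl : ‖ξ x - ξ y‖ ≤ K * (4 * δ) := (h.lip x hx y hy).trans (by gcongr)
  have hd : fderiv ℝ (fun q => paraboloid K (f x) (ξ x) x q - paraboloid K (f y) (ξ y) y q) =
      fun _ => ξ x - ξ y + (2 * K) • innerSL ℝ (y - x) := by
    ext1 q
    rw [((hasFDerivAt_paraboloid _ _ _ _).fun_sub (hasFDerivAt_paraboloid _ _ _ _)).fderiv]
    ext v
    simp
    ring
  refine jetBdd_iff.2 ⟨?_, ?_, ?_⟩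
  · have e : paraboloid K (f x) (ξ x) x p - paraboloid K (f y) (ξ y) y p =
        (f x - f y - ξ y (x - y)) + (ξ x - ξ y) (p - x) + K * ‖p - x‖ ^ 2 + -(K * ‖p - y‖ ^ 2) := by
      simp [paraboloid]
      ring
    rw [e]
    refine norm_add₄_le.trans ?_
    have h1 : ‖f x - f y - ξ y (x - y)‖ ≤ K * (4 * δ) ^ 2 := by
      refine (h.taylor y hy x hx).trans ?_
      rw [dist_comm]
      gcongr
    have h2 : ‖(ξ x - ξ y) (p - x)‖ ≤ K * (4 * δ) * (2 * δ) := by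
      refine ((ξ x - ξ y).le_opNorm _).trans ?_
      rw [dist_eq_norm] at hpx
      gcongr
    have h3 : ‖K * ‖p - x‖ ^ 2‖ ≤ K * (2 * δ) ^ 2 := by
      rw [Real.norm_of_nonneg (by positivity), ← dist_eq_norm]
      gcongr
    have h4 : ‖-(K * ‖p - y‖ ^ 2)‖ ≤ K * (2 * δ) ^ 2 := by
      rw [norm_neg, Real.norm_of_nonneg (by positivity), ← dist_eq_norm]
      gcongr
    linarith
  · rw [hd]
    refine (norm_add_le _ _).trans ?_
    rw [norm_smul, innerSL_apply_norm, Real.norm_of_nonneg (by positivity)]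
    rw [dist_comm, dist_eq_norm] at hxy
    have h1 : 2 * K * ‖y - x‖ ≤ 2 * K * (4 * δ) := by gcongr
    have h2 : 32 * K * δ ^ 2 * δ⁻¹ = 32 * K * δ := by field_simp
    have h3 : 0 ≤ K * δ := by positivity
    rw [h2]
    linarith
  · rw [hd, fderiv_fun_const]
    exact (norm_zero (E := E2 →L[ℝ] E2 →L[ℝ] ℝ)).trans_le (by positivity)

lemma exists_nearest {E : Set E2} (hE : E.Finite) (hne : E.Nonempty) (z : E2) :
    ∃ c ∈ E, ∀ y ∈ E, dist z c ≤ dist z y :=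
  Set.exists_min_image E (dist z) hE hne

lemma exists_nearest_neighbour {E : Set E2} (hE : E.Finite) (hne : E.Nontrivial) (x : E2) :
    ∃ c ∈ E, c ≠ x ∧ ∀ y ∈ E, y ≠ x → dist x c ≤ dist x y := by
  obtain ⟨c, hc, h⟩ := exists_nearest (hE.subset (Set.sdiff_subset (t := {x})))
    (hne.exists_ne x |>.imp fun y hy => ⟨hy.1, hy.2⟩) x
  exact ⟨c, hc.1, hc.2, fun y hy hyx => h y ⟨hy, hyx⟩⟩

/-- A bounded-depth Whitney extension operator preserving nonnegativity. -/
theorem exists_whitney_extension (hK : 1 ≤ K) : ∃ (N : ℕ) (C : ℝ), ∀ E : Set E2, E.Finite →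
    E.Nontrivial → ∃ Φ : (E2 → ℝ) → (E2 → E2 →L[ℝ] ℝ) → E2 → ℝ,
      (∀ p, ∃ T : Finset E2, (↑T : Set E2) ⊆ E ∧ T.card ≤ N ∧ ∀ f ξ f' ξ', Set.EqOn f f' ↑T →
        Set.EqOn ξ ξ' ↑T → Φ f ξ =ᶠ[𝓝 p] Φ f' ξ') ∧
      ∀ f ξ, WhitneyData E f ξ K → (∀ p, 0 ≤ Φ f ξ p) ∧ C2BddBy (Φ f ξ) C ∧
        ∀ x ∈ E, Φ f ξ x = f x := by
  obtain ⟨N, C, hNC⟩ := exists_scalePartition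
  have hK0 : 0 < K := by linarith
  refine ⟨N, N * (4 * C * (32 * K)) + 7 * K, fun E hE hne => ?_⟩
  choose n hnE hnx hn using exists_nearest_neighbour hE hne
  choose c hcE hc using exists_nearest hE hne.nonempty
  classical
  obtain ⟨δ, hδ0, hδl, hδ1, hδT, hδa⟩ :=
    exists_cone_scale (hE.toFinset.image fun x => (x, dist x (n x))) (by
      intro t ht
      obtain ⟨x, -, rfl⟩ := Finset.mem_image.1 ht
      exact dist_pos.2 (hnx x).symm)
  obtain ⟨T⟩ := hNC δ hδ0 hδl
  have hδn : ∀ x ∈ E, ∀ z, δ z ≤ dist x (n x) + dist z x := fun x hx z =>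
    hδT (x, dist x (n x)) (Finset.mem_image.2 ⟨x, by simpa using hx, rfl⟩) z
  have hδcase : ∀ z, δ z = 1 ∨ dist z (c z) ≤ δ z := by
    intro z
    rcases hδa z with h | ⟨t, ht, h⟩
    · exact .inl h
    · obtain ⟨x, hx, rfl⟩ := Finset.mem_image.1 ht
      right
      rw [h]
      have := hc z x (by simpa using hx)
      have := dist_nonneg (x := x) (y := n x)
      linarith
  have hnear : ∀ z, dist z (c z) ≤ 1 → dist z (c z) ≤ δ z := fun z hz => by
    rcases hδcase z with h | h
    · rwa [h]
    · exact h
  have hfar : ∀ z, ¬ dist z (c z) ≤ 1 → δ z = 1 := fun z hz =>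
    (hδcase z).resolve_right fun h => hz (h.trans (hδ1 z))
  let P : (E2 → ℝ) → (E2 → E2 →L[ℝ] ℝ) → E2 → E2 → ℝ := fun f ξ z =>
    if dist z (c z) ≤ 1 then paraboloid K (f (c z)) (ξ (c z)) (c z) else fun _ => 0
  have hPs : ∀ f ξ z, ContDiff ℝ 2 (P f ξ z) := fun f ξ z => by
    by_cases h : dist z (c z) ≤ 1
    · simpa [P, h] using contDiff_paraboloid _ _ _
    · simpa [P, h] using contDiff_const
  refine ⟨fun f ξ => T.glue (P f ξ), fun p => ⟨(T.I p).image c, ?_, ?_, ?_⟩, fun f ξ h => ?_⟩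
  · intro y hy
    obtain ⟨z, -, rfl⟩ := Finset.mem_image.1 (Finset.mem_coe.1 hy)
    exact hcE z
  · exact Finset.card_image_le.trans (T.card_le p)
  · intro f ξ f' ξ' hf hξ
    refine T.glue_congr fun z hz => ?_
    have hz' : c z ∈ (↑((T.I p).image c) : Set E2) :=
      Finset.mem_coe.2 (Finset.mem_image_of_mem c hz)
    simp only [P, hf hz', hξ hz']
  · have hdist : ∀ p, ∀ z ∈ T.I p, dist p z ≤ δ z / 8 ∧ δ z ≤ 8 / 7 * δ p := fun p z hz => by
      have h1 := T.dist_le p z hz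
      have h2 := hδl z p
      rw [dist_comm] at h2
      exact ⟨h1, by linarith⟩
    have hξK : ∀ x ∈ E, ‖ξ x‖ ≤ K := fun x hx => by
      have h1 := h.sq_le x hx
      have h2 := h.le x hx
      exact abs_le_of_sq_le_sq' (by nlinarith) hK0.le |>.2
    have hfK : ∀ x ∈ E, |f x| ≤ K := fun x hx => by
      rw [abs_of_nonneg (h.nonneg x hx)]; exact h.le x hx
    have hpc : ∀ p, ∀ z ∈ T.I p, dist z (c z) ≤ 1 → dist p (c z) ≤ 2 * δ p := fun p z hz hz1 => by
      have h1 := hnear z hz1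
      have h2 := hdist p z hz
      have h3 := dist_triangle p z (c z)
      linarith [hδ0 p]
    have hPB : ∀ p, ∀ z ∈ T.I p, JetBdd (P f ξ z) p 1 (7 * K) := fun p z hz => by
      by_cases hz1 : dist z (c z) ≤ 1
      · simp only [P, hz1, if_true]
        exact jetBdd_paraboloid hK0.le (hfK _ (hcE z)) (hξK _ (hcE z))
          ((hpc p z hz hz1).trans (by linarith [hδ1 p]))
      · simp only [P, hz1, if_false]
        exact (jetBdd_const 0 p zero_le_one).mono zero_le_one (by simpa using hK0.le)
    have hPB' : ∀ p, ∀ z ∈ T.I p, 7 / 8 ≤ δ p →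
        JetBdd (P f ξ z) p (δ p) (16 * K * δ p ^ 2) := fun p z hz hp => by
      refine ((hPB p z hz).rescale (k := 1) one_pos (hδ0 p) le_rfl (by linarith [hδ1 p])).mono
        (hδ0 p).le ?_
      have : (7 / 8) ^ 2 ≤ δ p ^ 2 := by gcongr
      nlinarith
    have hsub : ∀ p, ∀ z ∈ T.I p, ∀ w ∈ T.I p,
        JetBdd (fun q => P f ξ z q - P f ξ w q) p (δ p) (32 * K * δ p ^ 2) := by
      intro p z hz w hw
      by_cases hzw : dist z (c z) ≤ 1 ∧ dist w (c w) ≤ 1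
      · simp only [P, hzw.1, hzw.2, if_true]
        exact h.jetBdd_sub hK0.le (hcE z) (hcE w) (hδ0 p) (hpc p z hz hzw.1) (hpc p w hw hzw.2)
      · have hp : 7 / 8 ≤ δ p := by
          rcases not_and_or.1 hzw with h' | h'
          · linarith [hfar z h', (hdist p z hz).2]
          · linarith [hfar w h', (hdist p w hw).2]
        refine ((hPB' p z hz hp).sub (hPs f ξ z) (hPs f ξ w) (hPB' p w hw hp)).mono (hδ0 p).le ?_
        linarith
    refine ⟨fun p => ?_, ⟨T.glue_contDiff _ (hPs f ξ), fun p i hi => ?_⟩, fun x hx => ?_⟩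
    · refine Finset.sum_nonneg fun z _ => mul_nonneg (T.nonneg z p) ?_
      by_cases hz1 : dist z (c z) ≤ 1
      · simp only [P, hz1, if_true]
        exact paraboloid_nonneg hK0 (h.sq_le _ (hcE z)) _ _
      · simp [P, hz1]
    · obtain ⟨w, hw⟩ := T.I_nonempty p
      have h1 := T.glue_sub_jetBdd (P f ξ) hδ0 (hPs f ξ) (z₀ := w) fun z hz => hsub p z hz w hw
      have h2 : JetBdd (fun q => T.glue (P f ξ) q - P f ξ w q) p 1 (N * (4 * C * (32 * K))) := by
        intro j hj
        refine (h1 j hj).trans ?_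
        have hC : 0 ≤ C := (T.bound w p).nonneg
        have h3 : δ p ^ 2 * (δ p)⁻¹ ^ j ≤ 1 := by
          have : δ p ^ 2 * (δ p)⁻¹ ^ j = δ p ^ (2 - j) := by
            rw [inv_pow, ← div_eq_mul_inv, pow_sub₀ _ (hδ0 p).ne' hj, div_eq_mul_inv]
          rw [this]
          exact pow_le_one₀ (hδ0 p).le (hδ1 p)
        calc _ = N * (4 * C * (32 * K)) * (δ p ^ 2 * (δ p)⁻¹ ^ j) := by ring
          _ ≤ N * (4 * C * (32 * K)) * 1 := by gcongr
          _ = _ := by simp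
      have h3 := JetBdd.add ((T.glue_contDiff _ (hPs f ξ)).sub (hPs f ξ w)) (hPs f ξ w) h2
        (hPB p w hw)
      simpa using h3 i hi
    · have hcx : ∀ z ∈ T.I x, P f ξ z = paraboloid K (f x) (ξ x) x := by
        intro z hz
        have h1 := (hdist x z hz).1
        have h2 := hc z x hx
        have h3 : c z = x := by
          by_contra hne'
          have h4 := hn x (c z) (hcE z) hne'
          have h5 := hδn x hx z
          have h6 := dist_triangle x z (c z)
          rw [dist_comm] at h1
          rw [dist_comm x z] at h6
          linarith [hδ0 z]
        have h4 : dist z (c z) ≤ 1 := by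
          rw [dist_comm] at h1
          linarith [hδ1 z, hδ0 z]
        simp only [P, h4, if_true]
        rw [h3]
      calc T.glue (P f ξ) x = ∑ z ∈ T.I x, T.θ z x • f x :=
            Finset.sum_congr rfl fun z hz => by rw [hcx z hz, paraboloid_self]
        _ = f x := by rw [← Finset.sum_smul, T.sum_eq_one, one_smul]

end Whitney

section Frame

/-- Rotation by a right angle. -/
noncomputable def rot (v : E2) : E2 := !₂[-v 1, v 0]

lemma inner_eq_coord (u v : E2) : inner ℝ u v = u 0 * v 0 + u 1 * v 1 := by
  simp [PiLp.inner_apply, Fin.sum_univ_two, mul_comm]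

lemma norm_rot (v : E2) : ‖rot v‖ = ‖v‖ := by
  simp [EuclideanSpace.norm_eq, rot, Fin.sum_univ_two, add_comm]

lemma coord_sq_add_sq {t : E2} (ht : ‖t‖ = 1) : t 0 ^ 2 + t 1 ^ 2 = 1 := by
  have := real_inner_self_eq_norm_sq t
  rw [ht, inner_eq_coord] at this
  linarith

lemma frame_decomp {t : E2} (ht : ‖t‖ = 1) (w : E2) :
    w = inner ℝ t w • t + inner ℝ (rot t) w • rot t := by
  have h := coord_sq_add_sq ht
  ext i
  fin_cases i
  · simp [inner_eq_coord, rot]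
    linear_combination (-w 0) * h
  · simp [inner_eq_coord, rot]
    linear_combination (-w 1) * h

lemma apply_frame_decomp {t : E2} (ht : ‖t‖ = 1) (b : E2 →L[ℝ] ℝ) (w : E2) :
    b w = inner ℝ t w * b t + inner ℝ (rot t) w * b (rot t) := by
  conv_lhs => rw [frame_decomp ht w]
  simp

lemma frame_decomp_dual {t : E2} (ht : ‖t‖ = 1) (b : E2 →L[ℝ] ℝ) :
    b = b t • innerSL ℝ t + b (rot t) • innerSL ℝ (rot t) := by
  ext w
  simp [apply_frame_decomp ht b w, mul_comm]

lemma norm_smul_innerSL {t : E2} (ht : ‖t‖ = 1) (c : ℝ) : ‖c • innerSL ℝ t‖ = |c| := by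
  rw [norm_smul, innerSL_apply_norm, ht, mul_one, Real.norm_eq_abs]

lemma abs_inner_le {t : E2} (ht : ‖t‖ = 1) (w : E2) : |inner ℝ t w| ≤ ‖w‖ := by
  simpa [ht] using abs_real_inner_le_norm t w

lemma abs_apply_le {t : E2} (ht : ‖t‖ = 1) (b : E2 →L[ℝ] ℝ) : |b t| ≤ ‖b‖ := by
  simpa [ht] using b.le_opNorm t

lemma norm_le_frame {t : E2} (ht : ‖t‖ = 1) (b : E2 →L[ℝ] ℝ) : ‖b‖ ≤ |b t| + |b (rot t)| := by
  conv_lhs => rw [frame_decomp_dual ht b]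
  refine (norm_add_le _ _).trans ?_
  rw [norm_smul_innerSL ht, norm_smul_innerSL (by rw [norm_rot, ht])]

/-- The component of a covector normal to the direction `t`. -/
noncomputable def normalPart (t : E2) (b : E2 →L[ℝ] ℝ) : E2 →L[ℝ] ℝ :=
  b (rot t) • innerSL ℝ (rot t)

lemma normalPart_sub (t : E2) (b c : E2 →L[ℝ] ℝ) :
    normalPart t (b - c) = normalPart t b - normalPart t c := by
  simp [normalPart, sub_smul]

lemma norm_normalPart_le {t : E2} (ht : ‖t‖ = 1) (b : E2 →L[ℝ] ℝ) : ‖normalPart t b‖ ≤ ‖b‖ := by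
  have h : ‖rot t‖ = 1 := by rw [norm_rot, ht]
  rw [normalPart, norm_smul_innerSL h]
  exact abs_apply_le h b

lemma norm_normalPart_sub_le {t u : E2} (ht : ‖t‖ = 1) (hu : ‖u‖ = 1) (b : E2 →L[ℝ] ℝ) :
    ‖normalPart t b - normalPart u b‖ ≤ 3 * (‖b‖ * |inner ℝ (rot t) u|) := by
  have ht' : ‖rot t‖ = 1 := by rw [norm_rot, ht]
  have hu' : ‖rot u‖ = 1 := by rw [norm_rot, hu]
  set s := inner ℝ u (rot t) with hs
  set c := inner ℝ (rot u) (rot t) with hc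
  have hn : rot t = s • u + c • rot u := frame_decomp hu (rot t)
  have hsc : s ^ 2 + c ^ 2 = 1 := by
    have h1 := real_inner_self_eq_norm_sq (rot t)
    rw [ht'] at h1
    nth_rewrite 1 [hn] at h1
    rw [inner_add_left, real_inner_smul_left, real_inner_smul_left, ← hs, ← hc] at h1
    linarith
  have hb : b (rot t) = s * b u + c * b (rot u) := apply_frame_decomp hu b (rot t)
  have key : normalPart t b - normalPart u b =
      (s * b (rot t)) • innerSL ℝ u + (s * (c * b u - s * b (rot u))) • innerSL ℝ (rot u) := by
    ext w
    have h1 : inner ℝ (rot t) w = s * inner ℝ u w + c * inner ℝ (rot u) w := by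
      rw [hn, inner_add_left, real_inner_smul_left, real_inner_smul_left]
    simp only [normalPart, sub_apply, add_apply, smul_apply, innerSL_apply_apply, smul_eq_mul, h1, hb]
    linear_combination (b (rot u) * inner ℝ (rot u) w) * hsc
  have h1 := abs_apply_le ht' b
  have h2 := abs_apply_le hu b
  have h3 := abs_apply_le hu' b
  have h4 : |c| ≤ 1 := by
    rw [← sq_le_one_iff_abs_le_one]; nlinarith [sq_nonneg s]
  have h5 : |s| ≤ 1 := by
    rw [← sq_le_one_iff_abs_le_one]; nlinarith [sq_nonneg c]
  have h6 : |c * b u - s * b (rot u)| ≤ 1 * ‖b‖ + 1 * ‖b‖ := by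
    refine (abs_sub _ _).trans ?_
    rw [abs_mul, abs_mul]
    gcongr
  rw [key]
  refine (norm_add_le _ _).trans ?_
  rw [norm_smul_innerSL hu, norm_smul_innerSL hu', abs_mul, abs_mul, real_inner_comm, ← hs]
  have h7 : |s| * |b (rot t)| ≤ |s| * ‖b‖ := by gcongr
  have h8 : |s| * |c * b u - s * b (rot u)| ≤ |s| * (1 * ‖b‖ + 1 * ‖b‖) := by gcongr
  linarith

end Frame

section Selection

lemma WhitneyData.norm_le_two_mul {E : Set E2} {F : E2 → ℝ} {a : E2 → E2 →L[ℝ] ℝ}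
    (h : WhitneyData E F a 4) {x : E2} (hx : x ∈ E) {s : ℝ} (hs : 0 ≤ s) (hF : F x ≤ s ^ 2) :
    ‖a x‖ ≤ 2 * s := by
  have := h.sq_le x hx
  exact abs_le_of_sq_le_sq' (by nlinarith) (by positivity) |>.2

/-- A covector that is small in two directions is controlled by the curvature they determine. -/
lemma norm_le_of_two_directions {t w : E2} (ht : ‖t‖ = 1) {e : E2 →L[ℝ] ℝ} {r A : ℝ}
    (hA : 0 ≤ A) (hr : 0 < r) (hrw : r ≤ ‖w‖) (hw : inner ℝ (rot t) w ≠ 0)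
    (h1 : |e (r • t)| ≤ A * r ^ 2) (h2 : |e w| ≤ A * ‖w‖ ^ 2) :
    ‖e‖ ≤ 3 * A * (‖w‖ ^ 2 / |inner ℝ (rot t) w|) := by
  have hw' : 0 < |inner ℝ (rot t) w| := abs_pos.2 hw
  have hn : |inner ℝ (rot t) w| ≤ ‖w‖ := abs_inner_le (by rw [norm_rot, ht]) w
  have h3 : |e t| ≤ A * ‖w‖ := by
    rw [map_smul, smul_eq_mul, abs_mul, abs_of_pos hr] at h1
    have : |e t| ≤ A * r := le_of_mul_le_mul_left (by linarith) hr
    exact this.trans (by gcongr)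
  have h4 : |e (rot t)| * |inner ℝ (rot t) w| ≤ 2 * A * ‖w‖ ^ 2 := by
    have h5 : inner ℝ (rot t) w * e (rot t) = e w - inner ℝ t w * e t := by
      rw [apply_frame_decomp ht e w]
      ring
    rw [mul_comm, ← abs_mul, h5]
    refine (abs_sub _ _).trans ?_
    rw [abs_mul]
    have : |inner ℝ t w| * |e t| ≤ ‖w‖ * (A * ‖w‖) := by
      have := abs_inner_le ht w
      gcongr
    linarith
  have h6 : ‖e‖ * |inner ℝ (rot t) w| ≤ 3 * A * ‖w‖ ^ 2 := by
    have h7 := norm_le_frame ht e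
    have h8 : |e t| * |inner ℝ (rot t) w| ≤ A * ‖w‖ * ‖w‖ := by gcongr
    have h9 : ‖e‖ * |inner ℝ (rot t) w| ≤ (|e t| + |e (rot t)|) * |inner ℝ (rot t) w| := by gcongr
    linarith
  rw [← mul_div_assoc]
  exact (le_div_iff₀ hw').2 h6

/-- Unit vector pointing from `x` to `y`. -/
noncomputable def dir (x y : E2) : E2 := (dist x y)⁻¹ • (y - x)

lemma norm_dir {x y : E2} (h : x ≠ y) : ‖dir x y‖ = 1 := by
  have := dist_pos.2 h
  rw [dir, norm_smul, ← dist_eq_norm, dist_comm y x, norm_inv, Real.norm_of_nonneg dist_nonneg,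
    inv_mul_cancel₀ this.ne']

lemma dist_smul_dir {x y : E2} (h : x ≠ y) : dist x y • dir x y = y - x := by
  rw [dir, smul_smul, mul_inv_cancel₀ (dist_pos.2 h).ne', one_smul]

/-- A gradient at `y` compatible with prescribed values at three points, when there is one. -/
noncomputable def compatibleGradient (y y₁ y₂ : E2) (f : E2 → ℝ) : E2 →L[ℝ] ℝ :=
  Classical.epsilon fun η => |f y₁ - f y - η (y₁ - y)| ≤ 4 * dist y y₁ ^ 2 ∧
    |f y₂ - f y - η (y₂ - y)| ≤ 4 * dist y y₂ ^ 2

lemma norm_compatibleGradient_sub_le {F : E2 → ℝ} {a : E2 → E2 →L[ℝ] ℝ}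
    (h : WhitneyData univ F a 4) {y y₁ y₂ : E2} (h1 : y ≠ y₁) (h12 : dist y y₁ ≤ dist y y₂)
    (hn : inner ℝ (rot (dir y y₁)) (y₂ - y) ≠ 0) :
    ‖compatibleGradient y y₁ y₂ F - a y‖ ≤
      24 * (dist y y₂ ^ 2 / |inner ℝ (rot (dir y y₁)) (y₂ - y)|) := by
  obtain ⟨hη1, hη2⟩ : |F y₁ - F y - compatibleGradient y y₁ y₂ F (y₁ - y)| ≤ 4 * dist y y₁ ^ 2 ∧
      |F y₂ - F y - compatibleGradient y y₁ y₂ F (y₂ - y)| ≤ 4 * dist y y₂ ^ 2 :=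
    Classical.epsilon_spec (p := fun η : E2 →L[ℝ] ℝ =>
      |F y₁ - F y - η (y₁ - y)| ≤ 4 * dist y y₁ ^ 2 ∧
      |F y₂ - F y - η (y₂ - y)| ≤ 4 * dist y y₂ ^ 2)
      ⟨a y, h.taylor y trivial y₁ trivial, h.taylor y trivial y₂ trivial⟩
  have key : ∀ q, |F q - F y - compatibleGradient y y₁ y₂ F (q - y)| ≤ 4 * dist y q ^ 2 →
      |(compatibleGradient y y₁ y₂ F - a y) (q - y)| ≤ 8 * dist y q ^ 2 := by
    intro q hq
    have hq' := h.taylor y trivial q trivial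
    rw [sub_apply]
    rw [abs_le] at hq hq' ⊢
    constructor <;> linarith
  have hw : ‖y₂ - y‖ = dist y y₂ := by rw [dist_comm, dist_eq_norm]
  have := norm_le_of_two_directions (norm_dir h1) (e := compatibleGradient y y₁ y₂ F - a y)
    (w := y₂ - y) (A := 8) (by norm_num) (dist_pos.2 h1) (h12.trans_eq hw.symm) hn
    (by rw [dist_smul_dir h1]; exact key y₁ hη1) (by rw [hw]; exact key y₂ hη2)
  rw [hw] at this
  linarith

lemma compatibleGradient_congr {y y₁ y₂ : E2} {f g : E2 → ℝ} (h : f y = g y) (h₁ : f y₁ = g y₁)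
    (h₂ : f y₂ = g y₂) : compatibleGradient y y₁ y₂ f = compatibleGradient y y₁ y₂ g := by
  simp only [compatibleGradient, h, h₁, h₂]

/-- The curvature scale of `E`, relative to a choice `n` of neighbours. -/
lemma exists_curvature_scale {E : Set E2} (hE : E.Finite) (hne : E.Nonempty) (n : E2 → E2) :
    ∃ ρ : E2 → ℝ, (∀ x, 0 < ρ x) ∧ (∀ x y, ρ x ≤ ρ y + dist x y) ∧ (∀ x, ρ x ≤ 1) ∧
      (∀ x ∈ E, ∀ y ∈ E, |inner ℝ (rot (dir x (n x))) (y - x)| * ρ x ≤ dist x y ^ 2) ∧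
      ∀ z, ∃ y ∈ E, ∃ y₂ ∈ E, ρ z = 1 ∨ inner ℝ (rot (dir y (n y))) (y₂ - y) ≠ 0 ∧
        ρ z = dist y y₂ ^ 2 / |inner ℝ (rot (dir y (n y))) (y₂ - y)| + dist z y := by
  classical
  let S := (hE.toFinset ×ˢ hE.toFinset).filter
    fun q => inner ℝ (rot (dir q.1 (n q.1))) (q.2 - q.1) ≠ 0
  have hS : ∀ x y, (x, y) ∈ S ↔ (x ∈ E ∧ y ∈ E) ∧ inner ℝ (rot (dir x (n x))) (y - x) ≠ 0 := by
    simp [S]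
  obtain ⟨ρ, h1, h2, h3, h4, h5⟩ := exists_cone_scale
    (S.image fun q => (q.1, dist q.1 q.2 ^ 2 / |inner ℝ (rot (dir q.1 (n q.1))) (q.2 - q.1)|)) (by
      intro t ht
      obtain ⟨⟨x, y⟩, hxy, rfl⟩ := Finset.mem_image.1 ht
      have hi := ((hS x y).1 hxy).2
      have : x ≠ y := by rintro rfl; simp at hi
      have := dist_pos.2 this
      have := abs_pos.2 hi
      positivity)
  refine ⟨ρ, h1, h2, h3, fun x hx y hy => ?_, fun z => ?_⟩
  · by_cases hi : inner ℝ (rot (dir x (n x))) (y - x) = 0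
    · rw [hi]
      simp
    · have := h4 _ (Finset.mem_image_of_mem _ ((hS x y).2 ⟨⟨hx, hy⟩, hi⟩)) x
      rw [dist_self, add_zero, le_div_iff₀ (abs_pos.2 hi)] at this
      linarith
  · rcases h5 z with h | ⟨t, ht, h⟩
    · obtain ⟨y, hy⟩ := hne
      exact ⟨y, hy, y, hy, .inl h⟩
    · obtain ⟨⟨x, y⟩, hxy, rfl⟩ := Finset.mem_image.1 ht
      have hi := (hS x y).1 hxy
      exact ⟨x, hi.1.1, y, hi.1.2, .inr ⟨hi.2, h⟩⟩

/-- A gradient field of bounded depth approximating, to within the curvature scale, the gradient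
of every nonnegative extension. -/
theorem exists_background : ∃ (N : ℕ) (K : ℝ), 0 ≤ K ∧ ∀ (E : Set E2) (n : E2 → E2), E.Finite →
    E.Nonempty → (∀ x, n x ∈ E) → (∀ x, n x ≠ x) →
    (∀ x, ∀ y ∈ E, y ≠ x → dist x (n x) ≤ dist x y) →
    ∃ (ρ : E2 → ℝ) (η : (E2 → ℝ) → E2 → E2 →L[ℝ] ℝ), (∀ x, 0 < ρ x) ∧
      (∀ x ∈ E, ∀ y ∈ E, |inner ℝ (rot (dir x (n x))) (y - x)| * ρ x ≤ dist x y ^ 2) ∧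
      (∀ p, ∃ S : Finset E2, (S : Set E2) ⊆ E ∧ S.card ≤ N ∧ ∀ f g, EqOn f g S →
        η f p = η g p) ∧
      ∀ f F a, WhitneyData univ F a 4 → EqOn F f E → (∀ x, ‖η f x - a x‖ ≤ K * ρ x) ∧
        (∀ x y, ‖η f x - η f y‖ ≤ K * dist x y) ∧ ∀ x, ‖η f x‖ ^ 2 ≤ K * F x := by
  obtain ⟨N, C, hNC⟩ := exists_scalePartition
  obtain ⟨K₀, hK₀⟩ : ∃ K₀, K₀ = N * (4 * C * 66) := ⟨_, rfl⟩
  have hC0 : 0 ≤ C := by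
    obtain ⟨T⟩ := hNC (fun _ => 1) (fun _ => one_pos) (fun x y => by simp)
    exact (T.bound 0 0).nonneg
  have hK₀0 : 0 ≤ K₀ := by rw [hK₀]; positivity
  refine ⟨N * 3, (K₀ + 36) ^ 2, by positivity, fun E n hE hne hnE hnx hn => ?_⟩
  obtain ⟨ρ, h0, hl, h1, hEρ, ha⟩ := exists_curvature_scale hE hne n
  choose Y hYE Y₂ hY₂E hY using ha
  obtain ⟨T⟩ := hNC ρ h0 hl
  classical
  let G : (E2 → ℝ) → E2 → E2 →L[ℝ] ℝ := fun f z =>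
    if ρ z = 1 ∨ f (Y z) ≤ (4 * ρ z) ^ 2 then 0
    else compatibleGradient (Y z) (n (Y z)) (Y₂ z) f
  have hY' : ∀ z, ρ z ≠ 1 → dist z (Y z) ≤ ρ z := fun z hz => by
    rw [((hY z).resolve_left hz).2]
    have : 0 ≤ dist (Y z) (Y₂ z) ^ 2 / |inner ℝ (rot (dir (Y z) (n (Y z)))) (Y₂ z - Y z)| := by
      positivity
    linarith
  have hdist : ∀ p, ∀ z ∈ T.I p, dist p z ≤ ρ z / 8 ∧ ρ z ≤ 8 / 7 * ρ p ∧ ρ p ≤ 9 / 8 * ρ z :=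
    fun p z hz => by
      have h1 := T.dist_le p z hz
      have h2 := hl z p
      have h3 := hl p z
      rw [dist_comm] at h2
      exact ⟨h1, by linarith, by linarith⟩
  refine ⟨ρ, fun f => T.glue fun z _ => G f z, h0, hEρ, fun p => ?_, fun f F a h hFf => ?_⟩
  · refine ⟨(T.I p).biUnion fun z => {Y z, n (Y z), Y₂ z}, ?_, ?_, fun f g hfg => ?_⟩
    · intro y hy
      simp only [Finset.coe_biUnion, mem_iUnion, Finset.coe_insert, Finset.coe_singleton,
        mem_insert_iff, mem_singleton_iff] at hy
      obtain ⟨z, -, rfl | rfl | rfl⟩ := hy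
      exacts [hYE z, hnE _, hY₂E z]
    · refine (Finset.card_biUnion_le_card_mul _ _ 3 fun z _ => Finset.card_le_three).trans ?_
      gcongr
      exact T.card_le p
    · refine (T.glue_congr fun z hz => ?_).eq_of_nhds
      have hm : ∀ q ∈ ({Y z, n (Y z), Y₂ z} : Finset E2), f q = g q := fun q hq =>
        hfg (Finset.mem_coe.2 (Finset.mem_biUnion.2 ⟨z, hz, hq⟩))
      have e1 := hm (Y z) (by simp)
      funext q
      simp only [G, e1, compatibleGradient_congr e1 (hm (n (Y z)) (by simp))
        (hm (Y₂ z) (by simp))]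
  · have hGc : ∀ z, G f z = G F z := fun z => by
      have e1 := hFf (hYE z)
      simp only [G, e1, compatibleGradient_congr e1 (hFf (hnE (Y z))) (hFf (hY₂E z))]
    have hG : ∀ z, ‖G f z - a z‖ ≤ 28 * ρ z := fun z => by
      rw [hGc]
      by_cases hz : ρ z = 1
      · have h2 := h.norm_le_two_mul (x := z) trivial (s := 2) (by norm_num)
          ((h.le z trivial).trans (by norm_num))
        simp only [G, hz, true_or, if_true, zero_sub, norm_neg]
        linarith
      · have hd : ‖a (Y z) - a z‖ ≤ 4 * ρ z := by
          refine (h.lip _ trivial _ trivial).trans ?_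
          rw [dist_comm]
          linarith [hY' z hz]
        have h3 : ‖G F z - a (Y z)‖ ≤ 24 * ρ z := by
          by_cases hf : F (Y z) ≤ (4 * ρ z) ^ 2
          · have := h.norm_le_two_mul trivial (by linarith [h0 z]) hf
            simp only [G, hf, or_true, if_true, zero_sub, norm_neg]
            linarith [h0 z]
          · obtain ⟨hi, hv⟩ := (hY z).resolve_left hz
            have hne2 : Y₂ z ≠ Y z := by
              intro he
              rw [he, sub_self, inner_zero_right] at hi
              exact hi rfl
            have := norm_compatibleGradient_sub_le h (hnx (Y z)).symm
              (hn (Y z) (Y₂ z) (hY₂E z) hne2) hi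
            simp only [G, hf, hz, or_self, if_false]
            have := dist_nonneg (x := z) (y := Y z)
            linarith
        have := norm_sub_le_norm_sub_add_norm_sub (G F z) (a (Y z)) (a z)
        linarith
    have hsub : ∀ p, ∀ z ∈ T.I p, ∀ w ∈ T.I p, ‖G f z - G f w‖ ≤ 66 * ρ p := by
      intro p z hz w hw
      have h2 := hdist p z hz
      have h3 := hdist p w hw
      have h4 := (h.lip z trivial w trivial).trans
        (mul_le_mul_of_nonneg_left (dist_triangle_left z w p) (by norm_num))
      have h5 := norm_sub_le_norm_sub_add_norm_sub (G f z) (a z) (G f w)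
      have h6 := norm_sub_le_norm_sub_add_norm_sub (a z) (a w) (G f w)
      have h7 := hG z
      have h8 := hG w
      rw [norm_sub_rev] at h8
      linarith [h0 p]
    have hP : ∀ z, ContDiff ℝ 2 fun _ : E2 => G f z := fun z => contDiff_const
    have hjet : ∀ p, ∀ w ∈ T.I p,
        JetBdd (fun q => T.glue (fun z _ => G f z) q - G f w) p (ρ p) (K₀ * ρ p) := by
      intro p w hw
      have := T.glue_sub_jetBdd (fun z _ => G f z) h0 hP (p := p) (z₀ := w) (A := 66 * ρ p) (by
        intro z hz
        exact (jetBdd_const (G f z - G f w) p (h0 p).le).mono (h0 p).le (hsub p z hz w hw))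
      refine this.mono (h0 p).le (le_of_eq ?_)
      rw [hK₀]
      ring
    have hclose : ∀ x, ‖T.glue (fun z _ => G f z) x - a x‖ ≤ (K₀ + 34) * ρ x := fun x => by
      obtain ⟨w, hw⟩ := T.I_nonempty x
      have h2 := (jetBdd_iff.1 (hjet x w hw)).1
      have h3 := hG w
      have h4 := h.lip w trivial x trivial
      have h5 := hdist x w hw
      rw [dist_comm] at h4
      have h6 := norm_sub_le_norm_sub_add_norm_sub (T.glue (fun z _ => G f z) x) (G f w) (a x)
      have h7 := norm_sub_le_norm_sub_add_norm_sub (G f w) (a w) (a x)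
      linarith [h0 x]
    refine ⟨fun x => (hclose x).trans ?_, fun x y => ?_, fun x => ?_⟩
    · have := h0 x
      gcongr
      nlinarith
    · have hd := T.glue_contDiff (fun z _ => G f z) hP
      have hD : ∀ q, ‖fderiv ℝ (T.glue fun z _ => G f z) q‖ ≤ K₀ := fun q => by
        obtain ⟨w, hw⟩ := T.I_nonempty q
        have h2 := (jetBdd_iff.1 (hjet q w hw)).2.1
        rw [fderiv_sub_const, mul_assoc, mul_inv_cancel₀ (h0 q).ne', mul_one] at h2
        exact h2
      have := Convex.norm_image_sub_le_of_norm_fderiv_le (𝕜 := ℝ) (s := univ)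
        (fun q _ => (hd.differentiable (by norm_num)) q) (fun q _ => hD q) convex_univ
        (mem_univ y) (mem_univ x)
      rw [← dist_eq_norm x y] at this
      refine this.trans ?_
      gcongr
      nlinarith
    · rw [← Real.sq_sqrt (h.nonneg x trivial)]
      set s := √(F x) with hs
      have hs0 : 0 ≤ s := Real.sqrt_nonneg _
      have hFs : F x ≤ s ^ 2 := (Real.sq_sqrt (h.nonneg x trivial)).ge
      have hax := h.norm_le_two_mul trivial hs0 hFs
      rw [← mul_pow]
      refine pow_le_pow_left₀ (norm_nonneg _) ?_ 2
      beta_reduce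
      by_cases hsρ : s < ρ x
      · have hG0 : ∀ z ∈ T.I x, G f z = 0 := fun z hz => by
          by_cases hz1 : ρ z = 1
          · simp [G, hz1]
          · rw [hGc]
            have h2 := hdist x z hz
            have h3 := hY' z hz1
            have hxY : dist x (Y z) ≤ 9 / 8 * ρ z := by
              linarith [dist_triangle x z (Y z)]
            have h4 := (abs_le.1 (h.taylor x trivial (Y z) trivial)).2
            have h5 := (abs_le.1 ((a x).le_opNorm (Y z - x))).2
            rw [← dist_eq_norm, dist_comm (Y z) x] at h5
            have h6 : ‖a x‖ * dist x (Y z) ≤ 2 * s * dist x (Y z) := by gcongr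
            have h7 : (s + 2 * dist x (Y z)) ^ 2 ≤ (4 * ρ z) ^ 2 :=
              pow_le_pow_left₀ (by positivity) (by linarith [h0 z]) 2
            have h8 : F (Y z) ≤ (4 * ρ z) ^ 2 := by
              nlinarith [mul_nonneg hs0 (dist_nonneg (x := x) (y := Y z))]
            simp only [G, h8, or_true, if_true]
        have : T.glue (fun z _ => G f z) x = 0 :=
          Finset.sum_eq_zero fun z hz => by beta_reduce; rw [hG0 z hz, smul_zero]
        rw [this, norm_zero]
        positivity
      · have h2 := hclose x
        have h3 := norm_sub_norm_le (T.glue (fun z _ => G f z) x) (a x)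
        have h4 : (K₀ + 34) * ρ x ≤ (K₀ + 34) * s := by
          have := not_lt.1 hsρ
          gcongr
        linarith

/-- A gradient selection of bounded depth for the traces of nonnegative functions. -/
theorem exists_gradient_selection : ∃ (N : ℕ) (K : ℝ), 1 ≤ K ∧ ∀ E : Set E2, E.Finite →
    E.Nontrivial → ∃ ξ : (E2 → ℝ) → E2 → E2 →L[ℝ] ℝ,
      (∀ x ∈ E, ∃ S : Finset E2, (S : Set E2) ⊆ E ∧ S.card ≤ N ∧ ∀ f g, EqOn f g S →
        ξ f x = ξ g x) ∧
      ∀ f F a, WhitneyData univ F a 4 → EqOn F f E → WhitneyData E f (ξ f) K := by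
  obtain ⟨N, K, hK, hNK⟩ := exists_background
  refine ⟨N + 2, 7 * K + 80, by linarith, fun E hE hne => ?_⟩
  choose n hnE hnx hn using exists_nearest_neighbour hE hne
  obtain ⟨ρ, η, h0, hρ, hηloc, hη⟩ := hNK E n hE hne.nonempty hnE hnx hn
  classical
  let t : E2 → E2 := fun x => dir x (n x)
  let r : E2 → ℝ := fun x => dist x (n x)
  have ht : ∀ x, ‖t x‖ = 1 := fun x => norm_dir (hnx x).symm
  have hr : ∀ x, 0 < r x := fun x => dist_pos.2 (hnx x).symm
  let s : (E2 → ℝ) → E2 → ℝ := fun f x => if f x ≤ r x ^ 2 then 0 else (f (n x) - f x) / r x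
  refine ⟨fun f x => s f x • innerSL ℝ (t x) + normalPart (t x) (η f x), fun x hx => ?_,
    fun f F a h hFf => ?_⟩
  · obtain ⟨S, hSE, hSN, hS⟩ := hηloc x
    refine ⟨insert x (insert (n x) S), ?_, ?_, fun f g hfg => ?_⟩
    · intro y hy
      rcases Finset.mem_insert.1 (Finset.mem_coe.1 hy) with rfl | hy
      · exact hx
      rcases Finset.mem_insert.1 hy with rfl | hy
      · exact hnE x
      · exact hSE hy
    · exact (Finset.card_insert_le _ _).trans (Nat.succ_le_succ
        ((Finset.card_insert_le _ _).trans (Nat.succ_le_succ hSN)))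
    · have h1 : f x = g x := hfg (by simp)
      have h2 : f (n x) = g (n x) := hfg (by simp)
      have h3 := hS f g (hfg.mono (by
        intro y hy
        exact Finset.mem_coe.2 (Finset.mem_insert_of_mem (Finset.mem_insert_of_mem hy))))
      simp only [s, h1, h2, h3]
  obtain ⟨hclose, hlip, hsq⟩ := hη f F a h hFf
  have hrd : ∀ x, ∀ y ∈ E, x ≠ y → r x ≤ dist x y := fun x y hy hxy => hn x y hy hxy.symm
  have hfx : ∀ x ∈ E, f x = F x := fun x hx => (hFf hx).symm
  have hs : ∀ x ∈ E, |s f x - a x (t x)| ≤ 4 * r x := by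
    intro x hx
    by_cases hf : f x ≤ r x ^ 2
    · have h1 := h.norm_le_two_mul (x := x) trivial (hr x).le (hfx x hx ▸ hf)
      have h2 := abs_apply_le (ht x) (a x)
      simp only [s, hf, if_true, zero_sub, abs_neg]
      linarith [hr x]
    · have h1 := h.taylor x trivial (n x) trivial
      have h2 : n x - x = r x • t x := (dist_smul_dir (hnx x).symm).symm
      rw [h2, map_smul, smul_eq_mul, ← hfx x hx, ← hfx (n x) (hnE x)] at h1
      have h3 : s f x - a x (t x) = (f (n x) - f x - r x * a x (t x)) / r x := by
        simp only [s, hf, if_false]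
        field_simp [(hr x).ne']
      rw [h3, abs_div, abs_of_pos (hr x), div_le_iff₀ (hr x)]
      calc _ ≤ 4 * r x ^ 2 := h1
        _ = _ := by ring
  have hs2 : ∀ x ∈ E, s f x ^ 2 ≤ 36 * f x := by
    intro x hx
    have hf0 : 0 ≤ f x := hfx x hx ▸ h.nonneg x trivial
    by_cases hf : f x ≤ r x ^ 2
    · simp only [s, hf, if_true]
      linarith
    · have h1 : r x ≤ √(f x) := Real.le_sqrt_of_sq_le (not_le.1 hf).le
      have h2 := h.norm_le_two_mul (x := x) trivial (Real.sqrt_nonneg (f x))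
        (by rw [Real.sq_sqrt hf0, hfx x hx])
      have h3 := abs_apply_le (ht x) (a x)
      have h4 : |s f x| ≤ 6 * √(f x) := by
        have h5 := hs x hx
        have h6 := abs_sub_abs_le_abs_sub (s f x) (a x (t x))
        linarith
      calc s f x ^ 2 = |s f x| ^ 2 := (sq_abs _).symm
        _ ≤ (6 * √(f x)) ^ 2 := pow_le_pow_left₀ (abs_nonneg _) h4 2
        _ = 36 * f x := by rw [mul_pow, Real.sq_sqrt hf0]; norm_num
  have he : ∀ x, s f x • innerSL ℝ (t x) + normalPart (t x) (η f x) =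
      a x + ((s f x - a x (t x)) • innerSL ℝ (t x) + normalPart (t x) (η f x - a x)) := by
    intro x
    rw [normalPart_sub, sub_smul]
    conv_rhs => enter [1]; rw [frame_decomp_dual (ht x) (a x)]
    rw [normalPart, normalPart]
    abel
  have hb : ∀ x ∈ E, ∀ y ∈ E, ‖η f x - a x‖ * |inner ℝ (rot (t x)) (y - x)| ≤ K * dist x y ^ 2 := by
    intro x hx y hy
    have h1 := hclose x
    calc ‖η f x - a x‖ * |inner ℝ (rot (t x)) (y - x)|
        ≤ K * ρ x * |inner ℝ (rot (t x)) (y - x)| := by gcongr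
      _ = K * (|inner ℝ (rot (t x)) (y - x)| * ρ x) := by ring
      _ ≤ K * dist x y ^ 2 := by
        have := hρ x hx y hy
        gcongr
  have hb' : ∀ x ∈ E, ∀ y ∈ E, x ≠ y →
      ‖normalPart (t x) (η f x - a x) - normalPart (dir x y) (η f x - a x)‖ ≤
        3 * (K * dist x y) := by
    intro x hx y hy hxy
    have hd := dist_pos.2 hxy
    refine (norm_normalPart_sub_le (ht x) (norm_dir hxy) _).trans ?_
    have h1 : |inner ℝ (rot (t x)) (dir x y)| = |inner ℝ (rot (t x)) (y - x)| / dist x y := by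
      rw [dir, real_inner_smul_right, abs_mul, abs_of_pos (inv_pos.2 hd), div_eq_inv_mul]
    have h2 := hb x hx y hy
    rw [h1, ← mul_div_assoc]
    gcongr
    rw [div_le_iff₀ hd]
    linarith
  refine ⟨fun x hx => hfx x hx ▸ h.nonneg x trivial, fun x hx => ?_, fun x hx => ?_,
    fun x hx y hy => ?_, fun x hx y hy => ?_⟩
  · have := h.le x trivial
    rw [hfx x hx]
    linarith
  · have hf0 : 0 ≤ f x := hfx x hx ▸ h.nonneg x trivial
    have h1 := norm_add_le (s f x • innerSL ℝ (t x)) (normalPart (t x) (η f x))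
    have h2 := norm_normalPart_le (ht x) (η f x)
    rw [norm_smul_innerSL (ht x)] at h1
    have h3 := hs2 x hx
    have h4 := hsq x
    rw [← hfx x hx] at h4
    have h5 := sq_abs (s f x)
    have h6 := pow_le_pow_left₀ (norm_nonneg _) (h1.trans (add_le_add_right h2 _)) 2
    refine h6.trans ?_
    nlinarith [sq_nonneg (|s f x| - ‖η f x‖), mul_nonneg hK hf0]
  · rcases eq_or_ne x y with rfl | hxy
    · simp
    have hd := dist_pos.2 hxy
    have h1 := hb' x hx y hy hxy
    have h2 := hb' y hy x hx hxy.symm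
    have h3 : normalPart (dir y x) (η f y - a y) = normalPart (dir x y) (η f y - a y) := by
      have : dir y x = -dir x y := by
        rw [dir, dir, dist_comm, ← smul_neg, neg_sub]
      have h' : rot (-dir x y) = -rot (dir x y) := by
        ext i
        fin_cases i <;> simp [rot]
      ext w
      simp [this, normalPart, h']
      ring
    rw [h3, dist_comm y x] at h2
    have h4 : ‖normalPart (dir x y) (η f x - a x) - normalPart (dir x y) (η f y - a y)‖ ≤
        K * dist x y + 4 * dist x y := by
      rw [← normalPart_sub]
      refine (norm_normalPart_le (norm_dir hxy) _).trans ?_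
      have : η f x - a x - (η f y - a y) = (η f x - η f y) - (a x - a y) := by abel
      rw [this]
      exact (norm_sub_le _ _).trans (add_le_add (hlip x y) (h.lip x trivial y trivial))
    have h5 : ‖(s f x - a x (t x)) • innerSL ℝ (t x)‖ ≤ 4 * dist x y := by
      rw [norm_smul_innerSL (ht x)]
      linarith [hs x hx, hrd x y hy hxy]
    have h6 : ‖(s f y - a y (t y)) • innerSL ℝ (t y)‖ ≤ 4 * dist x y := by
      rw [norm_smul_innerSL (ht y)]
      have := hrd y x hx hxy.symm
      rw [dist_comm] at this
      linarith [hs y hy]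
    have h7 := h.lip x trivial y trivial
    beta_reduce
    rw [he x, he y]
    set A := (s f x - a x (t x)) • innerSL ℝ (t x)
    set B := (s f y - a y (t y)) • innerSL ℝ (t y)
    set P := normalPart (t x) (η f x - a x)
    set P' := normalPart (dir x y) (η f x - a x)
    set Q := normalPart (t y) (η f y - a y)
    set Q' := normalPart (dir x y) (η f y - a y)
    have h8 : a x + (A + P) - (a y + (B + Q)) =
        ((a x - a y) + A + -B) + ((P - P') + (P' - Q') + -(Q - Q')) := by abel
    rw [h8]
    refine (norm_add_le _ _).trans ?_
    have h9 := norm_add₃_le (a := a x - a y) (b := A) (c := -B)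
    have h10 := norm_add₃_le (a := P - P') (b := P' - Q') (c := -(Q - Q'))
    rw [norm_neg] at h9 h10
    linarith
  · rcases eq_or_ne x y with rfl | hxy
    · simp
    have h1 := h.taylor x trivial y trivial
    rw [← hfx x hx, ← hfx y hy] at h1
    have h2 := hb x hx y hy
    have hd : ‖y - x‖ = dist x y := by rw [dist_comm, dist_eq_norm]
    have h3 : |(s f x - a x (t x)) * inner ℝ (t x) (y - x)| ≤ 4 * dist x y * dist x y := by
      rw [abs_mul]
      have h4 := abs_inner_le (ht x) (y - x)
      rw [hd] at h4
      have h5 : |s f x - a x (t x)| ≤ 4 * dist x y := by linarith [hs x hx, hrd x y hy hxy]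
      gcongr
    have h4 : |(η f x - a x) (rot (t x)) * inner ℝ (rot (t x)) (y - x)| ≤ K * dist x y ^ 2 := by
      rw [abs_mul]
      refine le_trans ?_ h2
      have := abs_apply_le (by rw [norm_rot, ht x] : ‖rot (t x)‖ = 1) (η f x - a x)
      gcongr
    beta_reduce
    rw [he x]
    have h5 : f y - f x - (a x + ((s f x - a x (t x)) • innerSL ℝ (t x) +
        normalPart (t x) (η f x - a x))) (y - x) = (f y - f x - a x (y - x)) +
        -((s f x - a x (t x)) * inner ℝ (t x) (y - x)) +
        -((η f x - a x) (rot (t x)) * inner ℝ (rot (t x)) (y - x)) := by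
      simp only [add_apply, smul_apply, innerSL_apply_apply, smul_eq_mul, normalPart]
      ring
    rw [h5]
    refine (abs_add_three _ _ _).trans ?_
    rw [abs_neg, abs_neg]
    nlinarith [sq_nonneg (dist x y), mul_nonneg hK (sq_nonneg (dist x y))]

/-- A nonnegative `C²` function with its gradients satisfies Whitney's conditions. -/
lemma whitneyData_of_c2BddBy {F : E2 → ℝ} (h0 : ∀ x, 0 ≤ F x) (hF : C2BddBy F 1) :
    WhitneyData univ F (fderiv ℝ F) 4 := by
  have hd : Differentiable ℝ F := hF.1.differentiable (by norm_num)
  have hd2 : Differentiable ℝ (fderiv ℝ F) :=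
    (hF.1.fderiv_right (m := 1) (by norm_num)).differentiable (by norm_num)
  have hJ : ∀ x, JetBdd F x 1 1 := fun x i hi => by simpa using hF.2 x i hi
  have hlip : ∀ x y, ‖fderiv ℝ F x - fderiv ℝ F y‖ ≤ 1 * ‖x - y‖ := fun x y =>
    Convex.norm_image_sub_le_of_norm_fderiv_le (𝕜 := ℝ) (s := univ) (fun q _ => hd2 q)
      (fun q _ => by simpa using (jetBdd_iff.1 (hJ q)).2.2) convex_univ (mem_univ y) (mem_univ x)
  have htaylor : ∀ x y, |F y - F x - fderiv ℝ F x (y - x)| ≤ ‖y - x‖ ^ 2 := by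
    intro x y
    have := Convex.norm_image_sub_le_of_norm_fderiv_le' (𝕜 := ℝ) (s := Metric.closedBall x ‖y - x‖)
      (f := F) (φ := fderiv ℝ F x) (C := ‖y - x‖) (x := x) (y := y) (fun q _ => hd q)
      (fun q hq => by
        rw [Metric.mem_closedBall, dist_eq_norm] at hq
        linarith [hlip q x]) (convex_closedBall _ _) (by simp) (by simp [dist_eq_norm])
    rw [sq]
    exact this
  refine ⟨fun x _ => h0 x, fun x _ => ?_, fun x _ => ?_, fun x _ y _ => ?_, fun x _ y _ => ?_⟩
  · have := (jetBdd_iff.1 (hJ x)).1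
    have := le_abs_self (F x)
    rw [Real.norm_eq_abs] at *
    linarith
  · suffices h : ‖fderiv ℝ F x‖ ≤ 2 * √(F x) by
      calc _ ≤ (2 * √(F x)) ^ 2 := pow_le_pow_left₀ (norm_nonneg _) h 2
        _ = 4 * F x := by rw [mul_pow, Real.sq_sqrt (h0 x)]; norm_num
    refine ContinuousLinearMap.opNorm_le_bound _ (by positivity) fun v => ?_
    have hq : ∀ c : ℝ, 0 ≤ ‖v‖ ^ 2 * (c * c) + fderiv ℝ F x v * c + F x := fun c => by
      have h1 := (abs_le.1 (htaylor x (x + c • v))).2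
      have h2 := h0 (x + c • v)
      rw [add_sub_cancel_left, map_smul, smul_eq_mul, norm_smul, mul_pow, Real.norm_eq_abs,
        sq_abs] at h1
      linarith
    have := discrim_le_zero hq
    rw [discrim] at this
    refine abs_le_of_sq_le_sq ?_ (by positivity)
    rw [mul_pow, mul_pow, Real.sq_sqrt (h0 x)]
    linarith
  · have := hlip x y
    rw [← dist_eq_norm x y] at this
    linarith [dist_nonneg (x := x) (y := y)]
  · have := htaylor x y
    rw [← dist_eq_norm y x, dist_comm] at this
    linarith [sq_nonneg (dist x y)]

end Selection

section Extension

/-- A nonnegative extension operator of bounded depth on two-jets. -/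
theorem exists_extension_operator : ∃ (N : ℕ) (C : ℝ), ∀ E : Set E2, E.Finite →
    ∃ Ψ : (E2 → ℝ) → E2 → ℝ,
      (∀ p, ∃ S : Set E2, S ⊆ E ∧ S.ncard ≤ N ∧ ∀ f g, EqOn f g S → Ψ f =ᶠ[𝓝 p] Ψ g) ∧
      ∀ f F, (∀ x, 0 ≤ F x) → C2BddBy F 1 → EqOn F f E →
        (∀ p, 0 ≤ Ψ f p) ∧ C2BddBy (Ψ f) C ∧ ∀ x ∈ E, Ψ f x = f x := by
  obtain ⟨N₁, K, hK, hsel⟩ := exists_gradient_selection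
  obtain ⟨N₂, C, hext⟩ := exists_whitney_extension hK
  refine ⟨N₂ * (N₁ + 1) + 1, max C 1, fun E hE => ?_⟩
  rcases E.subsingleton_or_nontrivial with hs | hne
  · refine ⟨fun f => Classical.epsilon fun F : E2 → ℝ => (∀ x, 0 ≤ F x) ∧ C2BddBy F 1 ∧
      EqOn F (E.indicator f) E, fun p => ⟨E, subset_rfl, ?_, fun f g hfg => ?_⟩,
      fun f F h0 hF hFf => ?_⟩
    · have := hE.to_subtype
      exact (ncard_le_one_iff_subsingleton.2 hs).trans (by lia)
    · beta_reduce
      rw [indicator_congr hfg]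
    · have hi : EqOn (E.indicator f) f E := fun x hx => indicator_of_mem hx f
      obtain ⟨h1, h2, h3⟩ := Classical.epsilon_spec (p := fun F : E2 → ℝ => (∀ x, 0 ≤ F x) ∧
        C2BddBy F 1 ∧ EqOn F (E.indicator f) E) ⟨F, h0, hF, hFf.trans hi.symm⟩
      exact ⟨h1, ⟨h2.1, fun x i hi => (h2.2 x i hi).trans (le_max_right _ _)⟩,
        h3.trans hi⟩
  · obtain ⟨ξ, hξloc, hξ⟩ := hsel E hE hne
    obtain ⟨Φ, hΦloc, hΦ⟩ := hext E hE hne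
    classical
    choose! S hSE hSN hS using hξloc
    refine ⟨fun f => Φ f (ξ f), fun p => ?_, fun f F h0 hF hFf => ?_⟩
    · obtain ⟨T, hTE, hTN, hT⟩ := hΦloc p
      refine ⟨T.biUnion fun x => insert x (S x), ?_, ?_, fun f g hfg => ?_⟩
      · intro y hy
        obtain ⟨x, hx, hy⟩ := Finset.mem_biUnion.1 (Finset.mem_coe.1 hy)
        rcases Finset.mem_insert.1 hy with rfl | hy
        · exact hTE hx
        · exact hSE x (hTE hx) hy
      · rw [ncard_coe_finset]
        refine (Finset.card_biUnion_le_card_mul _ _ (N₁ + 1) fun x hx => ?_).trans ?_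
        · exact (Finset.card_insert_le _ _).trans (Nat.succ_le_succ (hSN x (hTE hx)))
        · have := Nat.mul_le_mul_right (N₁ + 1) hTN
          lia
      · have hm : ∀ x ∈ T, ∀ y ∈ insert x (S x), f y = g y := fun x hx y hy =>
          hfg (Finset.mem_coe.2 (Finset.mem_biUnion.2 ⟨x, hx, hy⟩))
        exact hT _ _ _ _ (fun x hx => hm x hx x (Finset.mem_insert_self _ _)) fun x hx =>
          hS x (hTE hx) f g fun y hy => hm x hx y (Finset.mem_insert_of_mem hy)
    · obtain ⟨h1, h2, h3⟩ := hΦ f (ξ f) (hξ f F _ (whitneyData_of_c2BddBy h0 hF) hFf)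
      exact ⟨h1, ⟨h2.1, fun x i hi => (h2.2 x i hi).trans (le_max_left _ _)⟩, h3⟩

lemma c2BddBy_const_mul {F : E2 → ℝ} {A c : ℝ} (hF : C2BddBy F A) (hc : 0 ≤ c) :
    C2BddBy (fun x => c * F x) (c * A) := by
  refine ⟨contDiff_const.mul hF.1, fun x i hi => ?_⟩
  have : (fun x => c * F x) = c • F := rfl
  rw [this, iteratedFDeriv_const_smul_apply (hF.1.of_le (by exact_mod_cast hi)).contDiffAt,
    norm_smul, Real.norm_of_nonneg hc]
  have := hF.2 x i hi
  gcongr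

lemma c2BddBy_mono {F : E2 → ℝ} {A B : ℝ} (hF : C2BddBy F A) (h : A ≤ B) : C2BddBy F B :=
  ⟨hF.1, fun x i hi => (hF.2 x i hi).trans h⟩

lemma c2BddBy_const {c : ℝ} (hc : 0 ≤ c) : C2BddBy (fun _ => c) c :=
  ⟨contDiff_const, fun x i hi => by
    simpa [abs_of_nonneg hc] using jetBdd_const c x zero_le_one i hi⟩

/-- Nonnegative functions on finite sets have nonnegative `C²` extensions. -/
lemma exists_extension {E : Set E2} (hE : E.Finite) {f : E2 → ℝ} (hf : ∀ y ∈ E, 0 ≤ f y) :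
    ∃ M, 0 ≤ M ∧ ∃ F : E2 → ℝ, (∀ y, 0 ≤ F y) ∧ (∀ x ∈ E, F x = f x) ∧ C2BddBy F M := by
  rcases E.subsingleton_or_nontrivial with hs | hne
  · rcases hs.eq_empty_or_singleton with rfl | ⟨x, rfl⟩
    · exact ⟨0, le_rfl, fun _ => 0, by simp, by simp, c2BddBy_const le_rfl⟩
    · have := hf x rfl
      exact ⟨f x, this, fun _ => f x, fun _ => this, by simp, c2BddBy_const this⟩
  · obtain ⟨K₁, hK₁⟩ := (hE.image f).bddAbove
    obtain ⟨K₂, hK₂⟩ := ((hE.prod hE).image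
      fun q : E2 × E2 => |f q.2 - f q.1| / dist q.1 q.2 ^ 2).bddAbove
    obtain ⟨K, hK⟩ : ∃ K, K = max 1 (max K₁ K₂) := ⟨_, rfl⟩
    have h1 : 1 ≤ K := hK ▸ le_max_left _ _
    have h2 : K₁ ≤ K := hK ▸ (le_max_left _ _).trans (le_max_right _ _)
    have h3 : K₂ ≤ K := hK ▸ (le_max_right _ _).trans (le_max_right _ _)
    have hW : WhitneyData E f 0 K := by
      refine ⟨hf, fun x hx => (hK₁ (mem_image_of_mem f hx)).trans h2, fun x hx => ?_,
        fun x _ y _ => ?_, fun x hx y hy => ?_⟩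
      · simpa using mul_nonneg (zero_le_one.trans h1) (hf x hx)
      · simp only [Pi.zero_apply, sub_zero, norm_zero]
        positivity
      · rcases eq_or_ne x y with rfl | hxy
        · simp
        · have := (hK₂ (mem_image_of_mem _ (mk_mem_prod hx hy))).trans h3
          have hd := dist_pos.2 hxy
          simpa using (div_le_iff₀ (by positivity)).1 this
    obtain ⟨_, C, hC⟩ := exists_whitney_extension h1
    obtain ⟨Φ, -, hΦ⟩ := hC E hE hne
    obtain ⟨h4, h5, h6⟩ := hΦ f 0 hW
    exact ⟨max C 0, le_max_right _ _, Φ f 0, h4, h6, c2BddBy_mono h5 (le_max_left _ _)⟩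

/-- The two-jet of a function. -/
noncomputable def jet (F : E2 → ℝ) (x : E2) : Jet2 :=
  (F x, fderiv ℝ F x, fderiv ℝ (fderiv ℝ F) x)

lemma jet_congr {F G : E2 → ℝ} {x : E2} (h : F =ᶠ[𝓝 x] G) : jet F x = jet G x := by
  rw [jet, jet, h.eq_of_nhds, h.fderiv_eq, h.fderiv.fderiv_eq]

lemma exists_of_posTraceNorm_lt {E : Set E2} (hE : E.Finite) {f : E2 → ℝ}
    (hf : ∀ y ∈ E, 0 ≤ f y) {M : ℝ} (h : posTraceNorm E f < M) :
    ∃ F : E2 → ℝ, (∀ y, 0 ≤ F y) ∧ (∀ x ∈ E, F x = f x) ∧ C2BddBy F M := by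
  obtain ⟨A, ⟨-, F, h1, h2, h3⟩, hA⟩ := exists_lt_of_csInf_lt (exists_extension hE hf) h
  exact ⟨F, h1, h2, c2BddBy_mono h3 hA.le⟩

end Extension

end PosInterp

open PosInterp in
/-- Bounded-depth family of two-jet valued maps `Ξ_x` realized by
a single nonnegative `C²` interpolant. -/
theorem statement1 :
    ∃ (C : ℝ) (D : ℕ), 0 < C ∧
      ∀ E : Set E2, E.Finite →
        ∃ Ξ : E2 → (E2 → ℝ) → ℝ → Jet2,
          (∀ x : E2, ∃ S : Set E2, S ⊆ E ∧ S.ncard ≤ D ∧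
            ∀ (M : ℝ) (f g : E2 → ℝ), 0 ≤ M →
              (∀ y ∈ E, 0 ≤ f y) → (∀ y ∈ E, 0 ≤ g y) →
              Set.EqOn f g S → Ξ x f M = Ξ x g M) ∧
          (∀ (f : E2 → ℝ) (M : ℝ), 0 ≤ M → (∀ y ∈ E, 0 ≤ f y) →
            posTraceNorm E f ≤ M →
              ∃ F : E2 → ℝ, (∀ y, 0 ≤ F y) ∧ C2BddBy F (C * M) ∧
                (∀ x ∈ E, F x = f x) ∧
                ∀ x : E2, JetPlusEq F x (Ξ x f M)) := by
  obtain ⟨N, C, hNC⟩ := exists_extension_operator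
  refine ⟨2 * max C 1, N, by positivity, fun E hE => ?_⟩
  obtain ⟨Ψ, hloc, hΨ⟩ := hNC E hE
  let G : (E2 → ℝ) → ℝ → E2 → ℝ := fun f M p => 2 * M * Ψ (fun y => (2 * M)⁻¹ * f y) p
  refine ⟨fun x f M => jet (G f M) x, fun x => ?_, fun f M hM hf hfM =>
    ⟨G f M, ?_⟩⟩
  · obtain ⟨S, hSE, hSN, hS⟩ := hloc x
    refine ⟨S, hSE, hSN, fun M f g _ _ _ hfg => jet_congr ?_⟩
    filter_upwards [hS (fun y => (2 * M)⁻¹ * f y) (fun y => (2 * M)⁻¹ * g y)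
      fun y hy => by simp only [hfg hy]] with p hp
    simp only [G, hp]
  rcases hM.eq_or_lt with rfl | hM
  · have hG : G f 0 = fun _ => 0 := by
      funext p
      simp [G]
    beta_reduce
    rw [hG]
    refine ⟨fun _ => le_rfl, by simpa using c2BddBy_const le_rfl, fun x hx => ?_,
      fun x => ⟨rfl, rfl, rfl⟩⟩
    refine le_antisymm (hf x hx) (le_of_forall_pos_le_add fun ε hε => ?_)
    obtain ⟨F, h1, h2, h3⟩ := exists_of_posTraceNorm_lt hE hf (hfM.trans_lt hε)
    have := h3.2 x 0 (by norm_num)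
    rw [norm_iteratedFDeriv_zero, h2 x hx] at this
    linarith [le_abs_self (f x), Real.norm_eq_abs (f x)]
  · have hM2 : 0 < 2 * M := by positivity
    obtain ⟨F, h1, h2, h3⟩ := exists_of_posTraceNorm_lt hE hf (M := 2 * M) (by linarith)
    obtain ⟨h4, h5, h6⟩ := hΨ (fun y => (2 * M)⁻¹ * f y) (fun y => (2 * M)⁻¹ * F y)
      (fun y => mul_nonneg (by positivity) (h1 y))
      (inv_mul_cancel₀ hM2.ne' ▸ c2BddBy_const_mul h3 (inv_pos.2 hM2).le)
      (fun y hy => by simp only [h2 y hy])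
    refine ⟨fun p => mul_nonneg hM2.le (h4 p), ?_, fun x hx => ?_, fun x => ⟨rfl, rfl, rfl⟩⟩
    · refine c2BddBy_mono (c2BddBy_const_mul h5 hM2.le) ?_
      calc 2 * M * C ≤ 2 * M * max C 1 := by gcongr; exact le_max_left _ _
        _ = _ := by ring
    · simp only [G, h6 x hx]
      field_simp
end
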